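/- If A ⊂ ℝ² is a Borel set with Hausdorff dimension s ∈ (1, 4/3), then the distance set Δ(A) satisfies dimH(Δ(A)) ≥ s(147 − 170s + 60s²) / (18(12 − 14s + 5s²)), and this lower bound is at least 37/54. -/

import Mathlib

open MeasureTheory Set

/-- Admissible branching functions: `F j + j` is monotone, `F j - j` is almost monotone decreasing,
and `F` grows at least with slope `σ`. -/
structure Branch (σ : ℝ) (N : ℕ) (F : ℕ → ℝ) : Prop where
  zero : F 0 = 0
  lower : ∀ i j : ℕ, i ≤ j → j ≤ N → F i - ((j : ℝ) - i) ≤ F j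
  upper : ∀ i j : ℕ, i ≤ j → j ≤ N → F j ≤ F i + ((j : ℝ) - i) + 2
  growth : ∀ j : ℕ, j ≤ N → σ * j - 2 ≤ F j

/-- Chains of scales along which the mass of a strip can be controlled, with their total loss. -/
inductive Tube (G : ℕ → ℝ) (C : ℝ) (t : ℕ) : ℕ → ℝ → Prop
  | zero : Tube G C t 0 0
  | step (c c' : ℕ) (l e : ℝ) : Tube G C t c l → c ≤ c' → c' ≤ c + t →
      (∀ u, c ≤ u → u ≤ c' → G c - G u ≤ e) → Tube G C t c' (l + e + C)

/-- Chains of scales along which the covering number of a pinned fibre can be controlled, with their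
total loss. -/
inductive Node (F G : ℕ → ℝ) (C : ℝ) (M : ℕ) : ℕ → ℝ → Prop
  | base : Node F G C M M M
  | step (a b : ℕ) (l e : ℝ) : Node F G C M a l → a ≤ b →
      (∀ t, a ≤ t → t ≤ b → ∃ l', Tube G C t (b - t) l' ∧ F a - F t + l' ≤ e) →
      Node F G C M b (l + e + C)

theorem exists_chain_of_block_step {T : ℕ → ℝ → Prop} {H : ℕ → ℝ} {E : ℝ} {M N x c : ℕ} {l : ℝ}
    (hM : 1 ≤ M) (hE : 0 ≤ E) (hxc : x ≤ c) (hcN : c ≤ N)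
    (hstep : ∀ a b l, x ≤ a → a ≤ b → b ≤ a + M → b ≤ N → T a l →
      T b (l + (H a - H b) / 2 + E)) (hT : T x l) :
    ∃ l', T c l' ∧ l' ≤ l + (H x - H c) / 2 + E * (((c : ℝ) - x) / M + 1) := by
  have hM' : (0 : ℝ) < M := by exact_mod_cast hM
  suffices h : ∀ n : ℕ, ∀ c, c = x + n → c ≤ N →
      ∃ l', T c l' ∧ l' ≤ l + (H x - H c) / 2 + E * ((n : ℝ) / M + 1) by
    obtain ⟨l', h1, h2⟩ := h (c - x) c (by omega) hcN
    refine ⟨l', h1, ?_⟩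
    rwa [Nat.cast_sub hxc] at h2
  intro n
  induction n using Nat.strong_induction_on with
  | _ n ih =>
    intro c hc hcN
    by_cases hn : n ≤ M
    · refine ⟨_, hstep x c l le_rfl (by omega) (by omega) hcN hT, ?_⟩
      have : 0 ≤ E * ((n : ℝ) / M) := by positivity
      linarith
    · obtain ⟨l', h1, h2⟩ := ih (n - M) (by omega) (c - M) (by omega) (by omega)
      refine ⟨_, hstep (c - M) c l' (by omega) (by omega) (by omega) hcN h1, ?_⟩
      rw [Nat.cast_sub (by omega)] at h2
      have : ((n : ℝ) - M) / M = n / M - 1 := by field_simp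
      rw [this] at h2
      linarith

namespace Branch

variable {σ : ℝ} {N : ℕ} {F G : ℕ → ℝ}

theorem neg_two_le (h : Branch σ N G) (hσ : 0 ≤ σ) {j : ℕ} (hj : j ≤ N) : -2 ≤ G j := by
  have := h.growth j hj
  have : 0 ≤ σ * j := by positivity
  linarith

theorem sub_le_half (h : Branch σ N G) {a u b : ℕ} (hau : a ≤ u) (hub : u ≤ b) (hb : b ≤ N) :
    G a - G u ≤ ((G a - a) - (G b - b)) / 2 + 1 := by
  have h1 := h.lower a u hau (by omega)
  have h2 := h.upper u b hub hb
  linarith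

theorem tube_first (h : Branch σ N G) (hσ : 0 ≤ σ) {C : ℝ} {t c : ℕ} (hct : c ≤ t) (hc : c ≤ N) :
    Tube G C t c (0 + 2 + C) := by
  refine Tube.step 0 c 0 2 Tube.zero (Nat.zero_le _) (by omega) fun u _ hu => ?_
  have := h.neg_two_le hσ (hu.trans hc)
  rw [h.zero]; linarith

theorem exists_pred (h : Branch σ N G) {t x : ℕ} (hx : t ≤ x) (hxN : x ≤ N)
    (hG : (x : ℝ) - t + 2 < G x) :
    ∃ u, x - t ≤ u ∧ u < x ∧ (∀ w, u ≤ w → w ≤ x → G u ≤ G w) ∧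
      (∀ w, x - t ≤ w → w < u → G u < G w) := by
  classical
  obtain ⟨v, hv, hvmin⟩ := Finset.exists_min_image (Finset.Icc (x - t) x) G ⟨x, by simp⟩
  have hex : ∃ u, x - t ≤ u ∧ u ≤ x ∧ ∀ w, x - t ≤ w → w ≤ x → G u ≤ G w :=
    ⟨v, (Finset.mem_Icc.1 hv).1, (Finset.mem_Icc.1 hv).2,
      fun w h1 h2 => hvmin w (Finset.mem_Icc.2 ⟨h1, h2⟩)⟩
  obtain ⟨h1, h2, h3⟩ := Nat.find_spec hex
  refine ⟨Nat.find hex, h1, lt_of_le_of_ne h2 ?_, fun w hw hwx => h3 w (h1.trans hw) hwx, ?_⟩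
  · intro heq
    have h4 := h3 (x - t) le_rfl (by omega)
    rw [heq] at h4
    have h5 := h.upper 0 (x - t) (Nat.zero_le _) (by omega)
    rw [h.zero, Nat.cast_sub hx] at h5
    push_cast at h5
    linarith
  · intro w hw hwu
    have h4 := Nat.find_min hex hwu
    push Not at h4
    obtain ⟨w', h5, h6, h7⟩ := h4 hw (by omega)
    exact (h3 w' h5 h6).trans_lt h7

theorem exists_tube_of_forall_lt (h : Branch σ N G) (hσ : 0 ≤ σ) {C : ℝ} (hC : 0 ≤ C) {t : ℕ}
    (x : ℕ) (hxN : x ≤ N) (hG : ∀ v : ℕ, t ≤ v → v ≤ x → (v : ℝ) - t + 2 < G v) :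
    ∃ l, Tube G C t x l ∧ l * t ≤ (C + 2) * (2 * x + 2 * t) := by
  induction x using Nat.strong_induction_on with
  | _ x ih =>
    have ht0 : (0 : ℝ) ≤ t := by positivity
    by_cases hx : x ≤ t
    · refine ⟨_, h.tube_first hσ hx hxN, ?_⟩
      have : (0 : ℝ) ≤ x := by positivity
      nlinarith
    push Not at hx
    have hx' : (t : ℝ) < x := by exact_mod_cast hx
    obtain ⟨u, hu1, hu2, hu3, hu4⟩ := h.exists_pred hx.le hxN (hG x hx.le le_rfl)
    have hstep : ∀ {l}, Tube G C t u l → Tube G C t x (l + 0 + C) := fun hl =>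
      Tube.step u x _ 0 hl hu2.le (by omega) fun w h1 h2 => by linarith [hu3 w h1 h2]
    by_cases hut : u ≤ t
    · refine ⟨_, hstep (h.tube_first hσ hut (by omega)), ?_⟩
      nlinarith
    push Not at hut
    obtain ⟨v, hv1, hv2, hv3, hv4⟩ := h.exists_pred hut.le (by omega) (hG u hut.le hu2.le)
    have hvx : v < x - t := by
      by_contra hcon
      push Not at hcon
      have h1 := hu4 v hcon hv2
      have h2 := hv3 u hv2.le le_rfl
      linarith
    obtain ⟨l, hl1, hl2⟩ := ih v (by omega) (by omega) fun w h1 h2 => hG w h1 (by omega)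
    refine ⟨_, hstep (Tube.step v u _ 0 hl1 hv2.le (by omega)
      fun w h1 h2 => by linarith [hv3 w h1 h2]), ?_⟩
    have hvx' : (v : ℝ) + t ≤ x := by exact_mod_cast (by omega : v + t ≤ x)
    nlinarith

theorem exists_tube (h : Branch σ N G) (hσ : 0 ≤ σ) {C : ℝ} (hC : 0 ≤ C) {M t c : ℕ}
    (hN : N = M * M) (hM : 1 ≤ M) (hMt : M ≤ t) (hc : c ≤ N) :
    ∃ l, Tube G C t c l ∧ l ≤ max 0 ((1 - σ) / 2 * c - t / 2) + 12 * (C + 2) * M := by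
  classical
  have hM' : (1 : ℝ) ≤ M := by exact_mod_cast hM
  have hMt' : (M : ℝ) ≤ t := by exact_mod_cast hMt
  have bound : ∀ {x : ℕ} {l : ℝ}, x ≤ N → l * t ≤ (C + 2) * (2 * x + 2 * t) →
      l ≤ 4 * (C + 2) * M := by
    intro x l hx hl
    have h1 : (x : ℝ) ≤ M * M := by exact_mod_cast hN ▸ hx
    have h2 : (x : ℝ) ≤ M * t := h1.trans (by gcongr)
    have h3 : l * t ≤ (4 * (C + 2) * M) * t := by
      refine hl.trans ?_
      have : (2 * (x : ℝ) + 2 * t) ≤ 4 * M * t := by nlinarith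
      nlinarith
    exact le_of_mul_le_mul_right h3 (by linarith)
  by_cases hcross : ∃ v : ℕ, t ≤ v ∧ v ≤ c ∧ G v ≤ (v : ℝ) - t + 2
  · obtain ⟨hx1, hx2, hx3⟩ := Nat.find_spec hcross
    set x := Nat.find hcross with hx
    have hbefore : ∀ v : ℕ, t ≤ v → v ≤ x - 1 → (v : ℝ) - t + 2 < G v := by
      intro v h1 h2
      have := Nat.find_min hcross (m := v) (by omega)
      push Not at this
      exact this h1 (by omega)
    obtain ⟨l, hl1, hl2⟩ := h.exists_tube_of_forall_lt hσ hC (x - 1) (by omega) hbefore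
    have hl3 := bound (by omega) hl2
    have hl4 : Tube G C t x (l + 1 + C) := by
      refine Tube.step (x - 1) x l 1 hl1 (by omega) (by omega) fun u h1 h2 => ?_
      have := h.lower (x - 1) u h1 (by omega)
      have h3 : (u : ℝ) ≤ ((x - 1 : ℕ) : ℝ) + 1 := by exact_mod_cast (by omega : u ≤ x - 1 + 1)
      linarith
    obtain ⟨l', h1, h2⟩ := exists_chain_of_block_step (T := Tube G C t) (H := fun j => G j - j)
      (E := 1 + C) (c := c) hM (by linarith) hx2 hc (fun a b l hxa hab hbM hbN hT => by
        have := Tube.step a b l (((G a - a) - (G b - b)) / 2 + 1) hT hab (by omega)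
          fun u h1 h2 => h.sub_le_half h1 h2 hbN
        convert this using 1; ring) hl4
    refine ⟨l', h1, h2.trans ?_⟩
    have h3 := h.growth c hc
    have h4 : ((c : ℝ) - x) / M ≤ M := by
      rw [div_le_iff₀ (by linarith)]
      have : (c : ℝ) ≤ M * M := by exact_mod_cast hN ▸ hc
      have : (0 : ℝ) ≤ x := by positivity
      linarith
    have h5 : (1 + C) * (((c : ℝ) - x) / M + 1) ≤ (1 + C) * (M + 1) := by gcongr
    have h6 := le_max_right 0 ((1 - σ) / 2 * (c : ℝ) - t / 2)
    nlinarith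
  · push Not at hcross
    obtain ⟨l, hl1, hl2⟩ := h.exists_tube_of_forall_lt hσ hC c hc hcross
    refine ⟨l, hl1, (bound hc hl2).trans ?_⟩
    have h6 := le_max_left 0 ((1 - σ) / 2 * (c : ℝ) - t / 2)
    nlinarith

theorem node_blocks (hF : Branch σ N F) (hG : Branch σ N G) (hσ : 0 ≤ σ) {C : ℝ} (hC : 0 ≤ C)
    {M b : ℕ} (hN : N = M * M) (hM : 1 ≤ M) (hMb : M ≤ b) (hb : b ≤ N) :
    ∃ l, Node F G C M b l ∧ l ≤ ((b : ℝ) - F b) / 2 + 6 * (C + 2) * M := by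
  have hM' : (1 : ℝ) ≤ M := by exact_mod_cast hM
  obtain ⟨l', h1, h2⟩ := exists_chain_of_block_step (T := Node F G C M) (H := fun j => F j - j)
    (E := 2 * C + 3) hM (by linarith) hMb hb (fun a b l hMa hab hbM hbN hT => by
      have := Node.step a b l (((F a - a) - (F b - b)) / 2 + 1 + (0 + 2 + C)) hT hab
        fun t h1 h2 => ⟨_, hG.tube_first hσ (by omega) (by omega), by
          linarith [hF.sub_le_half h1 h2 hbN]⟩
      convert this using 1; ring) Node.base
  refine ⟨l', h1, h2.trans ?_⟩
  have h3 := hF.upper 0 M (Nat.zero_le _) (hMb.trans hb)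
  rw [hF.zero] at h3
  have h4 : ((b : ℝ) - M) / M ≤ M := by
    rw [div_le_iff₀ (by linarith)]
    have : (b : ℝ) ≤ M * M := by exact_mod_cast hN ▸ hb
    linarith
  have h5 : (2 * C + 3) * (((b : ℝ) - M) / M + 1) ≤ (2 * C + 3) * (M + 1) := by gcongr
  push_cast at h3
  nlinarith

theorem node_long (hG : Branch σ N G) (hσ : 0 ≤ σ) {C : ℝ} (hC : 0 ≤ C)
    {M a b : ℕ} {l e : ℝ} (hN : N = M * M) (hM : 1 ≤ M) (hMa : M ≤ a) (hab : a ≤ b) (hb : b ≤ N)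
    (hl : Node F G C M a l)
    (he : ∀ t : ℕ, a ≤ t → t ≤ b → F a - F t + max 0 ((1 - σ) / 2 * (b - t) - t / 2) ≤ e) :
    Node F G C M b (l + (e + 12 * (C + 2) * M) + C) := by
  refine Node.step a b l _ hl hab fun t h1 h2 => ?_
  obtain ⟨l', h3, h4⟩ := hG.exists_tube hσ hC hN hM (hMa.trans h1) (c := b - t) (by omega)
  refine ⟨l', h3, ?_⟩
  rw [Nat.cast_sub h2] at h4
  linarith [he t h1 h2]

theorem exists_node_of_le (hF : Branch σ N F) (hG : Branch σ N G) (hσ : 0 < σ) (hσ1 : σ < 1)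
    {C : ℝ} (hC : 0 ≤ C) {M r : ℕ} {m : ℝ} (hN : N = M * M) (hM : 1 ≤ M) (hMr : M ≤ r) (hr : r ≤ N)
    (hm2 : -2 ≤ m) (hm : ∀ t : ℕ, (1 - σ) / (2 - σ) * r ≤ t → t ≤ r → m ≤ F t) :
    ∃ l, Node F G C M r l ∧
      l ≤ ((1 - σ) / 2 * (1 + σ) * r - m) / (2 + σ) + 30 * (C + 2) * M := by
  classical
  have hM' : (1 : ℝ) ≤ M := by exact_mod_cast hM
  have hMr' : (M : ℝ) ≤ r := by exact_mod_cast hMr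
  set B := ((1 - σ) / 2 * (1 + σ) * r - m) / (2 + σ) with hB
  have hBeq : B * (2 + σ) = (1 - σ) / 2 * (1 + σ) * r - m := by
    rw [hB]; field_simp
  have hpr : (1 - σ) / (2 - σ) * r ≤ r := by
    have : (1 - σ) / (2 - σ) ≤ 1 := by rw [div_le_one (by linarith)]; linarith
    nlinarith
  have hp : (2 - σ) * ((1 - σ) / (2 - σ) * r) = (1 - σ) * r := by
    have : 2 - σ ≠ 0 := by linarith
    field_simp
  have hCM : (C + 2) * 1 ≤ (C + 2) * M := by gcongr
  have hCM0 : 0 ≤ C * M := by positivity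
  by_cases hex : ∃ a : ℕ, M ≤ a ∧ a ≤ r ∧ 2 * (B + m) ≤ a + F a
  · obtain ⟨h1, h2, h3⟩ := Nat.find_spec hex
    set a := Nat.find hex with ha
    have ha' : (M : ℝ) ≤ a := by exact_mod_cast h1
    have h4 : a + F a ≤ 2 * (B + m) + 2 * M + 10 := by
      rcases h1.eq_or_lt with h5 | h5
      · have := hF.upper 0 a (Nat.zero_le _) (h2.trans hr)
        rw [hF.zero] at this
        push_cast at this
        have h6 : (a : ℝ) = M := by exact_mod_cast h5.symm
        have h7 : -4 ≤ B + m := by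
          have h8 : (B + m) * (2 + σ) = (1 + σ) * ((1 - σ) / 2 * r + m) := by linarith
          have h9 : 0 ≤ (1 - σ) / 2 * r := by
            have : 0 ≤ 1 - σ := by linarith
            positivity
          by_contra hcon
          push Not at hcon
          nlinarith
        linarith
      · have h6 := Nat.find_min hex (m := a - 1) (by omega)
        push Not at h6
        have h7 := h6 (by omega) (by omega)
        have h8 := hF.upper (a - 1) a (by omega) (h2.trans hr)
        rw [Nat.cast_sub (by omega)] at h7 h8
        push_cast at h7 h8
        linarith
    obtain ⟨l, hl1, hl2⟩ := hF.node_blocks hG hσ.le hC hN hM h1 (h2.trans hr)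
    have hlong := hG.node_long hσ.le hC hN hM h1 h2 hr hl1
      (e := B + (F a - a) / 2 + M + 7) fun t hat htr => ?_
    · refine ⟨_, hlong, ?_⟩
      nlinarith
    · have hat' : (a : ℝ) ≤ t := by exact_mod_cast hat
      by_cases ht : (1 - σ) / (2 - σ) * r ≤ t
      · have h5 := hm t ht htr
        have h6 : (1 - σ) / 2 * ((r : ℝ) - t) - t / 2 ≤ 0 := by nlinarith
        rw [max_eq_left h6]
        linarith
      · push Not at ht
        have h6 : 0 ≤ (1 - σ) / 2 * ((r : ℝ) - t) - t / 2 := by nlinarith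
        rw [max_eq_right h6]
        have h7 := hF.lower a t hat (htr.trans hr)
        have h8 := hF.growth t (htr.trans hr)
        have h9 : (1 + σ / 2) * (a + F a - t) ≤ (1 + σ / 2) * F t := by
          apply mul_le_mul_of_nonneg_left _ (by linarith); linarith
        have h10 : σ / 2 * (σ * t - 2) ≤ σ / 2 * F t := by
          apply mul_le_mul_of_nonneg_left _ (by linarith); linarith
        have h11 : (1 + σ) * ((a + F a) / 2 - F t + ((1 - σ) / 2 * ((r : ℝ) - t) - t / 2)) ≤
            (1 + σ) * (B + 2) := by nlinarith
        have h12 := le_of_mul_le_mul_left h11 (by linarith)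
        linarith
  · push Not at hex
    have h1 := hex r hMr le_rfl
    have h2 := hm r hpr le_rfl
    obtain ⟨l, hl1, hl2⟩ := hF.node_blocks hG hσ.le hC hN hM hMr hr
    refine ⟨l, hl1, ?_⟩
    nlinarith

theorem exists_argmin {p : ℝ} {r : ℕ} (hp : p * r ≤ r) :
    ∃ j : ℕ, p * r ≤ j ∧ j ≤ r ∧ ∀ t : ℕ, p * r ≤ t → t ≤ r → F j ≤ F t := by
  classical
  obtain ⟨v, hv, hvmin⟩ := Finset.exists_min_image
    ((Finset.range (r + 1)).filter fun j : ℕ => p * r ≤ j) F ⟨r, by simpa using hp⟩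
  simp only [Finset.mem_filter, Finset.mem_range] at hv hvmin
  exact ⟨v, hv.2, by omega, fun t h1 h2 => hvmin t ⟨by omega, h1⟩⟩

theorem exists_node (hF : Branch σ N F) (hG : Branch σ N G) (hσ : 0 < σ) (hσ1 : σ < 1)
    {C : ℝ} (hC : 0 ≤ C) {M : ℕ} (hN : N = M * M) (hM : 1 ≤ (1 - σ) / (2 - σ) * M) :
    ∃ l, Node F G C M N l ∧
      l ≤ (1 - σ) ^ 2 / (2 * (2 + σ)) * N + 50 * (C + 2) * M := by
  have hp0 : 0 < (1 - σ) / (2 - σ) := div_pos (by linarith) (by linarith)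
  have hp1 : (1 - σ) / (2 - σ) ≤ 1 := by rw [div_le_one (by linarith)]; linarith
  have hM' : (1 : ℝ) ≤ M := by nlinarith [(Nat.cast_nonneg M : (0 : ℝ) ≤ M)]
  have hM1 : 1 ≤ M := by exact_mod_cast hM'
  have hMN : M ≤ N := by rw [hN]; nlinarith
  have hN' : (N : ℝ) = M * M := by exact_mod_cast hN
  have hCM : (C + 2) * 1 ≤ (C + 2) * M := by gcongr
  have hCM0 : 0 ≤ C * M := by positivity
  have hscale : ∀ r : ℕ, (1 - σ) / (2 - σ) * (r : ℝ) ≤ r := fun r =>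
    mul_le_of_le_one_left (Nat.cast_nonneg r) hp1
  obtain ⟨r₁, h1, h2, h3⟩ := exists_argmin (F := F) (hscale N)
  have h1' : (M : ℝ) ≤ r₁ := by nlinarith
  have hMr : M ≤ r₁ := by exact_mod_cast h1'
  by_cases hr : (1 - σ) * N ≤ r₁
  · obtain ⟨l, hl1, hl2⟩ := hF.exists_node_of_le hG hσ hσ1 hC hN hM1 hMN le_rfl
      (hF.neg_two_le hσ.le h2) h3
    refine ⟨l, hl1, hl2.trans ?_⟩
    have h4 := hF.growth r₁ h2
    have h5 : ((1 - σ) / 2 * (1 + σ) * N - F r₁) / (2 + σ) ≤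
        (1 - σ) ^ 2 / (2 * (2 + σ)) * N + 2 := by
      rw [div_le_iff₀ (by linarith)]
      have : ((1 - σ) ^ 2 / (2 * (2 + σ)) * N + 2) * (2 + σ) =
        (1 - σ) ^ 2 / 2 * N + 2 * (2 + σ) := by field_simp
      rw [this]
      nlinarith
    linarith
  · push Not at hr
    obtain ⟨r₂, h4, h5, h6⟩ := exists_argmin (F := F) (hscale r₁)
    obtain ⟨l, hl1, hl2⟩ := hF.exists_node_of_le hG hσ hσ1 hC hN hM1 hMr h2
      (hF.neg_two_le hσ.le (h5.trans h2)) h6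
    have hlong := hG.node_long hσ.le hC hN hM1 hMr h2 le_rfl hl1 (e := 0) fun t hat htr => ?_
    · refine ⟨_, hlong, ?_⟩
      have h7 := hF.growth r₂ (h5.trans h2)
      have h8 : ((1 - σ) / 2 * (1 + σ) * r₁ - F r₂) / (2 + σ) ≤
          (1 - σ) ^ 2 / (2 * (2 + σ)) * N + 2 := by
        rw [div_le_iff₀ (by linarith)]
        have : ((1 - σ) ^ 2 / (2 * (2 + σ)) * N + 2) * (2 + σ) =
          (1 - σ) ^ 2 / 2 * N + 2 * (2 + σ) := by field_simp
        rw [this]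
        have h9 : (2 - σ) * ((1 - σ) / (2 - σ) * r₁) = (1 - σ) * r₁ := by
          have : 2 - σ ≠ 0 := by linarith
          field_simp
        have h10 : σ * ((1 - σ) / (2 - σ) * r₁) ≤ σ * r₂ := by gcongr
        have h11 : (2 - σ) * ((1 - σ) / 2 * (1 + σ) * r₁ - σ * ((1 - σ) / (2 - σ) * r₁)) ≤
            (2 - σ) * ((1 - σ) ^ 2 / 2 * N) := by
          have : (1 - σ) ^ 2 * (2 + σ) * r₁ ≤ (1 - σ) ^ 2 * (2 + σ) * ((1 - σ) * N) := by
            gcongr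
          have h12 : (1 - σ) ^ 2 * (σ ^ 2) * (N : ℝ) ≥ 0 := by positivity
          nlinarith
        have h13 := le_of_mul_le_mul_left h11 (by linarith)
        linarith
      linarith
    · have h7 := h3 t (h1.trans (by exact_mod_cast hat)) htr
      have hat' : (r₁ : ℝ) ≤ t := by exact_mod_cast hat
      have h8 : (2 - σ) * ((1 - σ) / (2 - σ) * N) = (1 - σ) * N := by
        have : 2 - σ ≠ 0 := by linarith
        field_simp
      have h9 : (1 - σ) / 2 * ((N : ℝ) - t) - t / 2 ≤ 0 := by nlinarith
      rw [max_eq_left h9]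
      linarith

end Branch

theorem mass_filter_lt_card_le {α β γ : Type*} [DecidableEq α] [DecidableEq β]
    (X : Finset α) (Y : Finset β) (S : Finset γ)
    (w : α → ℝ) (v : β → ℝ) (hw : ∀ x, 0 ≤ w x) (hv : ∀ y, 0 ≤ v y) (hv1 : ∑ y ∈ Y, v y ≤ 1)
    (R : α → β → γ → Prop) [∀ x y q, Decidable (R x y q)]
    (lev : β → γ → ℕ) (U : Finset ℕ) (W K : ℕ → ℝ) (hW : ∀ u, 0 ≤ W u) {D V : ℝ} (hD : 0 < D)
    (hlev : ∀ x ∈ X, ∀ y ∈ Y, ∀ q ∈ S, R x y q → lev y q ∈ U)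
    (hWle : ∀ y ∈ Y, ∀ q ∈ S, lev y q ∈ U → ∑ x ∈ X with R x y q, w x ≤ W (lev y q))
    (hK : ∀ y ∈ Y, ∀ u ∈ U,
      ∀ T ⊆ S, (∀ q ∈ T, lev y q = u ∧ ∃ x ∈ X, R x y q) → (T.card : ℝ) ≤ K u)
    (hV : ∑ u ∈ U, K u * W u ≤ V) (hV0 : 0 < V) (E : Finset (α × β)) (hE : E ⊆ X ×ˢ Y) :
    ∑ p ∈ E with D * V < (S.filter (R p.1 p.2)).card, w p.1 * v p.2 ≤ 1 / D := by
  classical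
  have hfib : ∀ y ∈ Y, ∑ x ∈ X, w x * ((S.filter (R x y)).card : ℝ) ≤ V := by
    intro y hy
    calc ∑ x ∈ X, w x * ((S.filter (R x y)).card : ℝ)
        = ∑ q ∈ S, ∑ x ∈ X with R x y q, w x := by
          simp_rw [Finset.card_filter, Nat.cast_sum, Finset.mul_sum]
          rw [Finset.sum_comm]
          refine Finset.sum_congr rfl fun q _ => ?_
          rw [Finset.sum_filter]
          refine Finset.sum_congr rfl fun x _ => ?_
          split_ifs <;> simp
      _ = ∑ q ∈ S with ∃ x ∈ X, R x y q, ∑ x ∈ X with R x y q, w x := by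
          rw [Finset.sum_filter_of_ne]
          intro q _ hne
          by_contra hcon
          push Not at hcon
          apply hne
          rw [Finset.filter_false_of_mem hcon, Finset.sum_empty]
      _ ≤ ∑ q ∈ S with ∃ x ∈ X, R x y q, W (lev y q) := by
          refine Finset.sum_le_sum fun q hq => ?_
          obtain ⟨hqS, x, hx, hR⟩ := Finset.mem_filter.1 hq
          exact hWle y hy q hqS (hlev x hx y hy q hqS hR)
      _ = ∑ u ∈ U, ∑ q ∈ (S.filter fun q => ∃ x ∈ X, R x y q) with lev y q = u,
            W (lev y q) := by
          rw [Finset.sum_fiberwise_of_maps_to]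
          intro q hq
          obtain ⟨hqS, x, hx, hR⟩ := Finset.mem_filter.1 hq
          exact hlev x hx y hy q hqS hR
      _ ≤ ∑ u ∈ U, K u * W u := by
          refine Finset.sum_le_sum fun u hu => ?_
          rw [Finset.sum_congr rfl (g := fun _ => W u) fun q hq => by
            rw [(Finset.mem_filter.1 hq).2], Finset.sum_const, nsmul_eq_mul]
          refine mul_le_mul_of_nonneg_right (hK y hy u hu _ ?_ ?_) (hW u)
          · exact (Finset.filter_subset _ _).trans (Finset.filter_subset _ _)
          · intro q hq
            simp only [Finset.mem_filter] at hq
            exact ⟨hq.2, hq.1.2⟩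
      _ ≤ V := hV
  have htot : ∑ p ∈ X ×ˢ Y, w p.1 * v p.2 * ((S.filter (R p.1 p.2)).card : ℝ) ≤ V := by
    rw [Finset.sum_product_right]
    calc ∑ y ∈ Y, ∑ x ∈ X, w x * v y * ((S.filter (R x y)).card : ℝ)
        = ∑ y ∈ Y, v y * ∑ x ∈ X, w x * ((S.filter (R x y)).card : ℝ) := by
          refine Finset.sum_congr rfl fun y _ => ?_
          rw [Finset.mul_sum]
          exact Finset.sum_congr rfl fun x _ => by ring
      _ ≤ ∑ y ∈ Y, v y * V :=
          Finset.sum_le_sum fun y hy => mul_le_mul_of_nonneg_left (hfib y hy) (hv y)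
      _ = (∑ y ∈ Y, v y) * V := by rw [Finset.sum_mul]
      _ ≤ V := mul_le_of_le_one_left hV0.le hv1
  have hDV : 0 < D * V := by positivity
  have h2 : (∑ p ∈ E with D * V < (S.filter (R p.1 p.2)).card, w p.1 * v p.2) * (D * V) ≤ V := by
    refine le_trans ?_ htot
    rw [Finset.sum_mul]
    refine (Finset.sum_le_sum fun p hp => ?_).trans
      (Finset.sum_le_sum_of_subset_of_nonneg ((Finset.filter_subset _ E).trans hE) fun p _ _ => ?_)
    · exact mul_le_mul_of_nonneg_left (Finset.mem_filter.1 hp).2.le (mul_nonneg (hw _) (hv _))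
    · exact mul_nonneg (mul_nonneg (hw _) (hv _)) (Nat.cast_nonneg _)
  rw [le_div_iff₀ hD]
  exact le_of_mul_le_mul_right (by linarith : _ * V ≤ 1 * V) hV0

theorem sum_filter_exists_lt_le {ι : Type*} (s : Finset ι) (w n : ι → ℝ)
    (valid : ℝ → Prop) (thr : ℝ → ℝ) (hthr : Monotone thr) {β : ℝ} (hβ : 0 ≤ β)
    [DecidablePred fun p => ∃ e, valid e ∧ thr e < n p]
    (h : ∀ e, valid e → ∀ T ⊆ s, (∀ p ∈ s, p ∈ T ↔ thr e < n p) → ∑ p ∈ T, w p ≤ β) :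
    ∑ p ∈ s with ∃ e, valid e ∧ thr e < n p, w p ≤ β := by
  classical
  rcases Finset.eq_empty_or_nonempty (s.filter fun p => ∃ e, valid e ∧ thr e < n p) with h0 | h0
  · rw [h0]; simpa
  have hch : ∀ p ∈ s.filter (fun p => ∃ e, valid e ∧ thr e < n p), ∃ e, valid e ∧ thr e < n p :=
    fun p hp => (Finset.mem_filter.1 hp).2
  choose! e he using hch
  obtain ⟨p₀, hp₀, hmin⟩ := Finset.exists_min_image _ e h0
  refine h (e p₀) (he p₀ hp₀).1 _ (Finset.filter_subset _ _) fun p hp =>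
    ⟨fun hpT => ?_, fun hlt => ?_⟩
  · exact (hthr (hmin p hpT)).trans_lt (he p hpT).2
  · exact Finset.mem_filter.2 ⟨hp, _, (he p₀ hp₀).1, hlt⟩

/-- The square of side `1 / n` of the standard grid that contains `z`. -/
noncomputable def cell (n : ℕ) (z : ℂ) : ℤ × ℤ := (⌊n * z.re⌋, ⌊n * z.im⌋)

/-- The planar cross product. -/
def cr (a b : ℂ) : ℝ := a.re * b.im - a.im * b.re

/-- The grid squares of side `1 / n` containing `z` and `w` touch or coincide. -/
def adj (n : ℕ) (z w : ℂ) : Prop :=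
  |(cell n z).1 - (cell n w).1| ≤ 1 ∧ |(cell n z).2 - (cell n w).2| ≤ 1

theorem cell_of_dvd {m n : ℕ} (hmn : m ∣ n) (hn : 0 < n) {z w : ℂ} (h : cell n z = cell n w) :
    cell m z = cell m w := by
  obtain ⟨k, rfl⟩ := hmn
  have hk : (k : ℝ) ≠ 0 := by
    rintro h0
    rw [Nat.cast_eq_zero] at h0
    simp [h0] at hn
  have key : ∀ r : ℝ, ⌊(m : ℝ) * r⌋ = ⌊((m * k : ℕ) : ℝ) * r⌋ / (k : ℤ) := by
    intro r
    rw [← Int.floor_div_natCast]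
    congr 1
    push_cast
    field_simp
  simp only [cell, Prod.mk.injEq] at h ⊢
  rw [key z.re, key w.re, key z.im, key w.im, h.1, h.2]
  exact ⟨rfl, rfl⟩

theorem cell_pow_of_le {D a b : ℕ} (hD : 0 < D) (hab : a ≤ b) {z w : ℂ}
    (h : cell (D ^ b) z = cell (D ^ b) w) : cell (D ^ a) z = cell (D ^ a) w :=
  cell_of_dvd (pow_dvd_pow D hab) (pow_pos hD b) h

theorem abs_sub_le_of_floor {n : ℕ} (hn : 0 < n) {r s : ℝ} {k : ℤ}
    (h : |⌊(n : ℝ) * r⌋ - ⌊(n : ℝ) * s⌋| ≤ k) : |r - s| ≤ (k + 1) / n := by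
  have hn' : (0 : ℝ) < n := by exact_mod_cast hn
  have h1 := Int.floor_le ((n : ℝ) * r)
  have h2 := Int.lt_floor_add_one ((n : ℝ) * r)
  have h3 := Int.floor_le ((n : ℝ) * s)
  have h4 := Int.lt_floor_add_one ((n : ℝ) * s)
  have h5 : |(⌊(n : ℝ) * r⌋ : ℝ) - ⌊(n : ℝ) * s⌋| ≤ k := by exact_mod_cast h
  rw [abs_le] at h5
  rw [le_div_iff₀ hn', ← abs_of_pos hn', ← abs_mul, abs_le]
  constructor <;> linarith [h5.1, h5.2]

theorem norm_sub_le_of_adj {n : ℕ} (hn : 0 < n) {z w : ℂ} (h : adj n z w) :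
    ‖z - w‖ ≤ 4 / n := by
  have h1 := abs_sub_le_of_floor hn (k := 1) h.1
  have h2 := abs_sub_le_of_floor hn (k := 1) h.2
  have h3 := Complex.norm_le_abs_re_add_abs_im (z - w)
  rw [Complex.sub_re, Complex.sub_im] at h3
  have : (4 : ℝ) / n = ((1 : ℤ) + 1) / n + ((1 : ℤ) + 1) / n := by push_cast; ring
  linarith

theorem norm_sub_le_of_cell {n : ℕ} (hn : 0 < n) {z w : ℂ} (h : cell n z = cell n w) :
    ‖z - w‖ ≤ 2 / n := by
  simp only [cell, Prod.mk.injEq] at h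
  have h1 := abs_sub_le_of_floor hn (k := 0) (r := z.re) (s := w.re) (by simp [h.1])
  have h2 := abs_sub_le_of_floor hn (k := 0) (r := z.im) (s := w.im) (by simp [h.2])
  have h3 := Complex.norm_le_abs_re_add_abs_im (z - w)
  rw [Complex.sub_re, Complex.sub_im] at h3
  have : (2 : ℝ) / n = ((0 : ℤ) + 1) / n + ((0 : ℤ) + 1) / n := by push_cast; ring
  linarith

theorem one_lt_abs_sub_of_floor {n : ℕ} (hn : 0 < n) {r s : ℝ}
    (h : ¬ |⌊(n : ℝ) * r⌋ - ⌊(n : ℝ) * s⌋| ≤ 1) : 1 / n ≤ |r - s| := by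
  by_contra hcon
  push Not at hcon h
  have hn' : (0 : ℝ) < n := by exact_mod_cast hn
  rw [lt_div_iff₀ hn', ← abs_of_pos hn', ← abs_mul, abs_lt] at hcon
  have h1 := Int.floor_le ((n : ℝ) * r)
  have h2 := Int.lt_floor_add_one ((n : ℝ) * r)
  have h3 := Int.floor_le ((n : ℝ) * s)
  have h4 := Int.lt_floor_add_one ((n : ℝ) * s)
  rcases lt_abs.1 h with h5 | h5
  · have h6 : (2 : ℝ) ≤ (⌊(n : ℝ) * r⌋ : ℝ) - ⌊(n : ℝ) * s⌋ := by exact_mod_cast h5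
    linarith [hcon.2]
  · have h6 : (2 : ℝ) ≤ -((⌊(n : ℝ) * r⌋ : ℝ) - ⌊(n : ℝ) * s⌋) := by exact_mod_cast h5
    linarith [hcon.1]

theorem le_norm_sub_of_not_adj {n : ℕ} (hn : 0 < n) {z w : ℂ} (h : ¬ adj n z w) :
    1 / n ≤ ‖z - w‖ := by
  rw [adj, not_and_or] at h
  rcases h with h | h
  · exact (one_lt_abs_sub_of_floor hn h).trans (Complex.abs_re_le_norm (z - w))
  · exact (one_lt_abs_sub_of_floor hn h).trans (Complex.abs_im_le_norm (z - w))

theorem adj_congr {n : ℕ} {z w z' w' : ℂ} (hz : cell n z = cell n z') (hw : cell n w = cell n w') :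
    adj n z w ↔ adj n z' w' := by
  rw [adj, adj, hz, hw]

theorem adj_of_cell_eq {n : ℕ} {z w : ℂ} (h : cell n z = cell n w) : adj n z w := by
  simp [adj, h]

theorem abs_cr_le (a b : ℂ) : |cr a b| ≤ ‖a‖ * ‖b‖ := by
  have h : cr a b = ((starRingEnd ℂ) a * b).im := by simp [cr]; ring
  rw [h]
  refine (Complex.abs_im_le_norm _).trans ?_
  simp

theorem cr_sub_right (a b c : ℂ) : cr a (b - c) = cr a b - cr a c := by simp [cr]; ring

/-- The real inner product on the plane. -/
def ip (a b : ℂ) : ℝ := a.re * b.re + a.im * b.im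

theorem abs_ip_le (a b : ℂ) : |ip a b| ≤ ‖a‖ * ‖b‖ := by
  have h : ip a b = ((starRingEnd ℂ) a * b).re := by simp [ip]
  rw [h]
  refine (Complex.abs_re_le_norm _).trans ?_
  simp

theorem abs_cr_mul_norm_le (a a' v : ℂ) :
    |cr a a'| * ‖v‖ ≤ |cr a v| * ‖a'‖ + |cr a' v| * ‖a‖ := by
  have h : (cr a a') • v = (-(cr a' v)) • a + (cr a v) • a' := by
    apply Complex.ext <;> simp [cr] <;> ring
  have h1 := norm_add_le ((-(cr a' v)) • a) ((cr a v) • a')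
  rw [← h] at h1
  simp only [norm_smul, Real.norm_eq_abs, abs_neg] at h1
  linarith

theorem abs_cr_mul_norm_le' (a w v : ℂ) :
    |cr a w| * ‖v‖ ≤ |ip a v| * ‖w‖ + |ip w v| * ‖a‖ := by
  have h1 := abs_cr_mul_norm_le a w (v * Complex.I)
  have h2 : ∀ b, cr b (v * Complex.I) = ip b v := fun b => by simp [cr, ip]
  simpa [h2] using h1

/-- Powers of the scale absorb constants. -/
theorem const_mul_rpow_le {D K x y : ℝ} (hK : K ≤ D) (hD : 1 ≤ D) (hxy : x + 1 ≤ y) :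
    K * D ^ x ≤ D ^ y := by
  have h0 : 0 < D := by linarith
  calc K * D ^ x ≤ D * D ^ x := by gcongr
    _ = D ^ (x + 1) := by rw [Real.rpow_add h0, Real.rpow_one, mul_comm]
    _ ≤ D ^ y := Real.rpow_le_rpow_of_exponent_le hD hxy

theorem natCast_pow_eq_rpow (D j : ℕ) : ((D ^ j : ℕ) : ℝ) = (D : ℝ) ^ (j : ℝ) := by
  rw [Real.rpow_natCast]; push_cast; rfl

theorem div_natCast_pow (K : ℝ) (D j : ℕ) :
    K / ((D ^ j : ℕ) : ℝ) = K * (D : ℝ) ^ (-(j : ℝ)) := by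
  rw [natCast_pow_eq_rpow, Real.rpow_neg (Nat.cast_nonneg D), div_eq_mul_inv]

open Classical in
/-- A weighted finite set in the unit square whose branching numbers in the `D`-adic grid are
described by `F`. -/
structure Regular (D N : ℕ) (X : Finset ℂ) (μ : ℂ → ℝ) (F : ℕ → ℝ) : Prop where
  nonneg : ∀ x, 0 ≤ μ x
  sum_le : ∑ x ∈ X, μ x ≤ 1
  zero : ∀ x ∈ X, cell 1 x = 0
  mass : ∀ j ≤ N, ∀ q, ∑ x ∈ X with cell (D ^ j) x = q, μ x ≤ (D : ℝ) ^ (-(F j + j))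
  count : ∀ a b, a ≤ b → b ≤ N → ∀ q,
    (((X.filter fun x => cell (D ^ a) x = q).image (cell (D ^ b))).card : ℝ) ≤
      (D : ℝ) ^ (F b - F a + ((b : ℝ) - a) + 1)

theorem norm_sub_le_two {z w : ℂ} (hz : cell 1 z = 0) (hw : cell 1 w = 0) : ‖z - w‖ ≤ 2 := by
  simpa using norm_sub_le_of_cell one_pos (hz.trans hw.symm)

namespace Regular

variable {D N : ℕ} {X Y : Finset ℂ} {μ ν : ℂ → ℝ} {F G : ℕ → ℝ}

theorem card_adj_le (h : Regular D N X μ F) {u b : ℕ} (hub : u ≤ b) (hb : b ≤ N) (y : ℂ)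
    (rep : ℤ × ℤ → ℂ) (T : Finset (ℤ × ℤ))
    (hT : ∀ q ∈ T, rep q ∈ X ∧ cell (D ^ b) (rep q) = q ∧ adj (D ^ u) y (rep q)) :
    (T.card : ℝ) ≤ 9 * (D : ℝ) ^ (F b - F u + ((b : ℝ) - u) + 1) := by
  classical
  set O : Finset (ℤ × ℤ) := Finset.Icc (-1) 1 ×ˢ Finset.Icc (-1) 1 with hO
  have hsub : T ⊆ O.biUnion fun o => (X.filter fun x => cell (D ^ u) x =
      cell (D ^ u) y - o).image (cell (D ^ b)) := by
    intro q hq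
    obtain ⟨h1, h2, h3⟩ := hT q hq
    refine Finset.mem_biUnion.2 ⟨cell (D ^ u) y - cell (D ^ u) (rep q), ?_, ?_⟩
    · rw [adj, abs_le, abs_le] at h3
      simp only [hO, Finset.mem_product, Finset.mem_Icc, Prod.fst_sub, Prod.snd_sub]
      exact h3
    · exact Finset.mem_image.2 ⟨rep q, Finset.mem_filter.2 ⟨h1, by abel⟩, h2⟩
  have hcard : O.card = 9 := by rw [hO]; rfl
  calc (T.card : ℝ) ≤ ((∑ o ∈ O, ((X.filter fun x => cell (D ^ u) x =
      cell (D ^ u) y - o).image (cell (D ^ b))).card : ℕ) : ℝ) := by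
        exact_mod_cast (Finset.card_le_card hsub).trans Finset.card_biUnion_le
    _ ≤ ∑ _o ∈ O, (D : ℝ) ^ (F b - F u + ((b : ℝ) - u) + 1) := by
        rw [Nat.cast_sum]
        exact Finset.sum_le_sum fun o _ => by convert h.count u b hub hb _
    _ = _ := by rw [Finset.sum_const, hcard]; simp

end Regular

theorem exists_rep (X : Finset ℂ) (n : ℕ) :
    ∃ rep : ℤ × ℤ → ℂ, ∀ q ∈ X.image (cell n), rep q ∈ X ∧ cell n (rep q) = q := by
  classical
  have h : ∀ q ∈ X.image (cell n), ∃ z, z ∈ X ∧ cell n z = q := fun q hq => by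
    simpa using Finset.mem_image.1 hq
  choose! rep hrep using h
  exact ⟨rep, hrep⟩

open Classical in
/-- The finest level in `[0, b]` at which `y` and `z` lie in adjacent grid squares. -/
noncomputable def adjLevel (D b : ℕ) (y z : ℂ) : ℕ :=
  Nat.findGreatest (fun u => adj (D ^ u) y z) b

theorem adjLevel_spec {D c b : ℕ} {y z : ℂ} (hcb : c ≤ b) (h : cell (D ^ c) y = cell (D ^ c) z) :
    c ≤ adjLevel D b y z ∧ adjLevel D b y z ≤ b ∧ adj (D ^ adjLevel D b y z) y z ∧
      (adjLevel D b y z < b → ¬ adj (D ^ (adjLevel D b y z + 1)) y z) := by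
  classical
  have h0 : adj (D ^ c) y z := adj_of_cell_eq h
  refine ⟨Nat.le_findGreatest hcb h0, Nat.findGreatest_le b, ?_, fun hlt => ?_⟩
  · exact Nat.findGreatest_spec (P := fun u => adj (D ^ u) y z) hcb h0
  · exact Nat.findGreatest_is_greatest (P := fun u => adj (D ^ u) y z) (Nat.lt_succ_self _) hlt

open Classical in
/-- The number of squares of level `c'` that carry a point of a pair `q` in `E` seen from the square
of `x` in nearly the same direction as the square of `y`. -/
noncomputable def tubeCount (E : Finset (ℂ × ℂ)) (D c c' : ℕ) (x y : ℂ) : ℕ :=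
  ((E.filter fun q => cell (D ^ c) q.2 = cell (D ^ c) y ∧ cell (D ^ c') q.1 = cell (D ^ c') x ∧
    ∃ p ∈ E, cell (D ^ c') p.1 = cell (D ^ c') x ∧ cell (D ^ c') p.2 = cell (D ^ c') y ∧
      |cr (p.1 - p.2) (q.2 - p.2)| ≤ (D : ℝ) ^ (3 - (c' : ℝ))).image
    fun q => cell (D ^ c') q.2).card

theorem thin_geometry {D c' u : ℕ} (hD : 13 ≤ D) {x x₀ y₀ z₀ x₁ y₁ z₁ : ℂ}
    (hx₀ : cell 1 x₀ = 0) (hy₀ : cell 1 y₀ = 0) (hx₁ : cell 1 x₁ = 0) (hy₁ : cell 1 y₁ = 0)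
    (hx : cell (D ^ c') x = cell (D ^ c') x₁) (hy : cell (D ^ c') y₁ = cell (D ^ c') y₀)
    (hz : cell (D ^ c') z₁ = cell (D ^ c') z₀)
    (hyz : (D : ℝ) ^ (-((u : ℝ) + 1)) ≤ ‖z₀ - y₀‖)
    (h₀ : |cr (x₀ - y₀) (z₀ - y₀)| ≤ (D : ℝ) ^ (3 - (c' : ℝ)))
    (h₁ : |cr (x₁ - y₁) (z₁ - y₁)| ≤ (D : ℝ) ^ (3 - (c' : ℝ))) :
    |cr (x₀ - y₀) (x - y₀)| ≤ (D : ℝ) ^ (5 + (u : ℝ) - c') := by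
  have hD' : (13 : ℝ) ≤ D := by exact_mod_cast hD
  have hD0 : (0 : ℝ) < D := by linarith
  have hDp : ∀ j, 0 < D ^ j := fun j => pow_pos (by omega) j
  have na₀ := norm_sub_le_two hx₀ hy₀
  have na₁ := norm_sub_le_two hx₁ hy₁
  have ex := norm_sub_le_of_cell (hDp c') hx
  have ey := norm_sub_le_of_cell (hDp c') hy
  have ez := norm_sub_le_of_cell (hDp c') hz
  rw [div_natCast_pow] at ex ey ez
  set δ := (D : ℝ) ^ (-(c' : ℝ)) with hδ
  have hδ0 : 0 < δ := Real.rpow_pos_of_pos hD0 _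
  have e3 : (D : ℝ) ^ (3 - (c' : ℝ)) = (D : ℝ) ^ 3 * δ := by
    rw [hδ, ← Real.rpow_natCast, ← Real.rpow_add hD0]; norm_num; ring_nf
  have e5 : (D : ℝ) ^ (5 + (u : ℝ) - c') = (D : ℝ) ^ 5 * (D : ℝ) ^ u * δ := by
    rw [hδ, ← Real.rpow_natCast, ← Real.rpow_natCast, ← Real.rpow_add hD0, ← Real.rpow_add hD0]
    norm_num; ring_nf
  have e1 : (D : ℝ) ^ (-((u : ℝ) + 1)) = ((D : ℝ) ^ u * D)⁻¹ := by
    rw [Real.rpow_neg hD0.le, Real.rpow_add hD0, Real.rpow_natCast, Real.rpow_one]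
  rw [e3] at h₀ h₁
  rw [e1] at hyz
  rw [e5]
  have hD3 : (16 : ℝ) ≤ (D : ℝ) ^ 3 := by
    calc (16 : ℝ) ≤ 13 ^ 3 := by norm_num
      _ ≤ (D : ℝ) ^ 3 := by gcongr
  have hu1 : (1 : ℝ) ≤ (D : ℝ) ^ u := one_le_pow₀ (by linarith)
  have hv : ‖(z₀ - y₀) - (z₁ - y₁)‖ ≤ 4 * δ := by
    have : (z₀ - y₀) - (z₁ - y₁) = (y₁ - y₀) - (z₁ - z₀) := by ring
    rw [this]
    exact (norm_sub_le _ _).trans (by linarith)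
  have h2 : |cr (x₁ - y₁) (z₀ - y₀)| ≤ (D : ℝ) ^ 3 * δ + 8 * δ := by
    have h3 := abs_cr_le (x₁ - y₁) ((z₀ - y₀) - (z₁ - y₁))
    have h4 : ‖x₁ - y₁‖ * ‖(z₀ - y₀) - (z₁ - y₁)‖ ≤ 2 * (4 * δ) := by gcongr
    rw [cr_sub_right] at h3
    have h5 := abs_sub_abs_le_abs_sub (cr (x₁ - y₁) (z₀ - y₀)) (cr (x₁ - y₁) (z₁ - y₁))
    linarith
  have h6 : |cr (x₀ - y₀) (x₁ - y₁)| ≤ 5 * (D : ℝ) ^ 4 * (D : ℝ) ^ u * δ := by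
    have h7 := abs_cr_mul_norm_le (x₀ - y₀) (x₁ - y₁) (z₀ - y₀)
    have h8 : |cr (x₀ - y₀) (z₀ - y₀)| * ‖x₁ - y₁‖ ≤ (D : ℝ) ^ 3 * δ * 2 := by gcongr
    have h9 : |cr (x₁ - y₁) (z₀ - y₀)| * ‖x₀ - y₀‖ ≤ ((D : ℝ) ^ 3 * δ + 8 * δ) * 2 := by gcongr
    have h10 : |cr (x₀ - y₀) (x₁ - y₁)| * ((D : ℝ) ^ u * D)⁻¹ ≤ 5 * (D : ℝ) ^ 3 * δ := by
      have h11 : |cr (x₀ - y₀) (x₁ - y₁)| * ((D : ℝ) ^ u * D)⁻¹ ≤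
        |cr (x₀ - y₀) (x₁ - y₁)| * ‖z₀ - y₀‖ := by gcongr
      nlinarith
    rw [mul_inv_le_iff₀ (by positivity)] at h10
    calc _ ≤ _ := h10
      _ = _ := by ring
  have h12 : |cr (x₀ - y₀) ((x - y₀) - (x₁ - y₁))| ≤ 8 * δ := by
    refine (abs_cr_le _ _).trans ?_
    have h13 : ‖(x - y₀) - (x₁ - y₁)‖ ≤ 4 * δ := by
      have : (x - y₀) - (x₁ - y₁) = (x - x₁) + (y₁ - y₀) := by ring
      rw [this]
      exact (norm_add_le _ _).trans (by linarith)
    have : ‖x₀ - y₀‖ * ‖(x - y₀) - (x₁ - y₁)‖ ≤ 2 * (4 * δ) := by gcongr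
    linarith
  rw [cr_sub_right] at h12
  have h14 := abs_sub_abs_le_abs_sub (cr (x₀ - y₀) (x - y₀)) (cr (x₀ - y₀) (x₁ - y₁))
  have h15 : 8 * δ ≤ 8 * (D : ℝ) ^ 4 * (D : ℝ) ^ u * δ := by
    have : (1 : ℝ) ≤ (D : ℝ) ^ 4 * (D : ℝ) ^ u :=
      one_le_mul_of_one_le_of_one_le (one_le_pow₀ (by linarith)) hu1
    nlinarith
  have h16 : 13 * ((D : ℝ) ^ 4 * (D : ℝ) ^ u * δ) ≤ D * ((D : ℝ) ^ 4 * (D : ℝ) ^ u * δ) := by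
    gcongr
  calc |cr (x₀ - y₀) (x - y₀)| ≤ 13 * ((D : ℝ) ^ 4 * (D : ℝ) ^ u * δ) := by linarith
    _ ≤ D * ((D : ℝ) ^ 4 * (D : ℝ) ^ u * δ) := h16
    _ = _ := by ring

open Classical in
theorem mass_tubeCount_le {D N : ℕ} {X Y : Finset ℂ} {μ ν : ℂ → ℝ} {G : ℕ → ℝ}
    (hD : 13 ≤ D) (hDN : 9 * (N + 1) ≤ D) (hX : ∀ x ∈ X, cell 1 x = 0) (hμ : ∀ x, 0 ≤ μ x)
    (hμ1 : ∑ x ∈ X, μ x ≤ 1) (hY : Regular D N Y ν G) {E : Finset (ℂ × ℂ)} (hE : E ⊆ X ×ˢ Y)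
    (thin : ∀ p ∈ E, ∀ j : ℕ, j ≤ N →
      ∑ x ∈ X with |cr (p.1 - p.2) (x - p.2)| ≤ (D : ℝ) ^ (-(j : ℝ)), μ x ≤
        (D : ℝ) ^ (1 - (j : ℝ)))
    {c c' : ℕ} (hcc : c ≤ c') (hc' : c' ≤ N) {e : ℝ}
    (he : ∀ u, c ≤ u → u ≤ c' → G c - G u ≤ e) :
    ∑ p ∈ E with (D : ℝ) ^ (9 + G c' - G c + e) < tubeCount E D c c' p.1 p.2, μ p.1 * ν p.2 ≤
      1 / (D : ℝ) := by
  have hD' : (13 : ℝ) ≤ D := by exact_mod_cast hD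
  have hD0 : (0 : ℝ) < D := by linarith
  have hDp : ∀ j, 0 < D ^ j := fun j => pow_pos (by omega) j
  obtain ⟨rep, hrep⟩ := exists_rep Y (D ^ c')
  set S := Y.image (cell (D ^ c')) with hS
  set r : ℂ → ℂ → ℂ × ℂ → Prop := fun x y q =>
    cell (D ^ c) q.2 = cell (D ^ c) y ∧ cell (D ^ c') q.1 = cell (D ^ c') x ∧
    ∃ p ∈ E, cell (D ^ c') p.1 = cell (D ^ c') x ∧ cell (D ^ c') p.2 = cell (D ^ c') y ∧
      |cr (p.1 - p.2) (q.2 - p.2)| ≤ (D : ℝ) ^ (3 - (c' : ℝ)) with hr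
  set R : ℂ → ℂ → ℤ × ℤ → Prop := fun x y Q => ∃ q ∈ E, cell (D ^ c') q.2 = Q ∧ r x y q with hR
  have hn : ∀ x y, tubeCount E D c c' x y = (S.filter (R x y)).card := by
    intro x y
    rw [tubeCount]
    congr 1
    ext Q
    simp only [Finset.mem_image, Finset.mem_filter, hR, hS]
    constructor
    · rintro ⟨q, ⟨h1, h2⟩, h3⟩
      exact ⟨⟨q.2, (Finset.mem_product.1 (hE h1)).2, h3⟩, q, h1, h3, h2⟩
    · rintro ⟨-, q, h1, h3, h2⟩
      exact ⟨q, ⟨h1, h2⟩, h3⟩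
  have hcell : ∀ x y Q, Q ∈ S → R x y Q → cell (D ^ c) y = cell (D ^ c) (rep Q) := by
    rintro x y Q hQ ⟨q, hq, h1, h2, -⟩
    rw [← h2]
    exact cell_pow_of_le (by omega) hcc (h1.trans (hrep Q hQ).2.symm)
  set V := (D : ℝ) ^ (8 + G c' - G c + e) with hV
  have hDV : (D : ℝ) ^ (9 + G c' - G c + e) = D * V := by
    rw [hV]
    nth_rewrite 2 [← Real.rpow_one (D : ℝ)]
    rw [← Real.rpow_add hD0]; ring_nf
  simp_rw [hn, hDV]
  refine mass_filter_lt_card_le X Y S μ ν hμ hY.nonneg hY.sum_le R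
    (fun y Q => adjLevel D c' y (rep Q)) (Finset.Icc c c')
    (fun u => (D : ℝ) ^ (6 - ((c' : ℝ) - u)))
    (fun u => 9 * (D : ℝ) ^ (G c' - G u + ((c' : ℝ) - u) + 1)) (fun u => by positivity) hD0
    ?_ ?_ ?_ ?_ (by positivity) E hE
  · intro x _ y _ Q hQ hxy
    have := adjLevel_spec hcc (hcell x y Q hQ hxy)
    exact Finset.mem_Icc.2 ⟨this.1, this.2.1⟩
  · intro y hy Q hQ hlev
    by_cases hex : ∃ x ∈ X, R x y Q
    swap
    · push Not at hex
      rw [Finset.filter_false_of_mem hex, Finset.sum_empty]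
      positivity
    obtain ⟨x₀, hx₀, q₀, hq₀, hQ₀, hc₀, hx₀', p₀, hp₀, hpx₀, hpy₀, hcr₀⟩ := hex
    have hspec := adjLevel_spec (D := D) hcc
      (hcell x₀ y Q hQ ⟨q₀, hq₀, hQ₀, hc₀, hx₀', p₀, hp₀, hpx₀, hpy₀, hcr₀⟩)
    set u := adjLevel D c' y (rep Q) with hu
    by_cases hu5 : u + 5 ≤ c'
    · have hth := thin p₀ hp₀ (c' - u - 5) (by omega)
      have hj : ((c' - u - 5 : ℕ) : ℝ) = (c' : ℝ) - u - 5 := by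
        rw [Nat.cast_sub (by omega), Nat.cast_sub (by omega)]; norm_num
      rw [hj] at hth
      refine le_trans (Finset.sum_le_sum_of_subset_of_nonneg ?_ fun x _ _ => hμ x)
        (hth.trans_eq (by ring_nf))
      intro x hx
      obtain ⟨hxX, q₁, hq₁, hQ₁, hc₁, hx₁', p₁, hp₁, hpx₁, hpy₁, hcr₁⟩ := Finset.mem_filter.1 hx
      refine Finset.mem_filter.2 ⟨hxX, ?_⟩
      have hp₀' := Finset.mem_product.1 (hE hp₀)
      have hp₁' := Finset.mem_product.1 (hE hp₁)
      have hna := hspec.2.2.2 (by omega)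
      rw [adj_congr (z' := p₀.2) (w' := q₀.2) (cell_pow_of_le (by omega) (by omega) hpy₀.symm)
        (cell_pow_of_le (b := c') (by omega) (by omega) ((hrep Q hQ).2.trans hQ₀.symm))] at hna
      have hdist := le_norm_sub_of_not_adj (hDp _) hna
      rw [div_natCast_pow, one_mul, norm_sub_rev] at hdist
      have := thin_geometry (u := u) hD (hX _ hp₀'.1) (hY.zero _ hp₀'.2) (hX _ hp₁'.1)
        (hY.zero _ hp₁'.2) hpx₁.symm (hpy₁.trans hpy₀.symm) (hQ₁.trans hQ₀.symm)
        (by push_cast at hdist; exact hdist) hcr₀ hcr₁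
      refine this.trans_eq ?_
      ring_nf
    · refine le_trans (Finset.sum_le_sum_of_subset_of_nonneg (Finset.filter_subset _ _)
        fun x _ _ => hμ x) (hμ1.trans ?_)
      apply Real.one_le_rpow (by linarith)
      have : (c' : ℝ) ≤ u + 5 := by exact_mod_cast (by omega : c' ≤ u + 5)
      linarith
  · intro y hy u hu T hTS hT
    rw [Finset.mem_Icc] at hu
    refine hY.card_adj_le hu.2 hc' y rep T fun Q hQ => ?_
    obtain ⟨h1, x, hx, hxR⟩ := hT Q hQ
    refine ⟨(hrep Q (hTS hQ)).1, (hrep Q (hTS hQ)).2, ?_⟩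
    have := (adjLevel_spec hcc (hcell x y Q (hTS hQ) hxR)).2.2.1
    rwa [h1] at this
  · have hterm : ∀ u ∈ Finset.Icc c c', 9 * (D : ℝ) ^ (G c' - G u + ((c' : ℝ) - u) + 1) *
        (D : ℝ) ^ (6 - ((c' : ℝ) - u)) ≤ 9 * (D : ℝ) ^ (7 + G c' - G c + e) := by
      intro u hu
      rw [Finset.mem_Icc] at hu
      rw [mul_assoc, ← Real.rpow_add hD0]
      have := he u hu.1 hu.2
      exact mul_le_mul_of_nonneg_left (Real.rpow_le_rpow_of_exponent_le (by linarith)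
        (by linarith)) (by norm_num)
    refine (Finset.sum_le_sum hterm).trans ?_
    rw [Finset.sum_const, nsmul_eq_mul, ← mul_assoc]
    refine const_mul_rpow_le ?_ (by linarith) (by linarith)
    have : (Finset.Icc c c').card * 9 ≤ D := by
      rw [Nat.card_Icc]; omega
    exact_mod_cast this

open Classical in
/-- The number of squares of level `b` that carry a point of a pair `q` in `E` which is nearly as
far from the square of `y` as the square of `x`. -/
noncomputable def fibreCount (E : Finset (ℂ × ℂ)) (D a b : ℕ) (x y : ℂ) : ℕ :=
  ((E.filter fun q => cell (D ^ a) q.1 = cell (D ^ a) x ∧ cell (D ^ b) q.2 = cell (D ^ b) y ∧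
    ∃ p ∈ E, cell (D ^ b) p.1 = cell (D ^ b) x ∧ cell (D ^ b) p.2 = cell (D ^ b) y ∧
      |‖p.1 - p.2‖ - ‖q.1 - q.2‖| ≤ (D : ℝ) ^ (1 - (b : ℝ))).image
    fun q => cell (D ^ b) q.1).card

theorem abs_ip_le_of_abs_norm_sub_le {x z y : ℂ} {ε : ℝ} (hx : ‖x - y‖ ≤ 2) (hz : ‖z - y‖ ≤ 2)
    (h : |‖x - y‖ - ‖z - y‖| ≤ ε) : |2 * ip (x - y) (z - x) + ‖z - x‖ ^ 2| ≤ 4 * ε := by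
  have h1 : 2 * ip (x - y) (z - x) + ‖z - x‖ ^ 2 =
      (‖z - y‖ - ‖x - y‖) * (‖z - y‖ + ‖x - y‖) := by
    have h2 : (‖z - y‖ - ‖x - y‖) * (‖z - y‖ + ‖x - y‖) = ‖z - y‖ ^ 2 - ‖x - y‖ ^ 2 := by ring
    rw [h2]
    simp only [← Complex.normSq_eq_norm_sq, Complex.normSq_apply, ip, Complex.sub_re,
      Complex.sub_im]
    ring
  rw [h1, abs_mul, abs_sub_comm, mul_comm 4]
  have h3 : |‖z - y‖ + ‖x - y‖| ≤ 4 := by rw [abs_of_nonneg (by positivity)]; linarith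
  have := (abs_nonneg _).trans h
  gcongr

theorem strip_geometry {D b t c c' : ℕ} (hD : 40 ≤ D) {x₀ y₀ z₀ y₀' x₁ y₁ z₁ y₁' : ℂ}
    (hx₀ : cell 1 x₀ = 0) (hy₀ : cell 1 y₀ = 0) (hz₀ : cell 1 z₀ = 0) (hy₁ : cell 1 y₁ = 0)
    (hy₀' : cell (D ^ b) y₀' = cell (D ^ b) y₀) (hy₁' : cell (D ^ b) y₁' = cell (D ^ b) y₁)
    (hx : cell (D ^ b) x₁ = cell (D ^ b) x₀) (hz : cell (D ^ b) z₁ = cell (D ^ b) z₀)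
    (hy : cell (D ^ c) y₁ = cell (D ^ c) y₀)
    (h₀ : |‖x₀ - y₀‖ - ‖z₀ - y₀'‖| ≤ (D : ℝ) ^ (1 - (b : ℝ)))
    (h₁ : |‖x₁ - y₁‖ - ‖z₁ - y₁'‖| ≤ (D : ℝ) ^ (1 - (b : ℝ)))
    (hadj : adj (D ^ t) x₀ z₀) (hnadj : t < b → ¬ adj (D ^ (t + 1)) x₀ z₀)
    (hct : c' ≤ c + t) (hbt : c' + t ≤ b) :
    |cr (x₀ - y₀) (y₁ - y₀)| ≤ (D : ℝ) ^ (3 - (c' : ℝ)) := by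
  have hD' : (40 : ℝ) ≤ D := by exact_mod_cast hD
  have hD0 : (0 : ℝ) < D := by linarith
  have hDp : ∀ j, 0 < D ^ j := fun j => pow_pos (by omega) j
  have n00 := norm_sub_le_two hx₀ hy₀
  have n10 := norm_sub_le_two hy₁ hy₀
  rcases (show t ≤ b by omega).eq_or_lt with rfl | htb
  · have : c' = 0 := by omega
    subst this
    refine (abs_cr_le _ _).trans ?_
    have h1 : ‖x₀ - y₀‖ * ‖y₁ - y₀‖ ≤ 2 * 2 := by gcongr
    have h2 : (40 : ℝ) ^ (3 : ℕ) ≤ (D : ℝ) ^ (3 : ℕ) := by gcongr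
    have h3 : (D : ℝ) ^ (3 - ((0 : ℕ) : ℝ)) = (D : ℝ) ^ (3 : ℕ) := by
      rw [← Real.rpow_natCast]; norm_num
    rw [h3]; linarith
  have nz0 := norm_sub_le_two hz₀ hy₀
  have nx1 := norm_sub_le_two hx₀ hy₁
  have nz1 := norm_sub_le_two hz₀ hy₁
  have ey0 := norm_sub_le_of_cell (hDp b) hy₀'
  have ey1 := norm_sub_le_of_cell (hDp b) hy₁'
  have ex := norm_sub_le_of_cell (hDp b) hx
  have ez := norm_sub_le_of_cell (hDp b) hz
  have ew := norm_sub_le_of_cell (hDp c) hy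
  have hv1 := norm_sub_le_of_adj (hDp t) hadj
  have hv2 := le_norm_sub_of_not_adj (hDp _) (hnadj htb)
  rw [div_natCast_pow] at ey0 ey1 ex ez ew hv1 hv2
  rw [norm_sub_rev] at hv1 hv2
  have e1 : (D : ℝ) ^ (1 - (b : ℝ)) = D * (D : ℝ) ^ (-(b : ℝ)) := by
    nth_rewrite 2 [← Real.rpow_one (D : ℝ)]
    rw [← Real.rpow_add hD0]; ring_nf
  have e2 : (D : ℝ) ^ (3 - (c' : ℝ)) = (D : ℝ) ^ 3 * (D : ℝ) ^ (-(c' : ℝ)) := by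
    rw [← Real.rpow_natCast, ← Real.rpow_add hD0]; norm_num; ring_nf
  have e3 : (D : ℝ) ^ (-((t + 1 : ℕ) : ℝ)) = (D : ℝ) ^ (-(t : ℝ)) / D := by
    rw [Nat.cast_add, neg_add, Real.rpow_add hD0, Nat.cast_one, Real.rpow_neg_one]; rfl
  rw [e1] at h₀ h₁
  rw [e3, one_mul] at hv2
  rw [e2]
  set β := (D : ℝ) ^ (-(b : ℝ)) with hβ
  set θ := (D : ℝ) ^ (-(t : ℝ)) with hθ
  set γ := (D : ℝ) ^ (-(c' : ℝ)) with hγ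
  set η := (D : ℝ) ^ (-(c : ℝ)) with hη
  have hβ0 : 0 < β := Real.rpow_pos_of_pos hD0 _
  have hθ0 : 0 < θ := Real.rpow_pos_of_pos hD0 _
  have hγ0 : 0 < γ := Real.rpow_pos_of_pos hD0 _
  have hη0 : 0 < η := Real.rpow_pos_of_pos hD0 _
  have hβγ : β ≤ γ * θ := by
    rw [hβ, hγ, hθ, ← Real.rpow_add hD0]
    refine Real.rpow_le_rpow_of_exponent_le (by linarith) ?_
    have : (c' : ℝ) + t ≤ b := by exact_mod_cast hbt
    linarith
  have hηγ : η * θ ≤ γ := by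
    rw [hη, hγ, hθ, ← Real.rpow_add hD0]
    refine Real.rpow_le_rpow_of_exponent_le (by linarith) ?_
    have : (c' : ℝ) ≤ c + t := by exact_mod_cast hct
    linarith
  have hη1 : η ≤ 1 := Real.rpow_le_one_of_one_le_of_nonpos (by linarith) (by simp)
  have hDβ : 40 * β ≤ D * β := by gcongr
  have d0 : |‖x₀ - y₀‖ - ‖z₀ - y₀‖| ≤ 2 * D * β := by
    have h1 := abs_norm_sub_norm_le (z₀ - y₀') (z₀ - y₀)
    have h2 : z₀ - y₀' - (z₀ - y₀) = -(y₀' - y₀) := by ring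
    rw [h2, norm_neg] at h1
    have h3 := abs_sub_le ‖x₀ - y₀‖ ‖z₀ - y₀'‖ ‖z₀ - y₀‖
    linarith
  have d1 : |‖x₀ - y₁‖ - ‖z₀ - y₁‖| ≤ 2 * D * β := by
    have h1 := abs_norm_sub_norm_le (z₁ - y₁') (z₀ - y₁)
    have h2 : z₁ - y₁' - (z₀ - y₁) = (z₁ - z₀) - (y₁' - y₁) := by ring
    rw [h2] at h1
    have h3 := abs_norm_sub_norm_le (x₀ - y₁) (x₁ - y₁)
    have h4 : x₀ - y₁ - (x₁ - y₁) = -(x₁ - x₀) := by ring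
    rw [h4, norm_neg] at h3
    have h5 := norm_sub_le (z₁ - z₀) (y₁' - y₁)
    have h6 := abs_sub_le ‖x₀ - y₁‖ ‖x₁ - y₁‖ ‖z₀ - y₁‖
    have h7 := abs_sub_le ‖x₁ - y₁‖ ‖z₁ - y₁'‖ ‖z₀ - y₁‖
    linarith
  have i0 := abs_ip_le_of_abs_norm_sub_le n00 nz0 d0
  have i1 := abs_ip_le_of_abs_norm_sub_le nx1 nz1 d1
  have hw : |ip (y₁ - y₀) (z₀ - x₀)| ≤ 8 * D * β := by
    have : ip (y₁ - y₀) (z₀ - x₀) = ip (x₀ - y₀) (z₀ - x₀) - ip (x₀ - y₁) (z₀ - x₀) := by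
      simp only [ip, Complex.sub_re, Complex.sub_im]; ring
    rw [this]
    rw [abs_le] at i0 i1 ⊢
    constructor <;> linarith [i0.1, i0.2, i1.1, i1.2]
  have ha : |ip (x₀ - y₀) (z₀ - x₀)| ≤ 4 * D * β + 8 * θ ^ 2 := by
    have h1 : ‖z₀ - x₀‖ ^ 2 ≤ (4 * θ) ^ 2 := by gcongr
    have h0 : 0 ≤ ‖z₀ - x₀‖ ^ 2 := by positivity
    rw [mul_pow] at h1
    rw [abs_le] at i0 ⊢
    constructor <;> linarith [i0.1, i0.2]
  have key := abs_cr_mul_norm_le' (x₀ - y₀) (y₁ - y₀) (z₀ - x₀)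
  have k1 : |ip (x₀ - y₀) (z₀ - x₀)| * ‖y₁ - y₀‖ ≤ (4 * D * β + 8 * θ ^ 2) * (2 * η) := by gcongr
  have k2 : |ip (y₁ - y₀) (z₀ - x₀)| * ‖x₀ - y₀‖ ≤ (8 * D * β) * 2 := by gcongr
  have k3 : |cr (x₀ - y₀) (y₁ - y₀)| * (θ / D) ≤ 40 * D * γ * θ := by
    have k4 : |cr (x₀ - y₀) (y₁ - y₀)| * (θ / D) ≤
      |cr (x₀ - y₀) (y₁ - y₀)| * ‖z₀ - x₀‖ := by gcongr
    have k5 : D * β * η ≤ D * (γ * θ) * 1 := by gcongr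
    have k6 : θ * (η * θ) ≤ θ * γ := by gcongr
    have k7 : D * β ≤ D * (γ * θ) := by gcongr
    have k8 : 40 * (θ * γ) ≤ D * (θ * γ) := by gcongr
    linarith
  rw [mul_div_assoc', div_le_iff₀ hD0] at k3
  have k9 : |cr (x₀ - y₀) (y₁ - y₀)| * θ ≤ (40 * (D : ℝ) ^ 2 * γ) * θ := by linarith
  have k10 := le_of_mul_le_mul_right k9 hθ0
  have k11 : 40 * ((D : ℝ) ^ 2 * γ) ≤ D * ((D : ℝ) ^ 2 * γ) := by gcongr
  calc _ ≤ 40 * ((D : ℝ) ^ 2 * γ) := by linarith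
    _ ≤ _ := k11
    _ = _ := by ring

theorem card_image_le_card_image_mul {ι κ : Type*} [DecidableEq κ] (Z : Finset ι) (f g : ι → κ)
    {B : ℝ}
    (h : ∀ z₀ ∈ Z, (((Z.filter fun z => f z = f z₀).image g).card : ℝ) ≤ B) :
    ((Z.image g).card : ℝ) ≤ (Z.image f).card * B := by
  have hsub : Z.image g ⊆ (Z.image f).biUnion fun q => (Z.filter fun z => f z = q).image g := by
    intro q hq
    obtain ⟨z, hz, rfl⟩ := Finset.mem_image.1 hq
    exact Finset.mem_biUnion.2 ⟨f z, Finset.mem_image_of_mem f hz,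
      Finset.mem_image_of_mem g (Finset.mem_filter.2 ⟨hz, rfl⟩)⟩
  calc ((Z.image g).card : ℝ)
      ≤ ((∑ q ∈ Z.image f, ((Z.filter fun z => f z = q).image g).card : ℕ) : ℝ) := by
        exact_mod_cast (Finset.card_le_card hsub).trans Finset.card_biUnion_le
    _ ≤ ∑ _q ∈ Z.image f, B := by
        rw [Nat.cast_sum]
        refine Finset.sum_le_sum fun q hq => ?_
        obtain ⟨z, hz, rfl⟩ := Finset.mem_image.1 hq
        exact h z hz
    _ = _ := by rw [Finset.sum_const, nsmul_eq_mul]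

open Classical in
theorem card_image_le_of_tube {D b t c : ℕ} {G : ℕ → ℝ} {l : ℝ} (hD : 1 ≤ D) (hG0 : G 0 = 0)
    {N : ℕ} (hb : b ≤ N) {E Z : Finset (ℂ × ℂ)} (hZE : Z ⊆ E) (hZ0 : ∀ p ∈ Z, cell 1 p.2 = 0)
    (hcount : ∀ p ∈ Z, ∀ c c', c ≤ c' → c' ≤ N → ∀ e, (∀ u, c ≤ u → u ≤ c' → G c - G u ≤ e) →
      (tubeCount E D c c' p.1 p.2 : ℝ) ≤ (D : ℝ) ^ (9 + G c' - G c + e))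
    (hZb : ∀ p ∈ Z, ∀ q ∈ Z, cell (D ^ b) q.1 = cell (D ^ b) p.1)
    (hcr : ∀ p ∈ Z, ∀ q ∈ Z, ∀ c c', c ≤ c' → c' ≤ c + t → c' + t ≤ b →
      cell (D ^ c) q.2 = cell (D ^ c) p.2 →
      |cr (p.1 - p.2) (q.2 - p.2)| ≤ (D : ℝ) ^ (3 - (c' : ℝ)))
    (hT : Tube G 9 t c l) (hc : c + t ≤ b) :
    ((Z.image fun p => cell (D ^ c) p.2).card : ℝ) ≤ (D : ℝ) ^ (G c + l) := by
  have hD0 : (0 : ℝ) < D := by exact_mod_cast hD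
  induction hT with
  | zero =>
    rw [hG0, add_zero, Real.rpow_zero]
    have : (Z.image fun p => cell (D ^ 0) p.2) ⊆ {0} := by
      intro q hq
      obtain ⟨p, hp, rfl⟩ := Finset.mem_image.1 hq
      simp [hZ0 p hp]
    have h1 := Finset.card_le_card this
    rw [Finset.card_singleton] at h1
    exact_mod_cast h1
  | step c c' l e _ hcc hct he ih =>
    have h1 := ih (by omega)
    have hstep := card_image_le_card_image_mul Z (fun p => cell (D ^ c) p.2)
      (fun p => cell (D ^ c') p.2) (B := (D : ℝ) ^ (9 + G c' - G c + e)) fun p hp => ?_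
    · calc _ ≤ _ := hstep
        _ ≤ (D : ℝ) ^ (G c + l) * (D : ℝ) ^ (9 + G c' - G c + e) :=
          mul_le_mul_of_nonneg_right h1 (by positivity)
        _ = (D : ℝ) ^ (G c' + (l + e + 9)) := by rw [← Real.rpow_add hD0]; ring_nf
    · refine le_trans ?_ (hcount p hp c c' hcc (by omega) e he)
      rw [tubeCount, Nat.cast_le]
      refine Finset.card_le_card (Finset.image_subset_image fun q hq => ?_)
      obtain ⟨hqZ, hq2⟩ := Finset.mem_filter.1 hq
      exact Finset.mem_filter.2 ⟨hZE hqZ, hq2,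
        cell_pow_of_le hD (by omega) (hZb p hp q hqZ), p, hZE hp, rfl, rfl,
        hcr p hp q hqZ c c' hcc hct hc hq2⟩

open Classical in
theorem mass_fibreCount_le {D N : ℕ} {X Y : Finset ℂ} {μ ν : ℂ → ℝ} {F G : ℕ → ℝ}
    (hD : 40 ≤ D) (hDN : 9 * (N + 1) ≤ D) (hX : Regular D N X μ F) (hY : Regular D N Y ν G)
    (hG0 : G 0 = 0) {E E' : Finset (ℂ × ℂ)} (hE : E ⊆ X ×ˢ Y) (hE' : E' ⊆ E)
    (hcount : ∀ p ∈ E', ∀ c c', c ≤ c' → c' ≤ N → ∀ e, (∀ u, c ≤ u → u ≤ c' → G c - G u ≤ e) →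
      (tubeCount E D c c' p.1 p.2 : ℝ) ≤ (D : ℝ) ^ (9 + G c' - G c + e))
    {a b : ℕ} (hab : a ≤ b) (hb : b ≤ N) {e : ℝ}
    (he : ∀ t, a ≤ t → t ≤ b → ∃ l, Tube G 9 t (b - t) l ∧ F a - F t + l ≤ e) :
    ∑ p ∈ E' with (D : ℝ) ^ (3 + F b - F a + e) < fibreCount E' D a b p.1 p.2, μ p.1 * ν p.2 ≤
      1 / (D : ℝ) := by
  have hD' : (40 : ℝ) ≤ D := by exact_mod_cast hD
  have hD0 : (0 : ℝ) < D := by linarith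
  have hDp : ∀ j, 0 < D ^ j := fun j => pow_pos (by omega) j
  choose! l hl hle using he
  obtain ⟨rep, hrep⟩ := exists_rep X (D ^ b)
  set S := X.image (cell (D ^ b)) with hS
  set r : ℂ → ℂ → ℂ × ℂ → Prop := fun x y q =>
    cell (D ^ a) q.1 = cell (D ^ a) x ∧ cell (D ^ b) q.2 = cell (D ^ b) y ∧
    ∃ p ∈ E', cell (D ^ b) p.1 = cell (D ^ b) x ∧ cell (D ^ b) p.2 = cell (D ^ b) y ∧
      |‖p.1 - p.2‖ - ‖q.1 - q.2‖| ≤ (D : ℝ) ^ (1 - (b : ℝ)) with hr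
  set R : ℂ → ℂ → ℤ × ℤ → Prop := fun y x Q => ∃ q ∈ E', cell (D ^ b) q.1 = Q ∧ r x y q with hR
  have hn : ∀ x y, fibreCount E' D a b x y = (S.filter (R y x)).card := by
    intro x y
    rw [fibreCount]
    congr 1
    ext Q
    simp only [Finset.mem_image, Finset.mem_filter, hR, hS]
    constructor
    · rintro ⟨q, ⟨h1, h2⟩, h3⟩
      exact ⟨⟨q.1, (Finset.mem_product.1 (hE (hE' h1))).1, h3⟩, q, h1, h3, h2⟩
    · rintro ⟨-, q, h1, h3, h2⟩
      exact ⟨q, ⟨h1, h2⟩, h3⟩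
  have hcell : ∀ x y Q, Q ∈ S → R y x Q → cell (D ^ a) x = cell (D ^ a) (rep Q) := by
    rintro x y Q hQ ⟨q, hq, h1, h2, -⟩
    rw [← h2]
    exact cell_pow_of_le (by omega) hab (h1.trans (hrep Q hQ).2.symm)
  set V := (D : ℝ) ^ (2 + F b - F a + e) with hV
  have hDV : (D : ℝ) ^ (3 + F b - F a + e) = D * V := by
    rw [hV]
    nth_rewrite 2 [← Real.rpow_one (D : ℝ)]
    rw [← Real.rpow_add hD0]; ring_nf
  simp_rw [hn, hDV]
  have hswap : ∑ p ∈ E' with D * V < ((S.filter (R p.2 p.1)).card : ℝ), μ p.1 * ν p.2 =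
      ∑ p ∈ E'.map (Equiv.prodComm ℂ ℂ).toEmbedding with
        D * V < ((S.filter (R p.1 p.2)).card : ℝ), ν p.1 * μ p.2 := by
    rw [Finset.filter_map, Finset.sum_map]
    exact Finset.sum_congr rfl fun p _ => mul_comm _ _
  rw [hswap]
  refine mass_filter_lt_card_le Y X S ν μ hY.nonneg hX.nonneg hX.sum_le R
    (fun x Q => adjLevel D b x (rep Q)) (Finset.Icc a b)
    (fun t => (D : ℝ) ^ (l t - ((b : ℝ) - t)))
    (fun t => 9 * (D : ℝ) ^ (F b - F t + ((b : ℝ) - t) + 1)) (fun t => by positivity) hD0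
    ?_ ?_ ?_ ?_ (by positivity) _ ?_
  · intro y _ x _ Q hQ hxy
    have := adjLevel_spec hab (hcell x y Q hQ hxy)
    exact Finset.mem_Icc.2 ⟨this.1, this.2.1⟩
  · intro x hx Q hQ hlev
    by_cases hex : ∃ y ∈ Y, R y x Q
    swap
    · push Not at hex
      rw [Finset.filter_false_of_mem hex, Finset.sum_empty]
      positivity
    obtain ⟨y₀, hy₀, hR₀⟩ := hex
    have hspec := adjLevel_spec (D := D) hab (hcell x y₀ Q hQ hR₀)
    set t := adjLevel D b x (rep Q) with ht
    obtain ⟨hat, htb, hadj, hnadj⟩ := hspec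
    set Z := E'.filter fun p => cell (D ^ b) p.1 = cell (D ^ b) x ∧ ∃ q ∈ E',
      cell (D ^ b) q.1 = Q ∧ cell (D ^ b) q.2 = cell (D ^ b) p.2 ∧
      |‖p.1 - p.2‖ - ‖q.1 - q.2‖| ≤ (D : ℝ) ^ (1 - (b : ℝ)) with hZ
    have hmem : ∀ p ∈ Z, p.1 ∈ X ∧ p.2 ∈ Y := fun p hp =>
      Finset.mem_product.1 (hE (hE' (Finset.mem_filter.1 hp).1))
    have hcard : ((Z.image fun p => cell (D ^ (b - t)) p.2).card : ℝ) ≤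
        (D : ℝ) ^ (G (b - t) + l t) := by
      refine card_image_le_of_tube (b := b) (t := t) (E := E) (by omega) hG0 hb
        ((Finset.filter_subset _ _).trans hE')
        (fun p hp => hY.zero _ (hmem p hp).2) (fun p hp => hcount p (Finset.mem_filter.1 hp).1)
        (fun p hp q hq => (Finset.mem_filter.1 hq).2.1.trans (Finset.mem_filter.1 hp).2.1.symm)
        ?_ (hl t hat htb) (by omega)
      intro p hp q hq c c' _ hct hbt hcell
      obtain ⟨-, hpx, p', hp', hp'Q, hp'y, hpd⟩ := Finset.mem_filter.1 hp
      obtain ⟨-, hqx, q', hq', hq'Q, hq'y, hqd⟩ := Finset.mem_filter.1 hq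
      have hX' := (Finset.mem_product.1 (hE (hE' hp'))).1
      have hcongr : ∀ k ≤ b, adj (D ^ k) x (rep Q) ↔ adj (D ^ k) p.1 p'.1 := fun k hk =>
        adj_congr (cell_pow_of_le (by omega) hk hpx.symm)
          (cell_pow_of_le (by omega) hk ((hrep Q hQ).2.trans hp'Q.symm))
      refine strip_geometry (t := t) (b := b) (c := c) hD (hX.zero _ (hmem p hp).1)
        (hY.zero _ (hmem p hp).2) (hX.zero _ hX') (hY.zero _ (hmem q hq).2) hp'y hq'y
        (hqx.trans hpx.symm) (hq'Q.trans hp'Q.symm) hcell hpd hqd ((hcongr t htb).1 hadj)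
        (fun h => mt (hcongr _ (by omega)).2 (hnadj h)) hct hbt
    have hmaps : ∀ y ∈ Y.filter fun y => R y x Q, cell (D ^ (b - t)) y ∈
        Z.image fun p => cell (D ^ (b - t)) p.2 := by
      intro y hy
      obtain ⟨hyY, q, hq, hqQ, hqx, hqy, p, hp, hpx, hpy, hd⟩ := Finset.mem_filter.1 hy
      refine Finset.mem_image.2 ⟨p, Finset.mem_filter.2 ⟨hp, hpx, q, hq, hqQ,
        hqy.trans hpy.symm, hd⟩, cell_pow_of_le (by omega) (by omega) hpy⟩
    rw [← Finset.sum_fiberwise_of_maps_to hmaps]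
    calc _ ≤ ∑ q ∈ Z.image fun p => cell (D ^ (b - t)) p.2,
          (D : ℝ) ^ (-(G (b - t) + ((b - t : ℕ) : ℝ))) := by
          refine Finset.sum_le_sum fun q _ => ?_
          refine le_trans (Finset.sum_le_sum_of_subset_of_nonneg ?_ fun x _ _ => hY.nonneg x)
            (hY.mass (b - t) (by omega) q)
          exact Finset.filter_subset_filter _ (Finset.filter_subset _ _)
      _ ≤ (D : ℝ) ^ (G (b - t) + l t) * (D : ℝ) ^ (-(G (b - t) + ((b - t : ℕ) : ℝ))) := by
          rw [Finset.sum_const, nsmul_eq_mul]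
          exact mul_le_mul_of_nonneg_right hcard (by positivity)
      _ = _ := by
          rw [← Real.rpow_add hD0, Nat.cast_sub htb]; ring_nf
  · intro x hx u hu T hTS hT
    rw [Finset.mem_Icc] at hu
    refine hX.card_adj_le hu.2 hb x rep T fun Q hQ => ?_
    obtain ⟨h1, y, hy, hxR⟩ := hT Q hQ
    refine ⟨(hrep Q (hTS hQ)).1, (hrep Q (hTS hQ)).2, ?_⟩
    have := (adjLevel_spec hab (hcell x y Q (hTS hQ) hxR)).2.2.1
    rwa [h1] at this
  · have hterm : ∀ t ∈ Finset.Icc a b, 9 * (D : ℝ) ^ (F b - F t + ((b : ℝ) - t) + 1) *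
        (D : ℝ) ^ (l t - ((b : ℝ) - t)) ≤ 9 * (D : ℝ) ^ (1 + F b - F a + e) := by
      intro t ht
      rw [Finset.mem_Icc] at ht
      rw [mul_assoc, ← Real.rpow_add hD0]
      have := hle t ht.1 ht.2
      exact mul_le_mul_of_nonneg_left (Real.rpow_le_rpow_of_exponent_le (by linarith)
        (by linarith)) (by norm_num)
    refine (Finset.sum_le_sum hterm).trans ?_
    rw [Finset.sum_const, nsmul_eq_mul, ← mul_assoc]
    refine const_mul_rpow_le ?_ (by linarith) (by linarith)
    have h1 : (Finset.Icc a b).card * 9 ≤ D := by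
      rw [Nat.card_Icc]; omega
    exact_mod_cast h1
  · intro p hp
    obtain ⟨q, hq, rfl⟩ := Finset.mem_map.1 hp
    have := Finset.mem_product.1 (hE (hE' hq))
    exact Finset.mem_product.2 ⟨this.2, this.1⟩

open Classical in
theorem sum_filter_exists_mem_le {ι κ : Type*} (s : Finset ι) (I : Finset κ) (w : ι → ℝ)
    (hw : ∀ p ∈ s, 0 ≤ w p) (P : κ → ι → Prop) :
    ∑ p ∈ s with ∃ i ∈ I, P i p, w p ≤ ∑ i ∈ I, ∑ p ∈ s with P i p, w p := by
  simp_rw [Finset.sum_filter]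
  rw [Finset.sum_comm]
  refine Finset.sum_le_sum fun p hp => ?_
  have hnn : ∀ i ∈ I, 0 ≤ if P i p then w p else 0 := fun i _ => by
    split_ifs
    exacts [hw p hp, le_rfl]
  by_cases h : ∃ i ∈ I, P i p
  · obtain ⟨i, hi, hP⟩ := h
    rw [if_pos ⟨i, hi, hP⟩]
    refine le_trans ?_ (Finset.single_le_sum hnn hi)
    rw [if_pos hP]
  · rw [if_neg h]
    exact Finset.sum_nonneg hnn

theorem exists_subset_le_thr {ι : Type*} (N : ℕ) (s : Finset ι) (w : ι → ℝ)
    (hw : ∀ p ∈ s, 0 ≤ w p)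
    (n : ℕ → ℕ → ι → ℝ) (valid : ℕ → ℕ → ℝ → Prop) (thr : ℕ → ℕ → ℝ → ℝ)
    (hthr : ∀ a b, Monotone (thr a b)) {β : ℝ} (hβ : 0 ≤ β)
    (h : ∀ a b, a ≤ b → b ≤ N → ∀ e, valid a b e →
      ∑ p ∈ s with thr a b e < n a b p, w p ≤ β) :
    ∃ s' ⊆ s, ∑ p ∈ s, w p ≤ ∑ p ∈ s', w p + (N + 1) ^ 2 * β ∧
      ∀ p ∈ s', ∀ a b, a ≤ b → b ≤ N → ∀ e, valid a b e → n a b p ≤ thr a b e := by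
  classical
  set I := ((Finset.range (N + 1)) ×ˢ (Finset.range (N + 1))).filter fun i => i.1 ≤ i.2 with hI
  set P : ℕ × ℕ → ι → Prop := fun i p => ∃ e, valid i.1 i.2 e ∧ thr i.1 i.2 e < n i.1 i.2 p with hP
  refine ⟨s.filter fun p => ¬ ∃ i ∈ I, P i p, Finset.filter_subset _ _, ?_, ?_⟩
  · rw [← Finset.sum_filter_add_sum_filter_not s (fun p => ∃ i ∈ I, P i p) w, add_comm]
    gcongr
    refine (sum_filter_exists_mem_le s I w hw P).trans ?_
    calc _ ≤ ∑ _i ∈ I, β := by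
          refine Finset.sum_le_sum fun i hi => ?_
          simp only [hI, Finset.mem_filter, Finset.mem_product, Finset.mem_range] at hi
          refine sum_filter_exists_lt_le s w (n i.1 i.2) (valid i.1 i.2) (thr i.1 i.2) (hthr _ _)
            hβ fun e he T hT hTs => ?_
          have : T = s.filter fun p => thr i.1 i.2 e < n i.1 i.2 p := by
            ext p
            rw [Finset.mem_filter]
            exact ⟨fun hp => ⟨hT hp, (hTs p (hT hp)).1 hp⟩, fun hp => (hTs p hp.1).2 hp.2⟩
          rw [this]
          exact h i.1 i.2 hi.2 (by omega) e he
      _ ≤ _ := by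
          rw [Finset.sum_const, nsmul_eq_mul]
          have : I.card ≤ (N + 1) ^ 2 := by
            refine (Finset.card_filter_le _ _).trans ?_
            rw [Finset.card_product, Finset.card_range, sq]
          gcongr
          exact_mod_cast this
  · intro p hp a b hab hb e he
    by_contra hlt
    push Not at hlt
    refine (Finset.mem_filter.1 hp).2 ⟨(a, b), ?_, e, he, hlt⟩
    simp only [hI, Finset.mem_filter, Finset.mem_product, Finset.mem_range]
    omega

open Classical in
theorem card_image_le_of_node {D N : ℕ} {X : Finset ℂ} {μ : ℂ → ℝ} {F G : ℕ → ℝ} {M : ℕ}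
    (hD : 2 ≤ D) (hX : Regular D N X μ F) (hF0 : F 0 = 0) {E E' : Finset (ℂ × ℂ)}
    (hE : ∀ p ∈ E, p.1 ∈ X) (hE' : E' ⊆ E)
    (hcount : ∀ p ∈ E', ∀ a b, a ≤ b → b ≤ N → ∀ e,
      (∀ t, a ≤ t → t ≤ b → ∃ l, Tube G 9 t (b - t) l ∧ F a - F t + l ≤ e) →
      (fibreCount E D a b p.1 p.2 : ℝ) ≤ (D : ℝ) ^ (3 + F b - F a + e))
    {y : ℂ} {r : ℝ} {b : ℕ} {l : ℝ} (hl : Node F G 9 M b l) (hb : b ≤ N) :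
    (((E'.filter fun p => p.2 = y ∧ |‖p.1 - p.2‖ - r| ≤ (D : ℝ) ^ (-(N : ℝ))).image
      fun p => cell (D ^ b) p.1).card : ℝ) ≤ (D : ℝ) ^ (F b + l + 1) := by
  have hD' : (2 : ℝ) ≤ D := by exact_mod_cast hD
  have hD0 : (0 : ℝ) < D := by linarith
  induction hl with
  | base =>
    refine le_trans ?_ ((hX.count 0 M (by omega) hb 0).trans_eq (by rw [hF0]; push_cast; ring_nf))
    rw [Nat.cast_le]
    refine Finset.card_le_card fun q hq => ?_
    obtain ⟨p, hp, rfl⟩ := Finset.mem_image.1 hq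
    have hp' := hE p (hE' (Finset.mem_filter.1 hp).1)
    exact Finset.mem_image_of_mem _ (Finset.mem_filter.2 ⟨hp', by simpa using hX.zero _ hp'⟩)
  | step a b l e _ hab he ih =>
    have h1 := ih (hab.trans hb)
    have hstep := card_image_le_card_image_mul
      (E'.filter fun p => p.2 = y ∧ |‖p.1 - p.2‖ - r| ≤ (D : ℝ) ^ (-(N : ℝ)))
      (fun p => cell (D ^ a) p.1) (fun p => cell (D ^ b) p.1)
      (B := (D : ℝ) ^ (3 + F b - F a + e)) fun p hp => ?_
    · calc _ ≤ _ := hstep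
        _ ≤ (D : ℝ) ^ (F a + l + 1) * (D : ℝ) ^ (3 + F b - F a + e) :=
          mul_le_mul_of_nonneg_right h1 (by positivity)
        _ ≤ _ := by
          rw [← Real.rpow_add hD0]
          exact Real.rpow_le_rpow_of_exponent_le (by linarith) (by linarith)
    · obtain ⟨hpE, hpy, hpr⟩ := Finset.mem_filter.1 hp
      refine le_trans ?_ (hcount p hpE a b hab hb e he)
      rw [fibreCount, Nat.cast_le]
      refine Finset.card_le_card (Finset.image_subset_image fun q hq => ?_)
      obtain ⟨hq1, hq2⟩ := Finset.mem_filter.1 hq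
      obtain ⟨hqE, hqy, hqr⟩ := Finset.mem_filter.1 hq1
      refine Finset.mem_filter.2 ⟨hE' hqE, hq2, by rw [hpy, hqy], p, hE' hpE, rfl, rfl, ?_⟩
      have e1 : (D : ℝ) ^ (1 - (b : ℝ)) = D * (D : ℝ) ^ (-(b : ℝ)) := by
        nth_rewrite 2 [← Real.rpow_one (D : ℝ)]
        rw [← Real.rpow_add hD0]; ring_nf
      have e2 : (D : ℝ) ^ (-(N : ℝ)) ≤ (D : ℝ) ^ (-(b : ℝ)) :=
        Real.rpow_le_rpow_of_exponent_le (by linarith) (by simpa using hb)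
      have e3 : 2 * (D : ℝ) ^ (-(b : ℝ)) ≤ D * (D : ℝ) ^ (-(b : ℝ)) := by gcongr
      have e4 := abs_sub_le ‖p.1 - p.2‖ r ‖q.1 - q.2‖
      rw [abs_sub_comm r] at e4
      linarith

set_option maxHeartbeats 400000 in
open Classical in
theorem rpow_le_card_of_node {D N : ℕ} {X Y : Finset ℂ} {μ ν : ℂ → ℝ} {F G : ℕ → ℝ} {M : ℕ}
    (hD : 40 ≤ D) (hDN : 9 * (N + 1) ≤ D) (hX : Regular D N X μ F) (hY : Regular D N Y ν G)
    (hF0 : F 0 = 0) (hG0 : G 0 = 0) {E : Finset (ℂ × ℂ)} (hE : E ⊆ X ×ˢ Y)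
    (thin : ∀ p ∈ E, ∀ j : ℕ, j ≤ N →
      ∑ x ∈ X with |cr (p.1 - p.2) (x - p.2)| ≤ (D : ℝ) ^ (-(j : ℝ)), μ x ≤
        (D : ℝ) ^ (1 - (j : ℝ)))
    {l : ℝ} (hl : Node F G 9 M N l)
    (hmass : (2 * (N + 1) ^ 2 + 1) / (D : ℝ) < ∑ p ∈ E, μ p.1 * ν p.2)
    {R : Finset ℝ} (hR : ∀ p ∈ E, ∃ r ∈ R, |‖p.1 - p.2‖ - r| ≤ (D : ℝ) ^ (-(N : ℝ))) :
    (D : ℝ) ^ ((N : ℝ) - l - 2) ≤ R.card := by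
  have hD' : (40 : ℝ) ≤ D := by exact_mod_cast hD
  have hD0 : (0 : ℝ) < D := by linarith
  have hw : ∀ p : ℂ × ℂ, 0 ≤ μ p.1 * ν p.2 := fun p => mul_nonneg (hX.nonneg _) (hY.nonneg _)
  have hmono : ∀ c : ℝ, Monotone fun e => (D : ℝ) ^ (c + e) := fun c x y hxy =>
    Real.rpow_le_rpow_of_exponent_le (by linarith) (by linarith)
  obtain ⟨E₁, hE₁, hm₁, hc₁⟩ := exists_subset_le_thr N E (fun p => μ p.1 * ν p.2) (fun p _ => hw p)
    (fun c c' p => tubeCount E D c c' p.1 p.2) (fun c c' e => ∀ u, c ≤ u → u ≤ c' → G c - G u ≤ e)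
    (fun c c' e => (D : ℝ) ^ (9 + G c' - G c + e)) (fun c c' => hmono _) (β := 1 / (D : ℝ))
    (by positivity) fun c c' hcc hc' e he => by
      simpa only using mass_tubeCount_le (by omega) hDN hX.zero hX.nonneg hX.sum_le hY hE
        thin hcc hc' he
  obtain ⟨E₂, hE₂, hm₂, hc₂⟩ := exists_subset_le_thr N E₁ (fun p => μ p.1 * ν p.2) (fun p _ => hw p)
    (fun a b p => fibreCount E₁ D a b p.1 p.2)
    (fun a b e => ∀ t, a ≤ t → t ≤ b → ∃ l, Tube G 9 t (b - t) l ∧ F a - F t + l ≤ e)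
    (fun a b e => (D : ℝ) ^ (3 + F b - F a + e)) (fun a b => hmono _) (β := 1 / (D : ℝ))
    (by positivity) fun a b hab hb e he => by
      simpa only using mass_fibreCount_le hD hDN hX hY hG0 hE hE₁ hc₁ hab hb he
  have hE₂X : E₂ ⊆ X ×ˢ Y := (hE₂.trans hE₁).trans hE
  have hm : 1 / (D : ℝ) < ∑ p ∈ E₂, μ p.1 * ν p.2 := by
    have h1 : (2 * ((N : ℝ) + 1) ^ 2 + 1) / D =
        (N + 1) ^ 2 * (1 / D) + (N + 1) ^ 2 * (1 / D) + 1 / D := by ring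
    linarith
  have hy : ∃ y ∈ Y, 1 / (D : ℝ) < ∑ p ∈ E₂ with p.2 = y, μ p.1 := by
    by_contra! hcon
    refine hm.not_ge ?_
    rw [← Finset.sum_fiberwise_of_maps_to (t := Y) (g := fun p : ℂ × ℂ => p.2)
      fun p hp => (Finset.mem_product.1 (hE₂X hp)).2]
    calc _ ≤ ∑ y ∈ Y, ν y * (1 / (D : ℝ)) := by
          refine Finset.sum_le_sum fun y hy => ?_
          rw [Finset.sum_congr rfl (g := fun p => ν y * μ p.1) fun p hp => by
            rw [(Finset.mem_filter.1 hp).2, mul_comm], ← Finset.mul_sum]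
          exact mul_le_mul_of_nonneg_left (hcon y hy) (hY.nonneg y)
      _ ≤ 1 * (1 / (D : ℝ)) := by
          rw [← Finset.sum_mul]
          exact mul_le_mul_of_nonneg_right hY.sum_le (by positivity)
      _ = _ := one_mul _
  obtain ⟨y, -, hy⟩ := hy
  set Z : ℝ → Finset (ℂ × ℂ) := fun r => E₂.filter fun p =>
    p.2 = y ∧ |‖p.1 - p.2‖ - r| ≤ (D : ℝ) ^ (-(N : ℝ)) with hZ
  have hZr : ∀ r ∈ R, ∑ p ∈ Z r, μ p.1 ≤ (D : ℝ) ^ (l + 1 - N) := by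
    intro r _
    have hcard := card_image_le_of_node (y := y) (r := r) (by omega) hX hF0
      (fun p hp => (Finset.mem_product.1 (hE (hE₁ hp))).1) hE₂ hc₂ hl le_rfl
    rw [← Finset.sum_fiberwise_of_maps_to (t := (Z r).image fun p => cell (D ^ N) p.1)
      (g := fun p => cell (D ^ N) p.1) fun p hp => Finset.mem_image_of_mem _ hp]
    calc _ ≤ ∑ q ∈ (Z r).image fun p => cell (D ^ N) p.1, (D : ℝ) ^ (-(F N + N)) := by
          refine Finset.sum_le_sum fun q _ => ?_
          refine le_trans ?_ (hX.mass N le_rfl q)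
          have hinj : Set.InjOn (Prod.fst : ℂ × ℂ → ℂ)
              ((Z r).filter fun p => cell (D ^ N) p.1 = q) := by
            intro p hp p' hp' h
            simp only [hZ, Finset.coe_filter, Finset.mem_filter, Set.mem_ofPred_eq] at hp hp'
            exact Prod.ext h (hp.1.2.1.trans hp'.1.2.1.symm)
          rw [← Finset.sum_image (f := μ) hinj]
          refine Finset.sum_le_sum_of_subset_of_nonneg ?_ fun x _ _ => hX.nonneg x
          intro x hx
          obtain ⟨p, hp, rfl⟩ := Finset.mem_image.1 hx
          simp only [hZ, Finset.mem_filter] at hp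
          exact Finset.mem_filter.2 ⟨(Finset.mem_product.1 (hE₂X hp.1.1)).1, hp.2⟩
      _ ≤ (D : ℝ) ^ (F N + l + 1) * (D : ℝ) ^ (-(F N + N)) := by
          rw [Finset.sum_const, nsmul_eq_mul]
          exact mul_le_mul_of_nonneg_right hcard (by positivity)
      _ = _ := by rw [← Real.rpow_add hD0]; ring_nf
  have htot : ∑ p ∈ E₂ with p.2 = y, μ p.1 ≤ R.card * (D : ℝ) ^ (l + 1 - N) := by
    calc _ ≤ ∑ p ∈ E₂ with ∃ r ∈ R, p.2 = y ∧ |‖p.1 - p.2‖ - r| ≤ (D : ℝ) ^ (-(N : ℝ)), μ p.1 := by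
          refine Finset.sum_le_sum_of_subset_of_nonneg ?_ fun p _ _ => hX.nonneg _
          intro p hp
          obtain ⟨hp, hpy⟩ := Finset.mem_filter.1 hp
          obtain ⟨r, hr, hpr⟩ := hR p (hE₁ (hE₂ hp))
          exact Finset.mem_filter.2 ⟨hp, r, hr, hpy, hpr⟩
      _ ≤ ∑ r ∈ R, ∑ p ∈ Z r, μ p.1 :=  by
          convert sum_filter_exists_mem_le E₂ R (fun p => μ p.1) (fun p _ => hX.nonneg _)
            fun r p => p.2 = y ∧ |‖p.1 - p.2‖ - r| ≤ (D : ℝ) ^ (-(N : ℝ))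
      _ ≤ ∑ _r ∈ R, (D : ℝ) ^ (l + 1 - N) := Finset.sum_le_sum hZr
      _ = _ := by rw [Finset.sum_const, nsmul_eq_mul]
  have hfin := hy.le.trans htot
  rw [← div_le_iff₀ (by positivity)] at hfin
  refine le_trans (le_of_eq ?_) hfin
  rw [one_div, ← Real.rpow_neg_one, ← Real.rpow_sub hD0]
  ring_nf

/-- The triangular kernel of width `h`. -/
noncomputable def hat (h u : ℝ) : ℝ := max (h - |u|) 0

/-- The indicator function of the half-open interval of length `h` that ends at `a`. -/
noncomputable def box (h a r : ℝ) : ℝ := (Ioc (a - h) a).indicator 1 r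

theorem box_nonneg (h a r : ℝ) : 0 ≤ box h a r := indicator_nonneg (fun _ _ => zero_le_one) r

theorem box_le_one (h a r : ℝ) : box h a r ≤ 1 :=
  indicator_le' (f := 1) (g := 1) (fun _ _ => le_rfl) (fun _ _ => zero_le_one) r

theorem box_mul_box (h a b r : ℝ) :
    box h a r * box h b r = (Ioc (max a b - h) (min a b)).indicator 1 r := by
  simp only [box, indicator, mem_Ioc, Pi.one_apply, sub_lt_iff_lt_add, max_lt_iff, le_min_iff]
  split_ifs <;> first | (norm_num; done) | (exfalso; grind)

theorem integrable_box (h a : ℝ) : Integrable (box h a) := by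
  refine IntegrableOn.integrable_indicator ?_ measurableSet_Ioc
  exact integrableOn_const (μ := volume) (C := (1 : ℝ)) (by simp)

theorem integral_box (h a : ℝ) (hh : 0 ≤ h) : ∫ r, box h a r = h := by
  simp only [box]
  rw [integral_indicator_one measurableSet_Ioc]
  simp [hh]

theorem integrable_box_mul_box (h a b : ℝ) : Integrable fun r => box h a r * box h b r := by
  simp_rw [box_mul_box]
  refine IntegrableOn.integrable_indicator ?_ measurableSet_Ioc
  exact integrableOn_const (μ := volume) (C := (1 : ℝ)) (by simp)

theorem integral_box_mul_box (h a b : ℝ) : ∫ r, box h a r * box h b r = hat h (a - b) := by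
  simp_rw [box_mul_box]
  rw [integral_indicator_one measurableSet_Ioc, Real.volume_real_Ioc, hat, ← max_sub_min_eq_abs']
  congr 1
  ring

theorem box_natCast_mul (h a r : ℝ) (hh : 0 < h) (R : ℕ) :
    box (R * h) a r = ∑ j ∈ Finset.range R, box h a (r + j * h) := by
  induction R with
  | zero => simp [box]
  | succ R ih =>
    rw [Finset.sum_range_succ, ← ih]
    have h1 : (0 : ℝ) ≤ R * h := by positivity
    simp only [box, indicator, mem_Ioc, Pi.one_apply]
    push_cast
    split_ifs <;> first | (norm_num; done) | (exfalso; grind)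

theorem sum_mul_boxes_le {ι : Type*} (X Y : Finset ι) (p μ ν : ι → ℝ) (hμ : ∀ x, 0 ≤ μ x)
    (hν : ∀ x, 0 ≤ ν x) {h κ : ℝ} {P : Finset (ι × ι)} (hP : P ⊆ X ×ˢ Y)
    (hp : ∀ q ∈ P, |p q.1 - p q.2| ≤ h / 4)
    (hk : ∀ q ∈ P, ∃ X' ⊆ X, (∀ x ∈ X', |p x - p q.2| ≤ h / 4) ∧ κ ≤ ∑ x ∈ X', μ x) (r : ℝ) :
    ∑ q ∈ P, μ q.1 * ν q.2 * box (h / 2) (p q.2 - h / 4) r ≤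
      (if κ ≤ ∑ x ∈ X, μ x * box h (p x) r then ∑ x ∈ X, μ x * box h (p x) r else 0) *
        ∑ y ∈ Y, ν y * box h (p y) r := by
  classical
  have hbox : ∀ x y, |p x - p y| ≤ h / 4 → box (h / 2) (p y - h / 4) r ≤ box h (p x) r := by
    intro x y hxy
    rw [abs_le] at hxy
    simp only [box]
    refine indicator_le_indicator_of_subset (fun s hs => ?_) (fun _ => zero_le_one) r
    simp only [mem_Ioc] at hs ⊢
    constructor <;> linarith [hs.1, hs.2, hxy.1, hxy.2]
  split_ifs with hc
  · rw [Finset.sum_mul_sum, ← Finset.sum_product']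
    calc _ ≤ ∑ q ∈ P, μ q.1 * box h (p q.1) r * (ν q.2 * box h (p q.2) r) := by
          refine Finset.sum_le_sum fun q hq => ?_
          have h1 := hbox q.1 q.2 (hp q hq)
          have h2 := hbox q.2 q.2 (by simpa using (abs_nonneg _).trans (hp q hq))
          have h3 : box (h / 2) (p q.2 - h / 4) r ≤ box h (p q.1) r * box h (p q.2) r := by
            have h4 := box_le_one (h / 2) (p q.2 - h / 4) r
            have h5 := box_nonneg (h / 2) (p q.2 - h / 4) r
            nlinarith [mul_le_mul h1 h2 h5 (box_nonneg h (p q.1) r), show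
              box (h / 2) (p q.2 - h / 4) r * box (h / 2) (p q.2 - h / 4) r =
                box (h / 2) (p q.2 - h / 4) r by
              simp only [box, indicator]; split_ifs <;> simp]
          calc _ ≤ μ q.1 * ν q.2 * (box h (p q.1) r * box h (p q.2) r) :=
                mul_le_mul_of_nonneg_left h3 (mul_nonneg (hμ _) (hν _))
            _ = _ := by ring
      _ ≤ _ := Finset.sum_le_sum_of_subset_of_nonneg hP fun q _ _ =>
          mul_nonneg (mul_nonneg (hμ _) (box_nonneg _ _ _)) (mul_nonneg (hν _) (box_nonneg _ _ _))
  · rw [zero_mul]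
    refine (Finset.sum_eq_zero fun q hq => ?_).le
    by_contra hne
    apply hc
    have hb : box (h / 2) (p q.2 - h / 4) r = 1 := by
      have := (mul_ne_zero_iff.1 hne).2
      simp only [box] at this ⊢
      exact indicator_of_mem (mem_of_indicator_ne_zero this) _
    obtain ⟨X', hX', h1, h2⟩ := hk q hq
    refine h2.trans ?_
    calc _ ≤ ∑ x ∈ X', μ x * box h (p x) r := by
          refine Finset.sum_le_sum fun x hx => ?_
          have := hbox x q.2 (h1 x hx)
          rw [hb] at this
          nlinarith [hμ x]
      _ ≤ _ := Finset.sum_le_sum_of_subset_of_nonneg hX' fun x _ _ =>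
          mul_nonneg (hμ _) (box_nonneg _ _ _)

theorem sum_heavy_sq_le (R : ℕ) (hR : 1 ≤ R) (a : ℕ → ℝ) {κ : ℝ}
    (hRκ : 2 ≤ R * κ) (h1 : ∑ j ∈ Finset.range R, a j ≤ 1) (h0 : ∀ j, 0 ≤ a j) :
    ∑ j ∈ Finset.range R, (if κ ≤ a j then a j else 0) ^ 2 ≤
      4 * (∑ j ∈ Finset.range R, a j ^ 2 - (∑ j ∈ Finset.range R, a j) ^ 2 / R) := by
  set c := ∑ j ∈ Finset.range R, a j with hc
  have hR0 : (0 : ℝ) < R := by exact_mod_cast hR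
  have hc0 : 0 ≤ c := Finset.sum_nonneg fun j _ => h0 j
  have hvar : ∑ j ∈ Finset.range R, a j ^ 2 - c ^ 2 / R =
      ∑ j ∈ Finset.range R, (a j - c / R) ^ 2 := by
    have : ∀ j, (a j - c / R) ^ 2 = a j ^ 2 - 2 * (c / R) * a j + (c / R) ^ 2 := fun j => by ring
    simp_rw [this]
    rw [Finset.sum_add_distrib, Finset.sum_sub_distrib, ← Finset.mul_sum, ← hc, Finset.sum_const,
      Finset.card_range, nsmul_eq_mul]
    field_simp
    ring
  rw [hvar, Finset.mul_sum]
  refine Finset.sum_le_sum fun j _ => ?_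
  split_ifs with hj
  · have h2 : c / R ≤ κ / 2 := by
      rw [div_le_iff₀ hR0]; linarith
    have h3 : a j ^ 2 ≤ (2 * (a j - c / R)) ^ 2 := pow_le_pow_left₀ (h0 j) (by linarith) 2
    linarith
  · rw [zero_pow two_ne_zero]; positivity

theorem integral_sq_sum_box {ι : Type*} (X : Finset ι) (p μ : ι → ℝ) (h : ℝ) :
    Integrable (fun r => (∑ x ∈ X, μ x * box h (p x) r) ^ 2) ∧
    ∫ r, (∑ x ∈ X, μ x * box h (p x) r) ^ 2 =
      ∑ x ∈ X, ∑ x' ∈ X, μ x * μ x' * hat h (p x - p x') := by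
  have h1 : ∀ r, (∑ x ∈ X, μ x * box h (p x) r) ^ 2 =
      ∑ x ∈ X, ∑ x' ∈ X, μ x * μ x' * (box h (p x) r * box h (p x') r) := by
    intro r
    rw [sq, Finset.sum_mul_sum]
    exact Finset.sum_congr rfl fun x _ => Finset.sum_congr rfl fun x' _ => by ring
  have hi : ∀ x x', Integrable fun r => μ x * μ x' * (box h (p x) r * box h (p x') r) :=
    fun x x' => (integrable_box_mul_box _ _ _).const_mul _
  simp_rw [h1]
  refine ⟨integrable_finsetSum _ fun x _ => integrable_finsetSum _ fun x' _ => hi x x', ?_⟩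
  rw [integral_finsetSum _ fun x _ => integrable_finsetSum _ fun x' _ => hi x x']
  refine Finset.sum_congr rfl fun x _ => ?_
  rw [integral_finsetSum _ fun x' _ => hi x x']
  refine Finset.sum_congr rfl fun x' _ => ?_
  rw [integral_const_mul, integral_box_mul_box]

theorem mass_le_of_heavy {ι : Type*} (X Y : Finset ι) (p μ ν : ι → ℝ) (hμ : ∀ x, 0 ≤ μ x)
    (hν : ∀ x, 0 ≤ ν x) (hμ1 : ∑ x ∈ X, μ x ≤ 1) {h κ c : ℝ} (hh : 0 < h) (hc : 0 < c) {R : ℕ}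
    (hR : 1 ≤ R) (hRκ : 2 ≤ R * κ) {P : Finset (ι × ι)} (hP : P ⊆ X ×ˢ Y)
    (hp : ∀ q ∈ P, |p q.1 - p q.2| ≤ h / 4)
    (hk : ∀ q ∈ P, ∃ X' ⊆ X, (∀ x ∈ X', |p x - p q.2| ≤ h / 4) ∧ κ ≤ ∑ x ∈ X', μ x) :
    h / 2 * ∑ q ∈ P, μ q.1 * ν q.2 ≤
      2 * c * (∑ x ∈ X, ∑ x' ∈ X, μ x * μ x' *
        (hat h (p x - p x') - hat (R * h) (p x - p x') / R ^ 2)) +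
      1 / (2 * c) * ∑ y ∈ Y, ∑ y' ∈ Y, ν y * ν y' * hat h (p y - p y') := by
  have hR0 : (0 : ℝ) < R := by exact_mod_cast hR
  set A : ℝ → ℝ := fun r => ∑ x ∈ X, μ x * box h (p x) r with hA
  set m : ℝ → ℝ := fun r => ∑ y ∈ Y, ν y * box h (p y) r with hm
  set B : ℝ → ℝ := fun r => ∑ x ∈ X, μ x * box (R * h) (p x) r with hB
  set f : ℝ → ℝ := fun r => ∑ q ∈ P, μ q.1 * ν q.2 * box (h / 2) (p q.2 - h / 4) r with hf
  obtain ⟨iA, eA⟩ := integral_sq_sum_box X p μ h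
  obtain ⟨im, em⟩ := integral_sq_sum_box Y p ν h
  obtain ⟨iB, eB⟩ := integral_sq_sum_box X p μ (R * h)
  have hfi : ∀ q ∈ P, Integrable fun r => μ q.1 * ν q.2 * box (h / 2) (p q.2 - h / 4) r :=
    fun q _ => (integrable_box _ _).const_mul _
  have if' : Integrable f := integrable_finsetSum _ hfi
  have ef : ∫ r, f r = h / 2 * ∑ q ∈ P, μ q.1 * ν q.2 := by
    rw [hf, integral_finsetSum _ hfi, Finset.mul_sum]
    refine Finset.sum_congr rfl fun q _ => ?_
    rw [integral_const_mul, integral_box _ _ (by positivity), mul_comm]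
  have hBA : ∀ r, B r = ∑ j ∈ Finset.range R, A (r + j * h) := by
    intro r
    simp only [hB, hA]
    rw [Finset.sum_comm]
    refine Finset.sum_congr rfl fun x _ => ?_
    rw [box_natCast_mul _ _ _ hh, Finset.mul_sum]
  have hB1 : ∀ r, B r ≤ 1 := fun r => by
    refine (Finset.sum_le_sum fun x _ => ?_).trans hμ1
    exact mul_le_of_le_one_right (hμ x) (box_le_one _ _ _)
  have hA0 : ∀ r, 0 ≤ A r := fun r =>
    Finset.sum_nonneg fun x _ => mul_nonneg (hμ x) (box_nonneg _ _ _)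
  have hpt : ∀ r, ∑ j ∈ Finset.range R, f (r + j * h) ≤
      2 * c * (∑ j ∈ Finset.range R, A (r + j * h) ^ 2 - B r ^ 2 / R) +
      1 / (2 * c) * ∑ j ∈ Finset.range R, m (r + j * h) ^ 2 := by
    intro r
    have h1 := sum_heavy_sq_le R hR (fun j => A (r + j * h)) hRκ
      (by rw [← hBA]; exact hB1 r) fun j => hA0 _
    rw [← hBA] at h1
    have h2 : ∀ j, f (r + j * h) ≤
        c / 2 * (if κ ≤ A (r + j * h) then A (r + j * h) else 0) ^ 2 +
          1 / (2 * c) * m (r + j * h) ^ 2 := by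
      intro j
      refine (sum_mul_boxes_le X Y p μ ν hμ hν hP hp hk (r + j * h)).trans ?_
      set g := if κ ≤ A (r + j * h) then A (r + j * h) else 0
      change g * m (r + j * h) ≤ _
      have h3 : c / 2 * g ^ 2 + 1 / (2 * c) * m (r + j * h) ^ 2 - g * m (r + j * h) =
        (c * g - m (r + j * h)) ^ 2 / (2 * c) := by field_simp; ring
      have h4 : 0 ≤ (c * g - m (r + j * h)) ^ 2 / (2 * c) := by positivity
      linarith
    calc _ ≤ ∑ j ∈ Finset.range R, _ := Finset.sum_le_sum fun j _ => h2 j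
      _ ≤ _ := by
        rw [Finset.sum_add_distrib, ← Finset.mul_sum, ← Finset.mul_sum]
        have := mul_le_mul_of_nonneg_left h1 (by positivity : 0 ≤ c / 2)
        linarith
  have iA' : ∀ j ∈ Finset.range R, Integrable fun r => A (r + (j : ℝ) * h) ^ 2 :=
    fun j _ => iA.comp_add_right _
  have im' : ∀ j ∈ Finset.range R, Integrable fun r => m (r + (j : ℝ) * h) ^ 2 :=
    fun j _ => im.comp_add_right _
  have ifj : ∀ j ∈ Finset.range R, Integrable fun r => f (r + (j : ℝ) * h) :=
    fun j _ => if'.comp_add_right _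
  have iB' : Integrable fun r => B r ^ 2 / R := iB.div_const (R : ℝ)
  have sAi := integrable_finsetSum _ iA'
  have smi := integrable_finsetSum _ im'
  have i1 : Integrable fun r => 2 * c * (∑ j ∈ Finset.range R, A (r + j * h) ^ 2 - B r ^ 2 / R) :=
    (sAi.sub iB').const_mul _
  have i2 : Integrable fun r => 1 / (2 * c) * ∑ j ∈ Finset.range R, m (r + j * h) ^ 2 :=
    smi.const_mul _
  have hle := integral_mono (integrable_finsetSum _ ifj) (i1.add i2) hpt
  simp only [Pi.add_apply] at hle
  rw [integral_finsetSum _ ifj, integral_add i1 i2, integral_const_mul, integral_const_mul,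
    integral_sub sAi iB', integral_finsetSum _ iA', integral_finsetSum _ im', integral_div] at hle
  have sA : ∀ j : ℕ, ∫ r, A (r + (j : ℝ) * h) ^ 2 = ∫ r, A r ^ 2 := fun j =>
    integral_add_right_eq_self (fun r => A r ^ 2) _
  have sm : ∀ j : ℕ, ∫ r, m (r + (j : ℝ) * h) ^ 2 = ∫ r, m r ^ 2 := fun j =>
    integral_add_right_eq_self (fun r => m r ^ 2) _
  have sf : ∀ j : ℕ, ∫ r, f (r + (j : ℝ) * h) = ∫ r, f r := fun j =>
    integral_add_right_eq_self f _
  simp only [sA, sm, sf, Finset.sum_const, Finset.card_range, nsmul_eq_mul] at hle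
  rw [ef] at hle
  have eA' : ∫ r, A r ^ 2 = _ := eA
  have em' : ∫ r, m r ^ 2 = _ := em
  have eB' : ∫ r, B r ^ 2 = _ := eB
  rw [eA', em', eB'] at hle
  refine le_of_mul_le_mul_left (hle.trans_eq ?_) hR0
  have : ∑ x ∈ X, ∑ x' ∈ X, μ x * μ x' *
        (hat h (p x - p x') - hat (R * h) (p x - p x') / R ^ 2) =
      ∑ x ∈ X, ∑ x' ∈ X, μ x * μ x' * hat h (p x - p x') -
      (∑ x ∈ X, ∑ x' ∈ X, μ x * μ x' * hat (R * h) (p x - p x')) / R ^ 2 := by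
    rw [Finset.sum_div, ← Finset.sum_sub_distrib]
    refine Finset.sum_congr rfl fun x _ => ?_
    rw [Finset.sum_div, ← Finset.sum_sub_distrib]
    exact Finset.sum_congr rfl fun x' _ => by ring
  rw [this]
  field_simp

theorem hat_le_hat {h u v : ℝ} (huv : |u| ≤ |v|) : hat h v ≤ hat h u :=
  max_le_max (by linarith) le_rfl

theorem hat_nonneg (h u : ℝ) : 0 ≤ hat h u := le_max_right _ _

theorem hat_le {h : ℝ} (hh : 0 ≤ h) (u : ℝ) : hat h u ≤ h :=
  max_le (by linarith [abs_nonneg u]) hh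

theorem hat_eq_zero {h u : ℝ} (hu : h ≤ |u|) : hat h u = 0 := max_eq_right (by linarith)

theorem continuous_hat (h : ℝ) : Continuous (hat h) := by
  unfold hat; fun_prop

theorem integral_hat_mul {h c b : ℝ} (hh : 0 ≤ h) (hc : 0 < c) (hb : h ≤ c * b) :
    ∫ θ in (-b)..b, hat h (c * θ) = h ^ 2 / c := by
  have hi : ∀ x y, IntervalIntegrable (fun θ => hat h (c * θ)) volume x y := fun x y =>
    ((continuous_hat h).comp (by fun_prop)).intervalIntegrable x y
  have hb' : h / c ≤ b := by rw [div_le_iff₀ hc]; linarith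
  have h0 : 0 ≤ h / c := by positivity
  have hpos : ∫ θ in (0 : ℝ)..b, hat h (c * θ) = h ^ 2 / (2 * c) := by
    rw [← intervalIntegral.integral_add_adjacent_intervals (hi 0 (h / c)) (hi (h / c) b)]
    have h1 : ∫ θ in (h / c)..b, hat h (c * θ) = 0 := by
      rw [intervalIntegral.integral_congr (g := fun _ => (0 : ℝ))]
      · simp
      · intro θ hθ
        rw [uIcc_of_le hb'] at hθ
        refine hat_eq_zero ?_
        rw [abs_of_nonneg (mul_nonneg hc.le (h0.trans hθ.1)), mul_comm]
        exact (div_le_iff₀ hc).1 hθ.1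
    have h2 : ∫ θ in (0 : ℝ)..(h / c), hat h (c * θ) = ∫ θ in (0 : ℝ)..(h / c), (h - c * θ) := by
      refine intervalIntegral.integral_congr fun θ hθ => ?_
      rw [uIcc_of_le h0] at hθ
      have := (le_div_iff₀ hc).1 hθ.2
      simp only [hat]
      rw [abs_of_nonneg (mul_nonneg hc.le hθ.1), max_eq_left (by linarith)]
    rw [h1, h2, intervalIntegral.integral_sub (by simp) (by
      exact (continuous_const.mul continuous_id).intervalIntegrable _ _),
      intervalIntegral.integral_const, intervalIntegral.integral_const_mul, integral_id]
    simp only [smul_eq_mul]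
    field_simp
    ring
  have hneg : ∫ θ in (-b)..(0 : ℝ), hat h (c * θ) = h ^ 2 / (2 * c) := by
    rw [← hpos]
    have := intervalIntegral.integral_comp_neg (fun θ => hat h (c * θ)) (a := 0) (b := b)
    rw [neg_zero] at this
    rw [← this]
    simp [hat]
  rw [← intervalIntegral.integral_add_adjacent_intervals (hi (-b) 0) (hi 0 b), hpos, hneg]
  field_simp
  ring

theorem integral_hat_mul_le {h c b : ℝ} (hh : 0 ≤ h) (hc : 0 < c) (hb : 0 ≤ b) :
    ∫ θ in (-b)..b, hat h (c * θ) ≤ h ^ 2 / c := by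
  have h1 := integral_hat_mul (b := max b (h / c)) hh hc (by
    have := le_max_right b (h / c)
    rw [div_le_iff₀ hc] at this
    linarith)
  rw [← h1]
  refine intervalIntegral.integral_mono_interval (neg_le_neg (le_max_left _ _)) (by linarith)
    (le_max_left _ _) (ae_of_all _ fun θ => hat_nonneg _ _) ?_
  exact ((continuous_hat h).comp (by fun_prop)).intervalIntegrable _ _

/-- The measure of the directions, on a quarter of the circle, weighted by the triangular kernel, in
which the projections of two points at distance `ρ` are close. -/
noncomputable def angular (h ρ : ℝ) : ℝ := ∫ θ in (-(Real.pi / 2))..(Real.pi / 2),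
  hat h (ρ * Real.sin θ)

theorem angular_le_of_forall {h ρ : ℝ} {g : ℝ → ℝ} (hg : Continuous g)
    (hle : ∀ θ, |θ| ≤ Real.pi / 2 → hat h (ρ * Real.sin θ) ≤ g θ) :
    angular h ρ ≤ ∫ θ in (-(Real.pi / 2))..(Real.pi / 2), g θ := by
  refine intervalIntegral.integral_mono_on (by linarith [Real.pi_pos])
    (((continuous_hat h).comp (by fun_prop)).intervalIntegrable _ _) (hg.intervalIntegrable _ _)
    fun θ hθ => hle θ (abs_le.2 hθ)

theorem angular_le_mul {h ρ : ℝ} (hh : 0 ≤ h) : angular h ρ ≤ Real.pi * h := by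
  refine (angular_le_of_forall continuous_const fun θ _ => hat_le hh _).trans_eq ?_
  rw [intervalIntegral.integral_const, smul_eq_mul]
  ring

theorem mul_abs_le_abs_sin {θ : ℝ} (hθ : |θ| ≤ Real.pi / 2) :
    2 / Real.pi * |θ| ≤ |Real.sin θ| := by
  have h1 := Real.mul_le_sin (abs_nonneg θ) hθ
  rcases abs_cases θ with ⟨h2, -⟩ | ⟨h2, -⟩ <;> rw [h2] at h1 ⊢
  · exact h1.trans (le_abs_self _)
  · rw [Real.sin_neg] at h1
    exact h1.trans (neg_le_abs _)

theorem angular_le_div {h ρ : ℝ} (hh : 0 ≤ h) (hρ : 0 < ρ) :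
    angular h ρ ≤ Real.pi / 2 * (h ^ 2 / ρ) := by
  have hc : 0 < ρ * (2 / Real.pi) := by positivity
  refine (angular_le_of_forall (g := fun θ => hat h (ρ * (2 / Real.pi) * θ))
    ((continuous_hat h).comp (by fun_prop)) fun θ hθ => hat_le_hat ?_).trans
    ((integral_hat_mul_le hh hc (by positivity)).trans_eq (by field_simp))
  rw [abs_mul, abs_mul, abs_mul, abs_of_pos hρ, abs_of_pos (show 0 < 2 / Real.pi by positivity),
    mul_assoc]
  exact mul_le_mul_of_nonneg_left (mul_abs_le_abs_sin hθ) hρ.le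

theorem div_le_angular {h ρ : ℝ} (hh : 0 ≤ h) (hρ : 0 < ρ) (hhρ : h ≤ ρ) :
    h ^ 2 / ρ ≤ angular h ρ := by
  have hpi := Real.pi_gt_three
  rw [← integral_hat_mul (b := Real.pi / 2) hh hρ (by nlinarith)]
  refine intervalIntegral.integral_mono_on (by linarith)
    (((continuous_hat h).comp (by fun_prop)).intervalIntegrable _ _)
    (((continuous_hat h).comp (by fun_prop)).intervalIntegrable _ _) fun θ _ => hat_le_hat ?_
  rw [abs_mul, abs_mul]
  exact mul_le_mul_of_nonneg_left (Real.abs_sin_le_abs) (abs_nonneg _)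

theorem angular_le_add {h ρ : ℝ} (hh : 0 ≤ h) (hρ : 0 < ρ) (hhρ : 2 * h ≤ ρ) :
    angular h ρ ≤ h ^ 2 / ρ + 2 * h ^ 4 / ρ ^ 3 := by
  have hpi := Real.pi_gt_three
  have hpi2 := Real.pi_lt_d2
  set q := h / ρ with hq
  have hq0 : 0 ≤ q := by positivity
  have hq2 : q ≤ 1 / 2 := by rw [hq, div_le_iff₀ hρ]; linarith
  have hhq : h = q * ρ := by rw [hq]; field_simp
  have hc : 1 / (1 + 2 * q ^ 2) ≤ 1 - 5 / 8 * q ^ 2 * 1.1 := by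
    rw [div_le_iff₀ (by positivity)]
    nlinarith [mul_nonneg hq0 hq0, mul_self_nonneg (q * q), mul_le_mul hq2 hq2 hq0 (by norm_num)]
  have hc0 : 0 < ρ / (1 + 2 * q ^ 2) := by positivity
  refine (angular_le_of_forall (g := fun θ => hat h (ρ / (1 + 2 * q ^ 2) * θ))
    ((continuous_hat h).comp (by fun_prop)) fun θ hθ => ?_).trans
    ((integral_hat_mul_le hh hc0 (by positivity)).trans_eq ?_)
  · by_cases hd : q ≤ 2 / Real.pi * |θ|
    · rw [hat_eq_zero]
      · exact hat_nonneg _ _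
      · rw [abs_mul, abs_of_pos hρ]
        calc h = ρ * q := by rw [hhq]; ring
          _ ≤ ρ * |Real.sin θ| :=
            mul_le_mul_of_nonneg_left (hd.trans (mul_abs_le_abs_sin hθ)) hρ.le
    · push Not at hd
      have hd' : |θ| ≤ 1.575 * q := by
        rw [div_mul_eq_mul_div, div_lt_iff₀ Real.pi_pos] at hd
        nlinarith
      refine hat_le_hat ?_
      rw [abs_mul, abs_mul, abs_of_pos hρ, abs_of_pos hc0, div_mul_eq_mul_div, mul_div_assoc]
      refine mul_le_mul_of_nonneg_left ?_ hρ.le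
      have hs : |θ| * (1 - |θ| ^ 2 / 4) ≤ |Real.sin θ| := by
        rcases (abs_nonneg θ).eq_or_lt with h0 | h0
        · rw [← h0]; simp
        · have h1 := Real.sin_gt_sub_cube h0
          rw [← Real.abs_sin_eq_sin_abs_of_abs_le_pi (by linarith)] at h1
          nlinarith [pow_pos h0 3]
      calc |θ| / (1 + 2 * q ^ 2) = |θ| * (1 / (1 + 2 * q ^ 2)) := by ring
        _ ≤ |θ| * (1 - |θ| ^ 2 / 4) := by
          refine mul_le_mul_of_nonneg_left (hc.trans ?_) (abs_nonneg _)
          have := pow_le_pow_left₀ (abs_nonneg θ) hd' 2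
          rw [mul_pow] at this
          nlinarith [sq_nonneg q]
        _ ≤ _ := hs
  · rw [hhq]; field_simp
    
/-- The orthogonal projection in direction `θ`. -/
noncomputable def proj (θ : ℝ) (z : ℂ) : ℝ := z.re * Real.cos θ + z.im * Real.sin θ

theorem proj_sub (θ : ℝ) (z w : ℂ) : proj θ (z - w) = proj θ z - proj θ w := by
  simp only [proj, Complex.sub_re, Complex.sub_im]; ring

theorem proj_eq (θ : ℝ) (z : ℂ) :
    proj θ z = ‖z‖ * Real.sin (θ + (Real.pi / 2 - Complex.arg z)) := by
  rw [proj, ← add_sub_assoc, add_sub_right_comm, Real.sin_add_pi_div_two, Real.cos_sub, mul_add]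
  have h1 := Complex.norm_mul_cos_arg z
  have h2 := Complex.norm_mul_sin_arg z
  linear_combination -Real.cos θ * h1 - Real.sin θ * h2

theorem integral_hat_proj (h : ℝ) (z : ℂ) :
    ∫ θ in (-(2 * Real.pi))..(2 * Real.pi), hat h (proj θ z) = 4 * angular h ‖z‖ := by
  simp_rw [proj_eq]
  have hper : Function.Periodic (fun θ => hat h (‖z‖ * Real.sin θ)) Real.pi := by
    intro θ
    simp only [hat, Real.sin_add_pi, abs_mul, abs_neg]
  rw [intervalIntegral.integral_comp_add_right (fun θ => hat h (‖z‖ * Real.sin θ))]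
  have h1 := hper.intervalIntegral_add_zsmul_eq 4
    (-(2 * Real.pi) + (Real.pi / 2 - Complex.arg z)) (fun x y =>
      ((continuous_hat h).comp (by fun_prop)).intervalIntegrable x y)
  have h2 := hper.intervalIntegral_add_eq (-(Real.pi / 2))
    (-(2 * Real.pi) + (Real.pi / 2 - Complex.arg z))
  rw [angular]
  rw [show -(Real.pi / 2) + Real.pi = Real.pi / 2 by ring] at h2
  rw [h2, show 2 * Real.pi + (Real.pi / 2 - Complex.arg z) =
    -(2 * Real.pi) + (Real.pi / 2 - Complex.arg z) + (4 : ℤ) • Real.pi by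
      rw [zsmul_eq_mul]; push_cast; ring, h1, zsmul_eq_mul]
  norm_num

theorem norm_mul_abs_proj_le (v u : ℂ) (τ : ℝ) :
    ‖v‖ * |proj (Complex.arg v + Real.pi / 2 + τ) u| ≤ |cr v u| + |τ| * (‖v‖ * ‖u‖) := by
  have h1 := Complex.norm_mul_cos_arg v
  have h2 := Complex.norm_mul_sin_arg v
  have key : ‖v‖ * proj (Complex.arg v + Real.pi / 2 + τ) u =
      Real.cos τ * cr v u - Real.sin τ * ip v u := by
    rw [proj, add_right_comm, Real.cos_add_pi_div_two, Real.sin_add_pi_div_two, Real.sin_add,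
      Real.cos_add, cr, ip, ← h1, ← h2]
    ring
  rw [← abs_of_nonneg (norm_nonneg v), ← abs_mul, key, abs_of_nonneg (norm_nonneg v)]
  refine (abs_sub _ _).trans (add_le_add ?_ ?_)
  · rw [abs_mul]
    exact mul_le_of_le_one_left (abs_nonneg _) (Real.abs_cos_le_one τ)
  · rw [abs_mul]
    exact mul_le_mul Real.abs_sin_le_abs (abs_ip_le v u) (abs_nonneg _) (abs_nonneg _)

theorem angular_le_max {h ρ δ : ℝ} (hδ : 0 < δ) (hδh : δ ≤ h) :
    angular h ρ ≤ 4 * h ^ 2 * (max ρ δ) ^ (-1 : ℝ) := by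
  have hpi := Real.pi_lt_d2
  have hpi0 := Real.pi_gt_three
  have hh : 0 < h := hδ.trans_le hδh
  rw [Real.rpow_neg_one, ← div_eq_mul_inv]
  rcases le_total δ ρ with h1 | h1
  · have hρ : 0 < ρ := hδ.trans_le h1
    rw [max_eq_left h1]
    refine (angular_le_div hh.le hρ).trans ?_
    rw [mul_div_assoc]
    refine mul_le_mul_of_nonneg_right (by linarith) (by positivity)
  · rw [max_eq_right h1, le_div_iff₀ hδ]
    have := angular_le_mul (ρ := ρ) hh.le
    have h2 : angular h ρ * δ ≤ Real.pi * h * δ := mul_le_mul_of_nonneg_right this hδ.le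
    have h3 : Real.pi * h * δ ≤ Real.pi * h * h := mul_le_mul_of_nonneg_left hδh (by positivity)
    nlinarith [mul_pos hh hh]

theorem angular_nonneg (h ρ : ℝ) : 0 ≤ angular h ρ :=
  intervalIntegral.integral_nonneg (by linarith [Real.pi_pos]) fun _ _ => hat_nonneg _ _

theorem angular_sub_le {h ρ δ σ : ℝ} {R : ℕ} (hR : 1 ≤ R) (hδ : 0 < δ) (hδh : δ ≤ h) (hσ : 0 ≤ σ)
    (hσ2 : σ ≤ 2) :
    angular h ρ - angular (R * h) ρ / R ^ 2 ≤
      4 * h ^ 2 * (2 * (R * h)) ^ σ * (max ρ δ) ^ (-(1 + σ)) := by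
  have hh : 0 < h := hδ.trans_le hδh
  have hR1 : (1 : ℝ) ≤ R := by exact_mod_cast hR
  have hhR : h ≤ R * h := le_mul_of_one_le_left hh.le hR1
  have hm : 0 < max ρ δ := lt_max_of_lt_right hδ
  have hrw : 4 * h ^ 2 * (2 * (R * h)) ^ σ * (max ρ δ) ^ (-(1 + σ)) =
      4 * h ^ 2 * (2 * (R * h) / max ρ δ) ^ σ * (max ρ δ) ^ (-1 : ℝ) := by
    rw [Real.div_rpow (by positivity) hm.le, neg_add_rev, Real.rpow_add hm, Real.rpow_neg hm.le σ]
    ring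
  rw [hrw]
  rcases le_or_gt (2 * (R * h)) ρ with h1 | h1
  · have hρ : 0 < ρ := by linarith
    rw [max_eq_left (by linarith)]
    have h2 := angular_le_add hh.le hρ (by linarith)
    have h3 := div_le_angular (h := R * h) (by positivity) hρ (by linarith)
    have h4 : h ^ 2 / ρ ≤ angular (R * h) ρ / R ^ 2 := by
      rw [le_div_iff₀ (by positivity)]
      refine le_trans (le_of_eq ?_) h3
      ring
    have h5 : (h / ρ) ^ 2 ≤ (2 * (R * h) / ρ) ^ σ := by
      have h6 : h / ρ ≤ 2 * (R * h) / ρ := by gcongr; linarith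
      have h7 : 2 * (R * h) / ρ ≤ 1 := (div_le_one hρ).2 h1
      calc (h / ρ) ^ 2 ≤ (2 * (R * h) / ρ) ^ 2 := by gcongr
        _ = (2 * (R * h) / ρ) ^ (2 : ℝ) := by norm_cast
        _ ≤ _ := Real.rpow_le_rpow_of_exponent_ge (by positivity) h7 hσ2
    calc _ ≤ 2 * h ^ 4 / ρ ^ 3 := by linarith
      _ = 2 * h ^ 2 * (h / ρ) ^ 2 * ρ ^ (-1 : ℝ) := by rw [Real.rpow_neg_one]; field_simp
      _ ≤ 4 * h ^ 2 * (2 * (R * h) / ρ) ^ σ * ρ ^ (-1 : ℝ) := by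
        gcongr
        norm_num
  · have h2 := angular_le_max (ρ := ρ) hδ hδh
    have h3 : 0 ≤ angular (R * h) ρ / R ^ 2 := div_nonneg (angular_nonneg _ _) (by positivity)
    have h4 : 1 ≤ (2 * (R * h) / max ρ δ) ^ σ := by
      refine Real.one_le_rpow ?_ hσ
      rw [one_le_div hm]
      exact max_le h1.le (by linarith)
    have h5 : 4 * h ^ 2 ≤ 4 * h ^ 2 * (2 * (R * h) / max ρ δ) ^ σ :=
      le_mul_of_one_le_right (by positivity) h4
    have h6 := mul_le_mul_of_nonneg_right h5 (Real.rpow_nonneg hm.le (-1))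
    linarith

theorem continuous_proj (z : ℂ) : Continuous fun θ => proj θ z := by
  unfold proj; fun_prop

theorem integral_sum_hat_proj (X : Finset ℂ) (μ : ℂ → ℝ) (h : ℝ) :
    ∫ θ in (-(2 * Real.pi))..(2 * Real.pi), ∑ x ∈ X, ∑ x' ∈ X, μ x * μ x' *
      hat h (proj θ x - proj θ x') =
    4 * ∑ x ∈ X, ∑ x' ∈ X, μ x * μ x' * angular h ‖x - x'‖ := by
  have hc : ∀ x x' : ℂ, Continuous fun θ => hat h (proj θ x - proj θ x') := fun x x' =>
    (continuous_hat h).comp ((continuous_proj x).sub (continuous_proj x'))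
  rw [intervalIntegral.integral_finsetSum fun x _ => Continuous.intervalIntegrable
    (continuous_finsetSum _ fun x' _ => (hc x x').const_mul _) _ _, Finset.mul_sum]
  refine Finset.sum_congr rfl fun x _ => ?_
  rw [intervalIntegral.integral_finsetSum fun x' _ => Continuous.intervalIntegrable
    ((hc x x').const_mul _) _ _, Finset.mul_sum]
  refine Finset.sum_congr rfl fun x' _ => ?_
  rw [intervalIntegral.integral_const_mul]
  simp_rw [← proj_sub]
  rw [integral_hat_proj]
  ring

theorem bad_mass_mul_le {X Y : Finset ℂ} {μ ν : ℂ → ℝ} (hμ : ∀ x, 0 ≤ μ x) (hν : ∀ y, 0 ≤ ν y)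
    (hμ1 : ∑ x ∈ X, μ x ≤ 1) (hXY : ∀ x ∈ X, ∀ y ∈ Y, ‖x - y‖ ≤ 2) {d w κ c : ℝ} (hd : 0 < d)
    (hw : 0 < w) (hw1 : w ≤ 1) (hc : 0 < c) {R : ℕ} (hR : 1 ≤ R) (hRκ : 2 ≤ R * κ)
    {P : Finset (ℂ × ℂ)} (hP : P ⊆ X ×ˢ Y) (hPd : ∀ p ∈ P, d ≤ ‖p.1 - p.2‖)
    (hbad : ∀ p ∈ P, κ ≤ ∑ x ∈ X with |cr (p.1 - p.2) (x - p.2)| ≤ w, μ x) {h : ℝ}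
    (hh : 4 * (1 / d + 2) * w = h) :
    h / 2 * w * ∑ p ∈ P, μ p.1 * ν p.2 ≤
      2 * c * (4 * ∑ x ∈ X, ∑ x' ∈ X, μ x * μ x' *
        (angular h ‖x - x'‖ - angular (R * h) ‖x - x'‖ / R ^ 2)) +
      1 / (2 * c) * (4 * ∑ y ∈ Y, ∑ y' ∈ Y, ν y * ν y' * angular h ‖y - y'‖) := by
  classical
  have hpi := Real.pi_gt_three
  have hh0 : 0 < h := by rw [← hh]; positivity
  let α : ℂ × ℂ → ℝ := fun p => Complex.arg (p.1 - p.2) + Real.pi / 2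
  have hαl : ∀ p, -(2 * Real.pi) ≤ α p := fun p => by
    have := Complex.neg_pi_lt_arg (p.1 - p.2); simp only [α]; linarith
  have hαu : ∀ p, α p + w ≤ 2 * Real.pi := fun p => by
    have := Complex.arg_le_pi (p.1 - p.2); simp only [α]; linarith
  have hproj : ∀ p ∈ P, ∀ x ∈ X, |cr (p.1 - p.2) (x - p.2)| ≤ w → ∀ θ ∈ Ioc (α p) (α p + w),
      |proj θ x - proj θ p.2| ≤ h / 4 := by
    intro p hp x hx hcr θ hθ
    have hv := hPd p hp
    have hy := (Finset.mem_product.1 (hP hp)).2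
    have h1 := norm_mul_abs_proj_le (p.1 - p.2) (x - p.2) (θ - α p)
    rw [show Complex.arg (p.1 - p.2) + Real.pi / 2 + (θ - α p) = θ by simp only [α]; ring,
      proj_sub, abs_of_nonneg (sub_nonneg.2 hθ.1.le)] at h1
    have hv0 : 0 < ‖p.1 - p.2‖ := hd.trans_le hv
    have h2 : (θ - α p) * (‖p.1 - p.2‖ * ‖x - p.2‖) ≤ ‖p.1 - p.2‖ * (2 * w) := by
      have h3 : (θ - α p) * ‖x - p.2‖ ≤ w * 2 :=
        mul_le_mul (by linarith [hθ.2]) (hXY x hx _ hy) (norm_nonneg _) hw.le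
      nlinarith
    have h4 : w ≤ ‖p.1 - p.2‖ * (1 / d * w) := by
      rw [← mul_assoc]
      refine le_mul_of_one_le_left hw.le ?_
      rw [mul_one_div, one_le_div hd]
      exact hv
    rw [← hh]
    refine le_of_mul_le_mul_left (?_ : ‖p.1 - p.2‖ * _ ≤ ‖p.1 - p.2‖ * _) hv0
    linarith
  let J : ℝ → Finset (ℂ × ℂ) := fun θ => P.filter fun p => θ ∈ Ioc (α p) (α p + w)
  have hpt : ∀ θ, h / 2 * ∑ p ∈ P, (Ioc (α p) (α p + w)).indicator (fun _ => μ p.1 * ν p.2) θ ≤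
      2 * c * ((∑ x ∈ X, ∑ x' ∈ X, μ x * μ x' * hat h (proj θ x - proj θ x')) -
        (∑ x ∈ X, ∑ x' ∈ X, μ x * μ x' * hat (R * h) (proj θ x - proj θ x')) / R ^ 2) +
      1 / (2 * c) * ∑ y ∈ Y, ∑ y' ∈ Y, ν y * ν y' * hat h (proj θ y - proj θ y') := by
    intro θ
    have h1 := mass_le_of_heavy X Y (proj θ) μ ν hμ hν hμ1 hh0 hc hR hRκ (P := J θ)
      ((Finset.filter_subset _ _).trans hP)
      (fun q hq => by
        obtain ⟨hq, hθ⟩ := Finset.mem_filter.1 hq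
        exact hproj q hq q.1 (Finset.mem_product.1 (hP hq)).1 (by simp [cr, mul_comm, hw.le]) θ hθ)
      (fun q hq => by
        obtain ⟨hq, hθ⟩ := Finset.mem_filter.1 hq
        refine ⟨_, Finset.filter_subset _ _, fun x hx => ?_, hbad q hq⟩
        obtain ⟨hx, hx'⟩ := Finset.mem_filter.1 hx
        exact hproj q hq x hx hx' θ hθ)
    convert h1 using 2
    · rw [Finset.sum_filter]
      simp only [indicator_apply]
    · rw [Finset.sum_div, ← Finset.sum_sub_distrib]
      congr 1
      refine Finset.sum_congr rfl fun x _ => ?_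
      rw [Finset.sum_div, ← Finset.sum_sub_distrib]
      exact Finset.sum_congr rfl fun x' _ => by ring
  have hind : ∀ p : ℂ × ℂ, ∀ a : ℝ, IntervalIntegrable
      ((Ioc (α p) (α p + w)).indicator fun _ => a) volume (-(2 * Real.pi)) (2 * Real.pi) := by
    intro p a
    refine Integrable.intervalIntegrable ?_
    rw [integrable_indicator_iff measurableSet_Ioc]
    exact integrableOn_const (by simp)
  have hii : ∀ (Z : Finset ℂ) (m : ℂ → ℝ) (h : ℝ), IntervalIntegrable (fun θ =>
      ∑ x ∈ Z, ∑ x' ∈ Z, m x * m x' * hat h (proj θ x - proj θ x')) volume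
      (-(2 * Real.pi)) (2 * Real.pi) := fun Z m h => Continuous.intervalIntegrable
    (continuous_finsetSum _ fun x _ => continuous_finsetSum _ fun x' _ => Continuous.const_mul
      ((continuous_hat h).comp ((continuous_proj x).sub (continuous_proj x'))) _) _ _
  have hindP : IntervalIntegrable (fun θ => h / 2 * ∑ p ∈ P,
      (Ioc (α p) (α p + w)).indicator (fun _ => μ p.1 * ν p.2) θ) volume
      (-(2 * Real.pi)) (2 * Real.pi) := by
    refine IntervalIntegrable.const_mul ?_ _
    have := IntervalIntegrable.sum P fun p _ => hind p (μ p.1 * ν p.2)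
    rwa [Finset.sum_fn] at this
  have hI := intervalIntegral.integral_mono_on (a := -(2 * Real.pi)) (b := 2 * Real.pi)
    (by linarith) hindP
    ((((hii X μ h).sub ((hii X μ (R * h)).div_const _)).const_mul _).add
      ((hii Y ν h).const_mul _)) fun θ _ => hpt θ
  rw [intervalIntegral.integral_const_mul, intervalIntegral.integral_finsetSum fun p _ => hind p _,
    intervalIntegral.integral_add
      (((hii X μ h).sub ((hii X μ (R * h)).div_const _)).const_mul _) ((hii Y ν h).const_mul _),
    intervalIntegral.integral_const_mul, intervalIntegral.integral_const_mul,
    intervalIntegral.integral_sub (hii X μ h) ((hii X μ (R * h)).div_const _),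
    intervalIntegral.integral_div, integral_sum_hat_proj, integral_sum_hat_proj,
    integral_sum_hat_proj] at hI
  have hm : ∀ p ∈ P, ∫ θ in (-(2 * Real.pi))..(2 * Real.pi),
      (Ioc (α p) (α p + w)).indicator (fun _ => μ p.1 * ν p.2) θ = w * (μ p.1 * ν p.2) := by
    intro p _
    rw [intervalIntegral.integral_of_le (by linarith), setIntegral_indicator measurableSet_Ioc,
      Ioc_inter_Ioc, max_eq_right (hαl p), min_eq_right (hαu p), setIntegral_const]
    simp [Measure.real, hw.le]
  rw [Finset.sum_congr rfl hm, ← Finset.mul_sum] at hI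
  have hs : ∑ x ∈ X, ∑ x' ∈ X, μ x * μ x' *
        (angular h ‖x - x'‖ - angular (R * h) ‖x - x'‖ / R ^ 2) =
      ∑ x ∈ X, ∑ x' ∈ X, μ x * μ x' * angular h ‖x - x'‖ -
        (∑ x ∈ X, ∑ x' ∈ X, μ x * μ x' * angular (R * h) ‖x - x'‖) / R ^ 2 := by
    simp only [mul_sub, Finset.sum_sub_distrib, Finset.sum_div, mul_div_assoc]
  rw [hs, mul_assoc, mul_sub, ← mul_div_assoc]
  exact hI

theorem bad_mass_le {X Y : Finset ℂ} {μ ν : ℂ → ℝ} (hμ : ∀ x, 0 ≤ μ x) (hν : ∀ y, 0 ≤ ν y)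
    (hμ1 : ∑ x ∈ X, μ x ≤ 1) (hXY : ∀ x ∈ X, ∀ y ∈ Y, ‖x - y‖ ≤ 2) {d w K δ σ E₀ E₁ : ℝ}
    (hd : 0 < d) (hδ : 0 < δ) (hδw : δ ≤ w) (hw1 : w ≤ 1) (hK : 0 < K) (hσ : 0 ≤ σ) (hσ2 : σ ≤ 2)
    (hE₁ : ∑ x ∈ X, ∑ x' ∈ X, μ x * μ x' * (max ‖x - x'‖ δ) ^ (-(1 + σ)) ≤ E₁)
    (hE₀ : ∑ y ∈ Y, ∑ y' ∈ Y, ν y * ν y' * (max ‖y - y'‖ δ) ^ (-1 : ℝ) ≤ E₀)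
    {P : Finset (ℂ × ℂ)} (hP : P ⊆ X ×ˢ Y) (hPd : ∀ p ∈ P, d ≤ ‖p.1 - p.2‖)
    (hbad : ∀ p ∈ P, K * w < ∑ x ∈ X with |cr (p.1 - p.2) (x - p.2)| ≤ w, μ x) :
    ∑ p ∈ P, μ p.1 * ν p.2 ≤ 128 * (1 / d + 2) * (4 * E₁ + E₀) *
      (24 * (1 / d + 2) / K) ^ (σ / 2) := by
  have hw : 0 < w := hδ.trans_le hδw
  set A := 1 / d + 2 with hA
  have hA2 : 2 ≤ A := by rw [hA]; linarith [show 0 < 1 / d by positivity]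
  have hm : ∀ x : ℝ, 0 < max x δ := fun x => lt_max_of_lt_right hδ
  have hE₁0 : 0 ≤ E₁ := le_trans (Finset.sum_nonneg fun x _ => Finset.sum_nonneg fun x' _ =>
    mul_nonneg (mul_nonneg (hμ x) (hμ x')) (Real.rpow_nonneg (hm _).le _)) hE₁
  have hE₀0 : 0 ≤ E₀ := le_trans (Finset.sum_nonneg fun x _ => Finset.sum_nonneg fun x' _ =>
    mul_nonneg (mul_nonneg (hν x) (hν x')) (Real.rpow_nonneg (hm _).le _)) hE₀
  have hR0 : 0 ≤ 128 * A * (4 * E₁ + E₀) * (24 * A / K) ^ (σ / 2) := by positivity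
  rcases P.eq_empty_or_nonempty with rfl | ⟨p₀, hp₀⟩
  · simpa using hR0
  have hκ1 : K * w ≤ 1 := (hbad p₀ hp₀).le.trans <|
    (Finset.sum_le_sum_of_subset_of_nonneg (Finset.filter_subset _ _) fun x _ _ => hμ x).trans hμ1
  have hκ : 0 < K * w := by positivity
  set R := ⌈2 / (K * w)⌉₊ with hR
  have hR2 : 2 / (K * w) ≤ R := Nat.le_ceil _
  have hR3 : (R : ℝ) ≤ 3 / (K * w) := by
    have h1 := Nat.ceil_lt_add_one (show 0 ≤ 2 / (K * w) by positivity)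
    have h2 : 1 ≤ 1 / (K * w) := (one_le_div hκ).2 hκ1
    have h3 : 3 / (K * w) = 2 / (K * w) + 1 / (K * w) := by ring
    rw [h3]
    exact h1.le.trans (by linarith)
  have hR1 : 1 ≤ R := Nat.one_le_iff_ne_zero.2 (by
    rw [hR, ← Nat.pos_iff_ne_zero, Nat.ceil_pos]; positivity)
  have hRr : (1 : ℝ) ≤ R := by exact_mod_cast hR1
  set h := 4 * A * w with hh
  have hh0 : 0 < h := by positivity
  have hδh : δ ≤ h := by rw [hh]; nlinarith
  set g := 2 * (R * h) with hg
  have hg0 : 0 < g := by positivity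
  have hgle : g ≤ 24 * A / K := by
    have h1 : R * h ≤ 3 / (K * w) * h := mul_le_mul_of_nonneg_right hR3 hh0.le
    have h2 : 3 / (K * w) * h = 12 * A / K := by rw [hh]; field_simp; ring
    rw [hg]
    calc 2 * (R * h) ≤ 2 * (12 * A / K) := by linarith
      _ = _ := by ring
  set c := g ^ (-(σ / 2)) with hc
  have hc0 : 0 < c := Real.rpow_pos_of_pos hg0 _
  have hmain := bad_mass_mul_le hμ hν hμ1 hXY hd hw hw1 hc0 hR1
    (κ := K * w) (by rwa [div_le_iff₀ hκ] at hR2) hP hPd (fun p hp => (hbad p hp).le) hh.symm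
  have h1 : ∑ x ∈ X, ∑ x' ∈ X, μ x * μ x' *
      (angular h ‖x - x'‖ - angular (R * h) ‖x - x'‖ / R ^ 2) ≤ 4 * h ^ 2 * g ^ σ * E₁ := by
    refine le_trans ?_ (mul_le_mul_of_nonneg_left hE₁ (by positivity))
    rw [Finset.mul_sum]
    refine Finset.sum_le_sum fun x _ => ?_
    rw [Finset.mul_sum]
    refine Finset.sum_le_sum fun x' _ => ?_
    have := mul_le_mul_of_nonneg_left (angular_sub_le (ρ := ‖x - x'‖) hR1 hδ hδh hσ hσ2)
      (mul_nonneg (hμ x) (hμ x'))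
    rw [← hg] at this
    linarith
  have h2 : ∑ y ∈ Y, ∑ y' ∈ Y, ν y * ν y' * angular h ‖y - y'‖ ≤ 4 * h ^ 2 * E₀ := by
    refine le_trans ?_ (mul_le_mul_of_nonneg_left hE₀ (by positivity))
    rw [Finset.mul_sum]
    refine Finset.sum_le_sum fun x _ => ?_
    rw [Finset.mul_sum]
    refine Finset.sum_le_sum fun x' _ => ?_
    have := mul_le_mul_of_nonneg_left (angular_le_max (ρ := ‖x - x'‖) hδ hδh)
      (mul_nonneg (hν x) (hν x'))
    linarith
  have h3 : g ^ σ * c = g ^ (σ / 2) := by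
    rw [hc, ← Real.rpow_add hg0]; ring_nf
  have h4 : 1 / c = g ^ (σ / 2) := by
    rw [hc, Real.rpow_neg hg0.le, one_div, inv_inv]
  have h5 : h / 2 * w * ∑ p ∈ P, μ p.1 * ν p.2 ≤
      h / 2 * w * (128 * A * (4 * E₁ + E₀) * g ^ (σ / 2)) := by
    have h6 : 2 * c * (4 * (4 * h ^ 2 * g ^ σ * E₁)) = 32 * h ^ 2 * E₁ * g ^ (σ / 2) := by
      rw [← h3]; ring
    have h7 : 1 / (2 * c) * (4 * (4 * h ^ 2 * E₀)) = 8 * h ^ 2 * E₀ * g ^ (σ / 2) := by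
      rw [← h4]; field_simp; ring
    have h8 : h / 2 * w * (128 * A * (4 * E₁ + E₀) * g ^ (σ / 2)) =
        (64 * h ^ 2 * E₁ + 16 * h ^ 2 * E₀) * g ^ (σ / 2) := by
      rw [hh]; ring
    have h9 := mul_le_mul_of_nonneg_left (mul_le_mul_of_nonneg_left h1 (by norm_num : (0:ℝ) ≤ 4))
      (show 0 ≤ 2 * c by positivity)
    have h10 := mul_le_mul_of_nonneg_left (mul_le_mul_of_nonneg_left h2 (by norm_num : (0:ℝ) ≤ 4))
      (show 0 ≤ 1 / (2 * c) by positivity)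
    have h11 : 0 ≤ h ^ 2 * E₁ * g ^ (σ / 2) := by positivity
    have h12 : 0 ≤ h ^ 2 * E₀ * g ^ (σ / 2) := by positivity
    rw [h8]
    linarith
  refine (le_of_mul_le_mul_left h5 (by positivity)).trans ?_
  gcongr

open Classical in
/-- The mass of the grid square of side `1 / n` that contains `z`. -/
noncomputable def cellMass (X : Finset ℂ) (μ : ℂ → ℝ) (n : ℕ) (z : ℂ) : ℝ :=
  ∑ x ∈ X with cell n x = cell n z, μ x

open Classical in
theorem card_image_cell_le {D : ℕ} (hD : 1 ≤ D) (X : Finset ℂ) {a b : ℕ} (hab : a ≤ b)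
    (q : ℤ × ℤ) :
    ((X.filter fun x => cell (D ^ a) x = q).image (cell (D ^ b))).card ≤ (D ^ (b - a)) ^ 2 := by
  set k := D ^ (b - a) with hk
  have hk0 : 0 < k := pow_pos hD _
  have hkb : D ^ b = D ^ a * k := by rw [hk, ← pow_add, Nat.add_sub_cancel' hab]
  have hfl : ∀ r : ℝ, ⌊((D ^ a : ℕ) : ℝ) * r⌋ = ⌊((D ^ b : ℕ) : ℝ) * r⌋ / (k : ℤ) := by
    intro r
    have hk1 : (k : ℝ) ≠ 0 := by exact_mod_cast hk0.ne'
    rw [← Int.floor_div_natCast, hkb]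
    congr 1
    push_cast
    field_simp
  have hsub : ((X.filter fun x => cell (D ^ a) x = q).image (cell (D ^ b))) ⊆
      Finset.Ico (q.1 * k) (q.1 * k + k) ×ˢ Finset.Ico (q.2 * k) (q.2 * k + k) := by
    intro z hz
    obtain ⟨x, hx, rfl⟩ := Finset.mem_image.1 hz
    obtain ⟨-, rfl⟩ := Finset.mem_filter.1 hx
    have hk2 : (0 : ℤ) < k := by exact_mod_cast hk0
    simp only [cell, Finset.mem_product, Finset.mem_Ico, hfl x.re, hfl x.im]
    refine ⟨⟨Int.ediv_mul_le _ hk2.ne', ?_⟩, Int.ediv_mul_le _ hk2.ne', ?_⟩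
    · exact Int.lt_ediv_add_one_mul_self _ hk2 |>.trans_eq (by ring)
    · exact Int.lt_ediv_add_one_mul_self _ hk2 |>.trans_eq (by ring)
  refine (Finset.card_le_card hsub).trans_eq ?_
  rw [Finset.card_product]
  simp [sq]

open Classical in
theorem light_mass_le {D : ℕ} (hD : 1 ≤ D) {X : Finset ℂ} {μ : ℂ → ℝ} (hμ : ∀ x, 0 ≤ μ x)
    {a b : ℕ} (hab : a ≤ b) :
    ∑ x ∈ X with cellMass X μ (D ^ b) x <
      ((D : ℝ) ^ (2 * (b - a) + 1))⁻¹ * cellMass X μ (D ^ a) x, μ x ≤ 1 / D * ∑ x ∈ X, μ x := by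
  have hD0 : (0 : ℝ) < D := by exact_mod_cast hD
  set L := X.filter fun x => cellMass X μ (D ^ b) x <
      ((D : ℝ) ^ (2 * (b - a) + 1))⁻¹ * cellMass X μ (D ^ a) x with hL
  rw [← Finset.sum_fiberwise_of_maps_to (s := L) (t := X.image (cell (D ^ a)))
      (fun x hx => Finset.mem_image_of_mem _ (Finset.filter_subset _ _ hx)),
    ← Finset.sum_fiberwise_of_maps_to (s := X) (t := X.image (cell (D ^ a)))
      (fun x hx => Finset.mem_image_of_mem _ hx), Finset.mul_sum]
  refine Finset.sum_le_sum fun q _ => ?_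
  set m := ∑ x ∈ X with cell (D ^ a) x = q, μ x with hm
  have hm0 : 0 ≤ m := Finset.sum_nonneg fun x _ => hμ x
  set T := (X.filter fun x => cell (D ^ a) x = q).image (cell (D ^ b)) with hT
  have hTc : (T.card : ℝ) ≤ (D : ℝ) ^ (2 * (b - a)) := by
    have := card_image_cell_le hD X hab q
    rw [← hT, ← pow_mul, mul_comm (b - a) 2] at this
    exact_mod_cast this
  rw [← Finset.sum_fiberwise_of_maps_to (t := T) (g := cell (D ^ b)) (fun x hx => by
    obtain ⟨h1, h2⟩ := Finset.mem_filter.1 hx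
    exact Finset.mem_image_of_mem _ (Finset.mem_filter.2 ⟨Finset.filter_subset _ _ h1, h2⟩))]
  have hbound : ∀ q' ∈ T, ∑ x ∈ (L.filter fun x => cell (D ^ a) x = q) with
      cell (D ^ b) x = q', μ x ≤ ((D : ℝ) ^ (2 * (b - a) + 1))⁻¹ * m := by
    intro q' _
    rcases Finset.eq_empty_or_nonempty
      ((L.filter fun x => cell (D ^ a) x = q).filter fun x => cell (D ^ b) x = q') with h0 | ⟨z, hz⟩
    · rw [h0]; simp only [Finset.sum_empty]; positivity
    · simp only [Finset.mem_filter, hL] at hz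
      obtain ⟨⟨⟨hzX, hlt⟩, hza⟩, hzb⟩ := hz
      simp only [cellMass, hza, hzb] at hlt
      refine le_trans ?_ hlt.le
      refine Finset.sum_le_sum_of_subset_of_nonneg (fun x hx => ?_) fun x _ _ => hμ x
      simp only [Finset.mem_filter, hL] at hx ⊢
      exact ⟨hx.1.1.1, hx.2⟩
  refine (Finset.sum_le_card_nsmul _ _ _ hbound).trans ?_
  rw [nsmul_eq_mul]
  calc (T.card : ℝ) * (((D : ℝ) ^ (2 * (b - a) + 1))⁻¹ * m)
      ≤ (D : ℝ) ^ (2 * (b - a)) * (((D : ℝ) ^ (2 * (b - a) + 1))⁻¹ * m) :=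
        mul_le_mul_of_nonneg_right hTc (by positivity)
    _ = 1 / D * m := by rw [pow_succ]; field_simp

/-- The integer `n` for which `m` lies in `(D ^ (-(n + 1)), D ^ (-n)]`. -/
noncomputable def expo (D : ℕ) (m : ℝ) : ℕ := ⌊-Real.logb D m⌋₊

theorem le_rpow_expo {D : ℕ} (hD : 2 ≤ D) {m : ℝ} (hm : 0 < m) (hm1 : m ≤ 1) :
    m ≤ (D : ℝ) ^ (-(expo D m : ℝ)) := by
  have hD1 : (1 : ℝ) < D := by exact_mod_cast hD
  have h0 : 0 ≤ -Real.logb D m := by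
    rw [neg_nonneg]; exact Real.logb_nonpos hD1 hm.le hm1
  have h1 : (expo D m : ℝ) ≤ -Real.logb D m := Nat.floor_le h0
  rw [← Real.logb_le_iff_le_rpow hD1 hm]
  linarith

theorem rpow_expo_lt {D : ℕ} (hD : 2 ≤ D) {m : ℝ} (hm : 0 < m) :
    (D : ℝ) ^ (-((expo D m : ℝ) + 1)) < m := by
  have hD1 : (1 : ℝ) < D := by exact_mod_cast hD
  have h1 : -Real.logb D m < expo D m + 1 := Nat.lt_floor_add_one _
  rw [← Real.lt_logb_iff_rpow_lt hD1 hm]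
  linarith

/-- From the square of `x` of side `1` on, the mass does not drop much faster than the area when
passing to finer squares. -/
def IsGood (D N : ℕ) (X : Finset ℂ) (μ : ℂ → ℝ) (x : ℂ) : Prop :=
  ∀ a b : ℕ, a ≤ b → b ≤ N →
    ((D : ℝ) ^ (2 * (b - a) + 1))⁻¹ * cellMass X μ (D ^ a) x ≤ cellMass X μ (D ^ b) x

open Classical in
/-- The good points of `X`. -/
noncomputable def goodPoints (D N : ℕ) (X : Finset ℂ) (μ : ℂ → ℝ) : Finset ℂ :=
  X.filter (IsGood D N X μ)

open Classical in
theorem goodPoints_subset (D N : ℕ) (X : Finset ℂ) (μ : ℂ → ℝ) : goodPoints D N X μ ⊆ X :=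
  Finset.filter_subset _ _

open Classical in
theorem sum_sdiff_goodPoints_le {D N : ℕ} (hD : 1 ≤ D) {X : Finset ℂ} {μ : ℂ → ℝ}
    (hμ : ∀ x, 0 ≤ μ x) (hμ1 : ∑ x ∈ X, μ x ≤ 1) :
    ∑ x ∈ X \ goodPoints D N X μ, μ x ≤ (N + 1) ^ 2 / D := by
  have hD0 : (0 : ℝ) < D := by exact_mod_cast hD
  set I := (Finset.range (N + 1) ×ˢ Finset.range (N + 1)).filter fun i => i.1 ≤ i.2 with hI
  have hsub : X \ goodPoints D N X μ ⊆ X.filter fun x => ∃ i ∈ I, cellMass X μ (D ^ i.2) x <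
      ((D : ℝ) ^ (2 * (i.2 - i.1) + 1))⁻¹ * cellMass X μ (D ^ i.1) x := by
    intro x hx
    simp only [goodPoints, IsGood, Finset.mem_sdiff, Finset.mem_filter, not_and, not_forall,
      not_le] at hx
    obtain ⟨hx, h⟩ := hx
    obtain ⟨a, b, hab, hb, hlt⟩ := h hx
    refine Finset.mem_filter.2 ⟨hx, (a, b), ?_, hlt⟩
    simp only [hI, Finset.mem_filter, Finset.mem_product, Finset.mem_range]
    omega
  refine (Finset.sum_le_sum_of_subset_of_nonneg hsub fun x _ _ => hμ x).trans ?_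
  refine (sum_filter_exists_mem_le X I μ (fun x _ => hμ x) _).trans ?_
  have : ∀ i ∈ I, ∑ x ∈ X with cellMass X μ (D ^ i.2) x <
      ((D : ℝ) ^ (2 * (i.2 - i.1) + 1))⁻¹ * cellMass X μ (D ^ i.1) x, μ x ≤ 1 / D := by
    intro i hi
    refine (light_mass_le hD hμ (Finset.mem_filter.1 hi).2).trans ?_
    exact mul_le_of_le_one_right (by positivity) hμ1
  refine (Finset.sum_le_card_nsmul _ _ _ this).trans ?_
  rw [nsmul_eq_mul, mul_one_div]
  gcongr
  have h1 : I.card ≤ (N + 1) * (N + 1) := (Finset.card_filter_le _ _).trans_eq (by simp)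
  calc (I.card : ℝ) ≤ (((N + 1) * (N + 1) : ℕ) : ℝ) := by exact_mod_cast h1
    _ = _ := by push_cast; ring

open Classical in
theorem exists_branch_regular {D N : ℕ} (hD : 2 ≤ D) {X : Finset ℂ} {μ : ℂ → ℝ}
    (hμ : ∀ x, 0 ≤ μ x) (hμ1 : ∑ x ∈ X, μ x = 1) (hX : ∀ x ∈ X, cell 1 x = 0) {σ C₀ : ℝ}
    (hC : C₀ ≤ D)
    (hF : ∀ j ≤ N, ∀ q, ∑ x ∈ X with cell (D ^ j) x = q, μ x ≤ C₀ * (D : ℝ) ^ (-((1 + σ) * j)))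
    {x₀ : ℂ} (hx₀ : x₀ ∈ goodPoints D N X μ) :
    ∃ F, Branch σ N F ∧ Regular D N ((goodPoints D N X μ).filter fun x => ∀ j ≤ N,
      expo D (cellMass X μ (D ^ j) x) = expo D (cellMass X μ (D ^ j) x₀)) μ F ∧
      ∀ j ≤ N, expo D (cellMass X μ (D ^ j) x₀) ≤ 2 * N + 2 := by
  have hD0 : (0 : ℝ) < D := by positivity
  have hD1 : (1 : ℝ) < D := by exact_mod_cast hD
  set f : ℕ → ℕ := fun j => expo D (cellMass X μ (D ^ j) x₀) with hf
  set Z := (goodPoints D N X μ).filter fun x => ∀ j ≤ N,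
      expo D (cellMass X μ (D ^ j) x) = f j with hZ
  have hgX : ∀ {x}, x ∈ goodPoints D N X μ → x ∈ X := fun h => goodPoints_subset _ _ _ _ h
  have hm1 : ∀ n x, cellMass X μ n x ≤ 1 := fun n x => by
    rw [← hμ1]
    exact Finset.sum_le_sum_of_subset_of_nonneg (Finset.filter_subset _ _) fun x _ _ => hμ x
  have hm0 : ∀ x ∈ X, cellMass X μ (D ^ 0) x = 1 := fun x hx => by
    rw [← hμ1, cellMass, Finset.filter_true_of_mem]
    intro z hz
    rw [pow_zero, hX z hz, hX x hx]
  have hgood : ∀ x ∈ goodPoints D N X μ, IsGood D N X μ x := fun x hx =>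
    (Finset.mem_filter.1 hx).2
  have hpos : ∀ x ∈ goodPoints D N X μ, ∀ j ≤ N, 0 < cellMass X μ (D ^ j) x := by
    intro x hx j hj
    have := hgood x hx 0 j (Nat.zero_le _) hj
    rw [hm0 x (hgX hx)] at this
    exact lt_of_lt_of_le (by positivity) this
  have hle : ∀ x ∈ Z, ∀ j ≤ N, cellMass X μ (D ^ j) x ≤ (D : ℝ) ^ (-(f j : ℝ)) := by
    intro x hx j hj
    obtain ⟨hx, h⟩ := Finset.mem_filter.1 hx
    rw [← h j hj]
    exact le_rpow_expo hD (hpos x hx j hj) (hm1 _ _)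
  have hlt : ∀ x ∈ Z, ∀ j ≤ N, (D : ℝ) ^ (-((f j : ℝ) + 1)) < cellMass X μ (D ^ j) x := by
    intro x hx j hj
    obtain ⟨hx, h⟩ := Finset.mem_filter.1 hx
    rw [← h j hj]
    exact rpow_expo_lt hD (hpos x hx j hj)
  have hx₀Z : x₀ ∈ Z := Finset.mem_filter.2 ⟨hx₀, fun _ _ => rfl⟩
  have hcmp : ∀ a b : ℝ, (D : ℝ) ^ a < (D : ℝ) ^ b → a < b := fun a b h =>
    (Real.rpow_lt_rpow_left_iff hD1).1 h
  have hf0 : f 0 = 0 := by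
    have h1 := hle x₀ hx₀Z 0 (Nat.zero_le _)
    rw [hm0 x₀ (hgX hx₀)] at h1
    by_contra h2
    have h3 : (0 : ℝ) < f 0 := by exact_mod_cast Nat.pos_of_ne_zero h2
    exact absurd h1 (not_le.2 (Real.rpow_lt_one_of_one_lt_of_neg hD1 (by linarith)))
  have hmono : ∀ i j, i ≤ j → j ≤ N → f i ≤ f j := by
    intro i j hij hj
    have h1 : cellMass X μ (D ^ j) x₀ ≤ cellMass X μ (D ^ i) x₀ :=
      Finset.sum_le_sum_of_subset_of_nonneg (fun x hx => by
        rw [Finset.mem_filter] at hx ⊢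
        exact ⟨hx.1, cell_pow_of_le (by omega) hij hx.2⟩) fun x _ _ => hμ x
    have h2 := hcmp _ _ <| ((hlt x₀ hx₀Z j hj).trans_le h1).trans_le
      (hle x₀ hx₀Z i (hij.trans hj))
    have h3 : (f i : ℝ) < f j + 1 := by linarith
    have h4 : f i < f j + 1 := by exact_mod_cast h3
    omega
  have hup : ∀ i j, i ≤ j → j ≤ N → f j ≤ f i + 2 * (j - i) + 2 := by
    intro i j hij hj
    have h1 := hgood x₀ hx₀ i j hij hj
    have h2 : ((D : ℝ) ^ (2 * (j - i) + 1))⁻¹ * (D : ℝ) ^ (-((f i : ℝ) + 1)) <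
        (D : ℝ) ^ (-(f j : ℝ)) := by
      refine lt_of_lt_of_le ?_ (h1.trans (hle x₀ hx₀Z j hj))
      exact mul_lt_mul_of_pos_left (hlt x₀ hx₀Z i (hij.trans hj)) (by positivity)
    rw [← Real.rpow_natCast, ← Real.rpow_neg hD0.le, ← Real.rpow_add hD0] at h2
    have h3 := hcmp _ _ h2
    have h4 : (f j : ℝ) < ((2 * (j - i) + 1 : ℕ) : ℝ) + (f i + 1) := by linarith
    have h5 : f j < (2 * (j - i) + 1) + (f i + 1) := by exact_mod_cast h4
    omega
  have hcell : ∀ j ≤ N, ∀ q, ∑ x ∈ Z with cell (D ^ j) x = q, μ x ≤ (D : ℝ) ^ (-(f j : ℝ)) := by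
    intro j hj q
    rcases (Z.filter fun x => cell (D ^ j) x = q).eq_empty_or_nonempty with h0 | ⟨z, hz⟩
    · rw [h0, Finset.sum_empty]; positivity
    · obtain ⟨hzZ, rfl⟩ := Finset.mem_filter.1 hz
      refine le_trans (Finset.sum_le_sum_of_subset_of_nonneg (fun x hx => ?_) fun x _ _ => hμ x)
        (hle z hzZ j hj)
      obtain ⟨h1, h2⟩ := Finset.mem_filter.1 hx
      exact Finset.mem_filter.2 ⟨hgX (Finset.mem_filter.1 h1).1, h2⟩
  refine ⟨fun j => (f j : ℝ) - j, ⟨by simp [hf0], fun i j hij hj => ?_, fun i j hij hj => ?_,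
    fun j hj => ?_⟩, ⟨hμ, ?_, fun x hx => hX x (hgX (Finset.mem_filter.1 hx).1), fun j hj q => ?_,
    fun a b hab hb q => ?_⟩, fun j hj => ?_⟩
  · have : (f i : ℝ) ≤ f j := by exact_mod_cast hmono i j hij hj
    linarith
  · have : (f j : ℝ) ≤ f i + 2 * ((j : ℝ) - i) + 2 := by
      rw [← Nat.cast_sub hij]
      have := hup i j hij hj
      have h2 : f j ≤ f i + 2 * (j - i) + 2 := by omega
      exact_mod_cast h2
    linarith
  · have h1 := (hlt x₀ hx₀Z j hj).trans_le (hF j hj (cell (D ^ j) x₀))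
    have h2 : C₀ * (D : ℝ) ^ (-((1 + σ) * j)) ≤ (D : ℝ) ^ (1 - (1 + σ) * j) := by
      rw [sub_eq_add_neg, Real.rpow_add hD0, Real.rpow_one]
      gcongr
    have h3 := hcmp _ _ (h1.trans_le h2)
    linarith
  · rw [← hμ1]
    exact Finset.sum_le_sum_of_subset_of_nonneg
      (fun x hx => hgX (Finset.mem_filter.1 hx).1) fun x _ _ => hμ x
  · simpa using hcell j hj q
  · set T := (Z.filter fun x => cell (D ^ a) x = q).image (cell (D ^ b)) with hT
    have h1 : ∀ q' ∈ T, (D : ℝ) ^ (-((f b : ℝ) + 1)) ≤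
        ∑ x ∈ (X.filter fun x => cell (D ^ a) x = q) with cell (D ^ b) x = q', μ x := by
      intro q' hq'
      obtain ⟨z, hz, rfl⟩ := Finset.mem_image.1 hq'
      obtain ⟨hzZ, rfl⟩ := Finset.mem_filter.1 hz
      refine (hlt z hzZ b hb).le.trans (Finset.sum_le_sum_of_subset_of_nonneg (fun x hx => ?_)
        fun x _ _ => hμ x)
      obtain ⟨h2, h3⟩ := Finset.mem_filter.1 hx
      exact Finset.mem_filter.2 ⟨Finset.mem_filter.2 ⟨h2, cell_pow_of_le (by omega) hab h3⟩, h3⟩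
    have h2 := Finset.card_nsmul_le_sum _ _ _ h1
    have h3 : ∑ q' ∈ T, ∑ x ∈ (X.filter fun x => cell (D ^ a) x = q) with cell (D ^ b) x = q',
        μ x ≤ ∑ x ∈ X with cell (D ^ a) x = q, μ x :=
      Finset.sum_fiberwise_le_sum_of_sum_fiber_nonneg fun q' _ =>
        Finset.sum_nonneg fun x _ => hμ x
    have hT4 : (T.card : ℝ) * (D : ℝ) ^ (-((f b : ℝ) + 1)) ≤ (D : ℝ) ^ (-(f a : ℝ)) := by
      rcases T.eq_empty_or_nonempty with h0 | ⟨q', hq'⟩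
      · rw [h0, Finset.card_empty, Nat.cast_zero, zero_mul]; positivity
      · obtain ⟨z, hz, -⟩ := Finset.mem_image.1 hq'
        obtain ⟨hzZ, rfl⟩ := Finset.mem_filter.1 hz
        rw [← nsmul_eq_mul]
        exact (h2.trans h3).trans (hle z hzZ a (hab.trans hb))
    have h5 : (D : ℝ) ^ ((f b : ℝ) - b - ((f a : ℝ) - a) + ((b : ℝ) - a) + 1) =
        (D : ℝ) ^ (-(f a : ℝ)) * (D : ℝ) ^ ((f b : ℝ) + 1) := by
      rw [← Real.rpow_add hD0]; congr 1; ring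
    rw [h5, ← div_le_iff₀ (by positivity), div_eq_mul_inv, ← Real.rpow_neg hD0.le]
    exact hT4
  · have := hup 0 j (Nat.zero_le _) hj
    rw [hf0] at this
    have h2 : f j ≤ 2 * N + 2 := by omega
    exact h2

open Classical in
theorem sum_adj_le {X : Finset ℂ} {μ : ℂ → ℝ} {n : ℕ} {B : ℝ} (hμ : ∀ x, 0 ≤ μ x)
    (hB : ∀ q, ∑ x ∈ X with cell n x = q, μ x ≤ B) (z : ℂ) :
    ∑ x ∈ X with adj n z x, μ x ≤ 9 * B := by
  set O : Finset (ℤ × ℤ) := Finset.Icc ((cell n z).1 - 1) ((cell n z).1 + 1) ×ˢ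
    Finset.Icc ((cell n z).2 - 1) ((cell n z).2 + 1) with hO
  have hc : O.card = 9 := by
    rw [hO, Finset.card_product, Int.card_Icc, Int.card_Icc]
    ring_nf
    rfl
  rw [← Finset.sum_fiberwise_of_maps_to (t := O) (g := cell n)]
  · refine (Finset.sum_le_card_nsmul _ _ B fun q _ => ?_).trans_eq
      (by rw [hc, nsmul_eq_mul]; norm_num)
    refine (Finset.sum_le_sum_of_subset_of_nonneg (fun x hx => ?_) fun x _ _ => hμ x).trans (hB q)
    simp only [Finset.mem_filter] at hx ⊢
    exact ⟨hx.1.1, hx.2⟩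
  · intro x hx
    obtain ⟨-, h1, h2⟩ := Finset.mem_filter.1 hx
    rw [abs_le] at h1 h2
    simp only [hO, Finset.mem_product, Finset.mem_Icc]
    omega

theorem max_rpow_neg_le (k : ℕ) {s ρ : ℝ} (hs : 0 ≤ s) :
    (max ρ ((2 : ℝ) ^ (-(k : ℝ)))) ^ (-s) ≤
      1 + ∑ i ∈ Finset.range (k + 1), if ρ < 1 / ((2 ^ i : ℕ) : ℝ) then
        (2 : ℝ) ^ (s * (i + 1)) else 0 := by
  have hnn : ∀ i ∈ Finset.range (k + 1), (0 : ℝ) ≤ if ρ < 1 / ((2 ^ i : ℕ) : ℝ) then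
        (2 : ℝ) ^ (s * (i + 1)) else 0 := fun i _ => by split_ifs <;> positivity
  have hk : 0 < (2 : ℝ) ^ (-(k : ℝ)) := by positivity
  by_cases hρ : 1 ≤ ρ
  · have h1 : (max ρ ((2 : ℝ) ^ (-(k : ℝ)))) ^ (-s) ≤ 1 :=
      Real.rpow_le_one_of_one_le_of_nonpos (le_max_of_le_left hρ) (by linarith)
    linarith [Finset.sum_nonneg hnn]
  · push Not at hρ
    obtain ⟨i, hi, hi'⟩ : ∃ i ∈ (Finset.range (k + 1)).filter fun i => ρ < 1 / ((2 ^ i : ℕ) : ℝ),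
        ∀ j ∈ (Finset.range (k + 1)).filter fun i => ρ < 1 / ((2 ^ i : ℕ) : ℝ), j ≤ i :=
      Finset.exists_max_image _ id ⟨0, by simp [hρ]⟩
    rw [Finset.mem_filter] at hi
    have hle : (2 : ℝ) ^ (-((i : ℝ) + 1)) ≤ max ρ ((2 : ℝ) ^ (-(k : ℝ))) := by
      rcases (Nat.lt_succ_iff.1 (Finset.mem_range.1 hi.1)).eq_or_lt with rfl | hik
      · exact le_max_of_le_right (Real.rpow_le_rpow_of_exponent_le one_le_two (by linarith))
      · refine le_max_of_le_left ?_
        by_contra hcon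
        push Not at hcon
        have := hi' (i + 1) (Finset.mem_filter.2 ⟨by simpa using hik, by
          refine hcon.trans_eq ?_
          rw [div_natCast_pow]; push_cast; ring⟩)
        omega
    have h1 : (max ρ ((2 : ℝ) ^ (-(k : ℝ)))) ^ (-s) ≤ (2 : ℝ) ^ (s * (i + 1)) := by
      refine (Real.rpow_le_rpow_of_nonpos (by positivity) hle (by linarith)).trans_eq ?_
      rw [← Real.rpow_mul (by norm_num)]
      congr 1; ring
    have h2 := Finset.single_le_sum hnn hi.1
    rw [if_pos hi.2] at h2
    linarith

open Classical in
theorem energy_le {X : Finset ℂ} {μ : ℂ → ℝ} (hμ : ∀ x, 0 ≤ μ x) (hμ1 : ∑ x ∈ X, μ x ≤ 1)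
    {k : ℕ} {t s C₀ : ℝ} (hC₀ : 0 ≤ C₀) (hs : 0 ≤ s) (hst : s ≤ t) (hs2 : s ≤ 2)
    (hF : ∀ i ≤ k, ∀ q, ∑ x ∈ X with cell (2 ^ i) x = q, μ x ≤ C₀ * (2 : ℝ) ^ (-(t * i))) :
    ∑ x ∈ X, ∑ x' ∈ X, μ x * μ x' * (max ‖x - x'‖ ((2 : ℝ) ^ (-(k : ℝ)))) ^ (-s) ≤
      1 + 36 * C₀ * (k + 1) := by
  have hB : 0 ≤ 1 + 36 * C₀ * (k + 1) := by positivity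
  have hone : ∀ x, ∑ x' ∈ X, μ x' * (max ‖x - x'‖ ((2 : ℝ) ^ (-(k : ℝ)))) ^ (-s) ≤
      1 + 36 * C₀ * (k + 1) := by
    intro x
    have hterm : ∀ i ∈ Finset.range (k + 1), ∑ x' ∈ X, μ x' *
        (if ‖x - x'‖ < 1 / ((2 ^ i : ℕ) : ℝ) then (2 : ℝ) ^ (s * (i + 1)) else 0) ≤ 36 * C₀ := by
      intro i hi
      have hik : i ≤ k := Nat.lt_succ_iff.1 (Finset.mem_range.1 hi)
      have h1 := sum_adj_le hμ (hF i hik) x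
      have h2 : ∑ x' ∈ X, μ x' *
          (if ‖x - x'‖ < 1 / ((2 ^ i : ℕ) : ℝ) then (2 : ℝ) ^ (s * (i + 1)) else 0) ≤
          (2 : ℝ) ^ (s * (i + 1)) * ∑ x' ∈ X with adj (2 ^ i) x x', μ x' := by
        rw [Finset.sum_filter, Finset.mul_sum]
        refine Finset.sum_le_sum fun x' _ => ?_
        by_cases ha : adj (2 ^ i) x x'
        · rw [if_pos ha, mul_comm]
          refine mul_le_mul_of_nonneg_right ?_ (hμ x')
          split_ifs
          · exact le_rfl
          · positivity
        · rw [if_neg ha, if_neg (not_lt.2 (le_norm_sub_of_not_adj (by positivity) ha))]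
          simp
      refine h2.trans ((mul_le_mul_of_nonneg_left h1 (by positivity)).trans ?_)
      have h3 : (2 : ℝ) ^ (s * (i + 1)) * (2 : ℝ) ^ (-(t * i)) ≤ 4 := by
        rw [← Real.rpow_add (by norm_num)]
        calc (2 : ℝ) ^ (s * (i + 1) + -(t * i)) ≤ (2 : ℝ) ^ (2 : ℝ) := by
              refine Real.rpow_le_rpow_of_exponent_le one_le_two ?_
              have : s * i ≤ t * i := mul_le_mul_of_nonneg_right hst (Nat.cast_nonneg i)
              linarith
          _ = 4 := by norm_num
      calc _ = 9 * C₀ * ((2 : ℝ) ^ (s * (i + 1)) * (2 : ℝ) ^ (-(t * i))) := by ring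
        _ ≤ 9 * C₀ * 4 := mul_le_mul_of_nonneg_left h3 (by positivity)
        _ = _ := by ring
    calc _ ≤ ∑ x' ∈ X, μ x' * (1 + ∑ i ∈ Finset.range (k + 1),
          if ‖x - x'‖ < 1 / ((2 ^ i : ℕ) : ℝ) then (2 : ℝ) ^ (s * (i + 1)) else 0) :=
          Finset.sum_le_sum fun x' _ => mul_le_mul_of_nonneg_left (max_rpow_neg_le k hs) (hμ x')
      _ = ∑ x' ∈ X, μ x' + ∑ i ∈ Finset.range (k + 1), ∑ x' ∈ X, μ x' *
          (if ‖x - x'‖ < 1 / ((2 ^ i : ℕ) : ℝ) then (2 : ℝ) ^ (s * (i + 1)) else 0) := by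
        simp only [mul_add, mul_one, Finset.sum_add_distrib, Finset.mul_sum]
        rw [Finset.sum_comm (s := X)]
      _ ≤ 1 + (Finset.range (k + 1)).card • (36 * C₀) :=
        add_le_add hμ1 (Finset.sum_le_card_nsmul _ _ _ hterm)
      _ = _ := by rw [Finset.card_range, nsmul_eq_mul]; push_cast; ring
  calc _ = ∑ x ∈ X, μ x * ∑ x' ∈ X, μ x' * (max ‖x - x'‖ ((2 : ℝ) ^ (-(k : ℝ)))) ^ (-s) := by
        simp only [Finset.mul_sum, mul_assoc]
    _ ≤ ∑ x ∈ X, μ x * (1 + 36 * C₀ * (k + 1)) :=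
      Finset.sum_le_sum fun x _ => mul_le_mul_of_nonneg_left (hone x) (hμ x)
    _ = (∑ x ∈ X, μ x) * (1 + 36 * C₀ * (k + 1)) := by rw [Finset.sum_mul]
    _ ≤ _ := mul_le_of_le_one_left hB hμ1

open Classical in
theorem sum_filter_not_mem_fst_le {X Y X' : Finset ℂ} {μ ν : ℂ → ℝ} (hμ : ∀ x, 0 ≤ μ x)
    (hν : ∀ y, 0 ≤ ν y) (hν1 : ∑ y ∈ Y, ν y ≤ 1) {G : Finset (ℂ × ℂ)} (hG : G ⊆ X ×ˢ Y) :
    ∑ p ∈ G with p.1 ∉ X', μ p.1 * ν p.2 ≤ ∑ x ∈ X \ X', μ x := by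
  calc _ ≤ ∑ p ∈ (X \ X') ×ˢ Y, μ p.1 * ν p.2 := by
        refine Finset.sum_le_sum_of_subset_of_nonneg (fun p hp => ?_)
          fun p _ _ => mul_nonneg (hμ _) (hν _)
        obtain ⟨h1, h2⟩ := Finset.mem_filter.1 hp
        have := Finset.mem_product.1 (hG h1)
        exact Finset.mem_product.2 ⟨Finset.mem_sdiff.2 ⟨this.1, h2⟩, this.2⟩
    _ = (∑ x ∈ X \ X', μ x) * ∑ y ∈ Y, ν y := by
      rw [Finset.sum_product, Finset.sum_mul_sum]
    _ ≤ _ := mul_le_of_le_one_right (Finset.sum_nonneg fun x _ => hμ x) hν1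

open Classical in
theorem sum_filter_not_mem_snd_le {X Y Y' : Finset ℂ} {μ ν : ℂ → ℝ} (hμ : ∀ x, 0 ≤ μ x)
    (hν : ∀ y, 0 ≤ ν y) (hμ1 : ∑ x ∈ X, μ x ≤ 1) {G : Finset (ℂ × ℂ)} (hG : G ⊆ X ×ˢ Y) :
    ∑ p ∈ G with p.2 ∉ Y', μ p.1 * ν p.2 ≤ ∑ y ∈ Y \ Y', ν y := by
  calc _ ≤ ∑ p ∈ X ×ˢ (Y \ Y'), μ p.1 * ν p.2 := by
        refine Finset.sum_le_sum_of_subset_of_nonneg (fun p hp => ?_)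
          fun p _ _ => mul_nonneg (hμ _) (hν _)
        obtain ⟨h1, h2⟩ := Finset.mem_filter.1 hp
        have := Finset.mem_product.1 (hG h1)
        exact Finset.mem_product.2 ⟨this.1, Finset.mem_sdiff.2 ⟨this.2, h2⟩⟩
    _ = (∑ x ∈ X, μ x) * ∑ y ∈ Y \ Y', ν y := by
      rw [Finset.sum_product, Finset.sum_mul_sum]
    _ ≤ _ := mul_le_of_le_one_left (Finset.sum_nonneg fun x _ => hν x) hμ1

open Classical in
/-- The pinned-distance bound at a fixed dyadic resolution. -/
theorem rpow_le_card_of_mass {σ C₀ d : ℝ} (hσ : 0 < σ) (hσ1 : σ < 1) (hC₀ : 0 ≤ C₀) (hd : 0 < d)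
    {M N L D k : ℕ} (hN : N = M * M) (hM : 1 ≤ (1 - σ) / (2 - σ) * M) (hDL : D = 2 ^ L)
    (hLk : L * N ≤ k) (hD : 40 ≤ D) (hDN : 9 * (N + 1) ≤ D) (hC₀D : C₀ ≤ D)
    {X Y : Finset ℂ} {μ ν : ℂ → ℝ} (hμ : ∀ x, 0 ≤ μ x) (hν : ∀ y, 0 ≤ ν y)
    (hμ1 : ∑ x ∈ X, μ x = 1) (hν1 : ∑ y ∈ Y, ν y = 1)
    (hX : ∀ x ∈ X, cell 1 x = 0) (hY : ∀ y ∈ Y, cell 1 y = 0)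
    (hXY : ∀ x ∈ X, ∀ y ∈ Y, d ≤ ‖x - y‖)
    (hμF : ∀ i ≤ k, ∀ q, ∑ x ∈ X with cell (2 ^ i) x = q, μ x ≤ C₀ * (2 : ℝ) ^ (-((1 + σ) * i)))
    (hνF : ∀ i ≤ k, ∀ q, ∑ y ∈ Y with cell (2 ^ i) y = q, ν y ≤ C₀ * (2 : ℝ) ^ (-((1 + σ) * i)))
    {G : Finset (ℂ × ℂ)} (hG : G ⊆ X ×ˢ Y)
    (hmass : 2 * ((N + 1) ^ 2 / (D : ℝ)) + (N + 1) * (128 * (1 / d + 2) *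
        (5 * (1 + 36 * C₀ * (k + 1))) * (24 * (1 / d + 2) / D) ^ (σ / 2)) +
        ((2 * N + 3) ^ (N + 1) * (2 * N + 3) ^ (N + 1) : ℕ) * ((2 * (N + 1) ^ 2 + 1) / (D : ℝ)) <
      ∑ p ∈ G, μ p.1 * ν p.2)
    {R : Finset ℝ} (hR : ∀ p ∈ G, ∃ r ∈ R, |‖p.1 - p.2‖ - r| ≤ (2 : ℝ) ^ (-(k : ℝ))) :
    (D : ℝ) ^ (N - ((1 - σ) ^ 2 / (2 * (2 + σ)) * N + 550 * M) - 2) ≤ R.card := by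
  have hD0 : (0 : ℝ) < D := by positivity
  have hD1 : (1 : ℝ) ≤ D := by exact_mod_cast (by omega : 1 ≤ D)
  have hpow : ∀ j : ℕ, D ^ j = 2 ^ (L * j) := fun j => by rw [hDL, ← pow_mul]
  have hLj : ∀ j ≤ N, L * j ≤ k := fun j hj => (Nat.mul_le_mul_left L hj).trans hLk
  have hDr : ∀ j : ℕ, (D : ℝ) ^ (-(j : ℝ)) = (2 : ℝ) ^ (-((L * j : ℕ) : ℝ)) := fun j => by
    rw [Real.rpow_neg hD0.le, Real.rpow_neg (by norm_num), Real.rpow_natCast, Real.rpow_natCast,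
      hDL]
    push_cast
    rw [pow_mul]
  have hDs : ∀ j : ℕ, (2 : ℝ) ^ (-((1 + σ) * ((L * j : ℕ) : ℝ))) =
      (D : ℝ) ^ (-((1 + σ) * j)) := fun j => by
    have h1 : (D : ℝ) = (2 : ℝ) ^ (L : ℝ) := by rw [hDL, Real.rpow_natCast]; push_cast; rfl
    rw [h1, ← Real.rpow_mul (by norm_num)]
    congr 1; push_cast; ring
  have hw : ∀ p ∈ G, 0 ≤ μ p.1 * ν p.2 := fun p _ => mul_nonneg (hμ _) (hν _)
  set bad : ℕ → ℂ × ℂ → Prop := fun j p => (D : ℝ) * (D : ℝ) ^ (-(j : ℝ)) <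
    ∑ x ∈ X with |cr (p.1 - p.2) (x - p.2)| ≤ (D : ℝ) ^ (-(j : ℝ)), μ x with hbad
  have hbadmass : ∀ j ∈ Finset.range (N + 1), ∑ p ∈ G with bad j p, μ p.1 * ν p.2 ≤
      128 * (1 / d + 2) * (5 * (1 + 36 * C₀ * (k + 1))) * (24 * (1 / d + 2) / D) ^ (σ / 2) := by
    intro j hj
    have hjN : j ≤ N := Nat.lt_succ_iff.1 (Finset.mem_range.1 hj)
    have h1 := energy_le hμ hμ1.le hC₀ (s := 1 + σ) (by linarith) le_rfl (by linarith) hμF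
    have h2 := energy_le hν hν1.le hC₀ (s := 1) (by linarith) (by linarith) (by norm_num) hνF
    refine (bad_mass_le hμ hν hμ1.le (fun x hx y hy => norm_sub_le_two (hX x hx) (hY y hy)) hd
      (by positivity) (w := (D : ℝ) ^ (-(j : ℝ))) (K := D) (σ := σ) ?_ ?_ hD0 hσ.le (by linarith) h1
      h2 ((Finset.filter_subset _ _).trans hG) (fun p hp => ?_) (fun p hp => ?_)).trans_eq (by ring)
    · rw [hDr]
      exact Real.rpow_le_rpow_of_exponent_le one_le_two (by
        have : ((L * j : ℕ) : ℝ) ≤ k := by exact_mod_cast hLj j hjN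
        linarith)
    · exact Real.rpow_le_one_of_one_le_of_nonpos hD1 (by simp)
    · have := Finset.mem_product.1 (hG (Finset.mem_filter.1 hp).1)
      exact hXY _ this.1 _ this.2
    · exact (Finset.mem_filter.1 hp).2
  set E₀ := G.filter fun p => p.1 ∈ goodPoints D N X μ ∧ p.2 ∈ goodPoints D N Y ν ∧
    ∀ j ∈ Finset.range (N + 1), ¬ bad j p with hE₀
  have hE₀mem : ∀ p ∈ E₀, p ∈ G ∧ p.1 ∈ goodPoints D N X μ ∧ p.2 ∈ goodPoints D N Y ν ∧
      ∀ j ∈ Finset.range (N + 1), ¬ bad j p := fun p hp => by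
    rw [hE₀] at hp
    simpa only [Finset.mem_filter] using hp
  have hE₀mass : ((2 * N + 3) ^ (N + 1) * (2 * N + 3) ^ (N + 1) : ℕ) *
      ((2 * (N + 1) ^ 2 + 1) / (D : ℝ)) < ∑ p ∈ E₀, μ p.1 * ν p.2 := by
    have h1 : ∑ p ∈ G, μ p.1 * ν p.2 ≤ ∑ p ∈ E₀, μ p.1 * ν p.2 +
        ∑ p ∈ G with p.1 ∉ goodPoints D N X μ, μ p.1 * ν p.2 +
        ∑ p ∈ G with p.2 ∉ goodPoints D N Y ν, μ p.1 * ν p.2 +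
        ∑ p ∈ G with ∃ j ∈ Finset.range (N + 1), bad j p, μ p.1 * ν p.2 := by
      rw [hE₀]
      simp only [Finset.sum_filter, ← Finset.sum_add_distrib]
      refine Finset.sum_le_sum fun p hp => ?_
      have h0 := hw p hp
      have hE : ¬ (∃ j ∈ Finset.range (N + 1), bad j p) ↔
          ∀ j ∈ Finset.range (N + 1), ¬ bad j p := by simp
      rw [← hE]
      by_cases ha : p.1 ∈ goodPoints D N X μ <;> by_cases hb : p.2 ∈ goodPoints D N Y ν <;>
        by_cases hc : ∃ j ∈ Finset.range (N + 1), bad j p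
      all_goals
        simp only [ha, hb, hc, not_true_eq_false, not_false_eq_true, if_true, if_false, true_and,
          false_and]
        linarith
    have h2 := (sum_filter_not_mem_fst_le (X' := goodPoints D N X μ) hμ hν hν1.le hG).trans
      (sum_sdiff_goodPoints_le (by omega) hμ hμ1.le)
    have h3 := (sum_filter_not_mem_snd_le (Y' := goodPoints D N Y ν) hμ hν hμ1.le hG).trans
      (sum_sdiff_goodPoints_le (by omega) hν hν1.le)
    have h4 := (sum_filter_exists_mem_le G (Finset.range (N + 1)) _ hw bad).trans
      (Finset.sum_le_card_nsmul _ _ _ hbadmass)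
    rw [nsmul_eq_mul, Finset.card_range] at h4
    have h5 : ∑ p ∈ G with ∃ j ∈ Finset.range (N + 1), bad j p, μ p.1 * ν p.2 ≤
        ((N + 1 : ℕ) : ℝ) * (128 * (1 / d + 2) * (5 * (1 + 36 * C₀ * (k + 1))) *
          (24 * (1 / d + 2) / D) ^ (σ / 2)) := by
      refine Eq.trans_le (Finset.sum_congr ?_ fun _ _ => rfl) h4
      ext p
      simp only [Finset.mem_filter]
    push_cast at h5 hmass ⊢
    linarith
  let ty : (ℂ × ℂ) → (Fin (N + 1) → ℕ) × (Fin (N + 1) → ℕ) := fun p =>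
    (fun j => expo D (cellMass X μ (D ^ (j : ℕ)) p.1),
      fun j => expo D (cellMass Y ν (D ^ (j : ℕ)) p.2))
  have hXreg : ∀ x ∈ goodPoints D N X μ, _ := fun x hx => exists_branch_regular (D := D) (N := N)
    (by omega) hμ hμ1 hX hC₀D (fun j hj q => by
      rw [← hDs, hpow]; exact hμF _ (hLj j hj) q) hx
  have hYreg : ∀ y ∈ goodPoints D N Y ν, _ := fun y hy => exists_branch_regular (D := D) (N := N)
    (by omega) hν hν1 hY hC₀D (fun j hj q => by
      rw [← hDs, hpow]; exact hνF _ (hLj j hj) q) hy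
  set V := Fintype.piFinset fun _ : Fin (N + 1) => Finset.range (2 * N + 3) with hV
  have hVc : V.card = (2 * N + 3) ^ (N + 1) := by
    rw [hV, Fintype.card_piFinset_const, Finset.card_range]
  have hmaps : ∀ p ∈ E₀, ty p ∈ V ×ˢ V := by
    intro p hp
    obtain ⟨-, hp1, hp2, -⟩ := hE₀mem p hp
    obtain ⟨F, -, -, h1⟩ := hXreg _ hp1
    obtain ⟨F', -, -, h2⟩ := hYreg _ hp2
    simp only [hV, Finset.mem_product, Fintype.mem_piFinset, Finset.mem_range, ty]
    exact ⟨fun j => Nat.lt_succ_of_le (h1 j (Nat.lt_succ_iff.1 j.2)),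
      fun j => Nat.lt_succ_of_le (h2 j (Nat.lt_succ_iff.1 j.2))⟩
  obtain ⟨τ, -, hτ⟩ := Finset.exists_lt_sum_fiber_of_maps_to_of_nsmul_lt_sum hmaps
    (w := fun p => μ p.1 * ν p.2) (b := (2 * (N + 1) ^ 2 + 1) / (D : ℝ)) (by
      rw [nsmul_eq_mul, Finset.card_product, hVc]; exact hE₀mass)
  set E := E₀.filter fun p => ty p = τ with hE
  obtain ⟨p₀, hp₀⟩ : E.Nonempty := by
    rw [Finset.nonempty_iff_ne_empty]
    intro h0
    rw [h0, Finset.sum_empty] at hτ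
    exact absurd hτ (not_lt.2 (by positivity))
  have hp₀' := Finset.mem_filter.1 hp₀
  obtain ⟨-, hp1, hp2, -⟩ := hE₀mem _ hp₀'.1
  obtain ⟨F, hFb, hFr, -⟩ := hXreg _ hp1
  obtain ⟨F', hFb', hFr', -⟩ := hYreg _ hp2
  obtain ⟨l, hl, hlle⟩ := Branch.exists_node hFb hFb' hσ hσ1 (by norm_num : (0 : ℝ) ≤ 9) hN hM
  have hty : ∀ p ∈ E, ∀ j ≤ N,
      expo D (cellMass X μ (D ^ j) p.1) = expo D (cellMass X μ (D ^ j) p₀.1) ∧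
      expo D (cellMass Y ν (D ^ j) p.2) = expo D (cellMass Y ν (D ^ j) p₀.2) := by
    intro p hp j hj
    have h1 := (Finset.mem_filter.1 hp).2.trans hp₀'.2.symm
    exact ⟨congr_fun (congr_arg Prod.fst h1) ⟨j, Nat.lt_succ_of_le hj⟩,
      congr_fun (congr_arg Prod.snd h1) ⟨j, Nat.lt_succ_of_le hj⟩⟩
  have hfin := rpow_le_card_of_node hD hDN hFr hFr' hFb.zero hFb'.zero (E := E)
    (fun p hp => by
      obtain ⟨h1, -⟩ := Finset.mem_filter.1 hp
      obtain ⟨-, h2, h3, -⟩ := hE₀mem p h1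
      exact Finset.mem_product.2 ⟨Finset.mem_filter.2 ⟨h2, fun j hj => (hty p hp j hj).1⟩,
        Finset.mem_filter.2 ⟨h3, fun j hj => (hty p hp j hj).2⟩⟩)
    (fun p hp j hj => by
      obtain ⟨h1, -⟩ := Finset.mem_filter.1 hp
      obtain ⟨-, -, -, h4⟩ := hE₀mem p h1
      have h5 := not_lt.1 (h4 j (Finset.mem_range.2 (Nat.lt_succ_of_le hj)))
      rw [sub_eq_add_neg (1 : ℝ) (j : ℝ), Real.rpow_add hD0, Real.rpow_one]
      refine le_trans (Finset.sum_le_sum_of_subset_of_nonneg (fun x hx => ?_) fun x _ _ => hμ x) h5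
      obtain ⟨h6, h7⟩ := Finset.mem_filter.1 hx
      exact Finset.mem_filter.2 ⟨goodPoints_subset _ _ _ _ (Finset.mem_filter.1 h6).1, h7⟩)
    hl hτ (R := R) (fun p hp => by
      obtain ⟨h1, -⟩ := Finset.mem_filter.1 hp
      obtain ⟨r, hr, h2⟩ := hR p (hE₀mem p h1).1
      refine ⟨r, hr, h2.trans ?_⟩
      rw [hDr]
      exact Real.rpow_le_rpow_of_exponent_le one_le_two (by
        have : ((L * N : ℕ) : ℝ) ≤ k := by exact_mod_cast hLk
        linarith))
  refine le_trans (Real.rpow_le_rpow_of_exponent_le hD1 ?_) hfin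
  linarith

theorem eventually_add_lt_one_div_sq {a b A τ : ℝ} (ha : 0 ≤ a) (hb : 0 ≤ b) (hA : 0 ≤ A)
    (hτ : 0 < τ) {N : ℕ} (hN : 0 < N) :
    ∀ᶠ k : ℕ in Filter.atTop, ∀ D : ℝ, (2 : ℝ) ^ ((k : ℝ) / N) / 2 ≤ D →
      a / D + b * (k + 1) * (A / D) ^ τ < 1 / (k : ℝ) ^ 2 := by
  have hN' : (0 : ℝ) < N := by exact_mod_cast hN
  set q : ℝ := (2 : ℝ) ^ (-(1 / (N : ℝ))) with hq
  set q' : ℝ := q ^ τ with hq'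
  have hq0 : 0 < q := by positivity
  have hq1 : q < 1 := Real.rpow_lt_one_of_one_lt_of_neg one_lt_two (by
    rw [neg_lt_zero]; positivity)
  have hq'0 : 0 < q' := by positivity
  have hq'1 : q' < 1 := Real.rpow_lt_one hq0.le hq1 hτ
  have habs : |q| < 1 := by rwa [abs_of_pos hq0]
  have habs' : |q'| < 1 := by rwa [abs_of_pos hq'0]
  have hlim := ((tendsto_pow_const_mul_const_pow_of_abs_lt_one 2 habs).const_mul (2 * a)).add
    (((tendsto_pow_const_mul_const_pow_of_abs_lt_one 3 habs').add
      (tendsto_pow_const_mul_const_pow_of_abs_lt_one 2 habs')).const_mul (b * (2 * A) ^ τ))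
  rw [mul_zero, add_zero, mul_zero, add_zero] at hlim
  filter_upwards [hlim.eventually (gt_mem_nhds one_pos), Filter.eventually_gt_atTop 0]
    with k hk hk0 D hD
  have hk' : (0 : ℝ) < k := by exact_mod_cast hk0
  have hqk : (2 : ℝ) ^ ((k : ℝ) / N) = (q ^ k)⁻¹ := by
    rw [hq, ← Real.rpow_natCast, ← Real.rpow_mul (by norm_num), ← Real.rpow_neg (by norm_num)]
    congr 1
    ring
  have hqk0 : 0 < q ^ k := by positivity
  have hD0 : 0 < D := lt_of_lt_of_le (by positivity) hD
  have hDi : 1 / D ≤ 2 * q ^ k := by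
    rw [hqk] at hD
    rw [div_le_iff₀ hD0]
    calc (1 : ℝ) = 2 * q ^ k * ((q ^ k)⁻¹ / 2) := by field_simp
      _ ≤ _ := by gcongr
  have h1 : a / D ≤ 2 * a * q ^ k := by
    rw [div_eq_mul_one_div]
    nlinarith
  have h2 : (A / D) ^ τ ≤ (2 * A) ^ τ * q' ^ k := by
    have : q' ^ k = (q ^ k) ^ τ := by
      rw [hq', ← Real.rpow_natCast, ← Real.rpow_natCast, ← Real.rpow_mul hq0.le,
        ← Real.rpow_mul hq0.le, mul_comm]
    rw [this, ← Real.mul_rpow (by positivity) hqk0.le]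
    refine Real.rpow_le_rpow (by positivity) ?_ hτ.le
    rw [div_eq_mul_one_div]
    nlinarith
  rw [lt_div_iff₀ (by positivity)]
  calc _ ≤ (2 * a * q ^ k + b * (k + 1) * ((2 * A) ^ τ * q' ^ k)) * (k : ℝ) ^ 2 := by gcongr
    _ = 2 * a * (k ^ 2 * q ^ k) + b * (2 * A) ^ τ * (k ^ 3 * q' ^ k + k ^ 2 * q' ^ k) := by ring
    _ < 1 := hk

theorem exists_loss_lt {σ u : ℝ} (hσ : σ < 1) (hu : u < 1 - (1 - σ) ^ 2 / (2 * (2 + σ))) :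
    ∃ M : ℕ, 0 < M ∧ 1 ≤ (1 - σ) / (2 - σ) * M ∧
      u * (M * M) < M * M - ((1 - σ) ^ 2 / (2 * (2 + σ)) * (M * M) + 550 * M) - 2 := by
  have hp : 0 < (1 - σ) / (2 - σ) := div_pos (by linarith) (by linarith)
  obtain ⟨M, hM⟩ := exists_nat_gt (max 1 (max (1 / ((1 - σ) / (2 - σ)))
    (552 / (1 - (1 - σ) ^ 2 / (2 * (2 + σ)) - u))))
  obtain ⟨h1, h2⟩ := max_lt_iff.1 hM
  obtain ⟨h2, h3⟩ := max_lt_iff.1 h2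
  rw [div_lt_iff₀ hp] at h2
  rw [div_lt_iff₀ (by linarith)] at h3
  refine ⟨M, by exact_mod_cast (by linarith : (0 : ℝ) < M), by linarith, ?_⟩
  nlinarith

open Classical in
/-- A positive proportion of the pairs in a product of two separated `t`-dimensional planar sets
determines many distances at resolution `2⁻ᵏ`. -/
theorem exists_forall_rpow_le_card {t u C₀ d : ℝ} (ht1 : 1 < t) (ht2 : t < 2) (hu0 : 0 < u)
    (hu : u < 1 - (2 - t) ^ 2 / (2 * (1 + t))) (hC₀ : 0 ≤ C₀) (hd : 0 < d) :
    ∃ k₀ : ℕ, ∀ k ≥ k₀, ∀ (X Y : Finset ℂ) (μ ν : ℂ → ℝ), (∀ x, 0 ≤ μ x) → (∀ y, 0 ≤ ν y) →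
      ∑ x ∈ X, μ x = 1 → ∑ y ∈ Y, ν y = 1 →
      (∀ x ∈ X, cell 1 x = 0) → (∀ y ∈ Y, cell 1 y = 0) →
      (∀ x ∈ X, ∀ y ∈ Y, d ≤ ‖x - y‖) →
      (∀ i ≤ k, ∀ q, ∑ x ∈ X with cell (2 ^ i) x = q, μ x ≤ C₀ * (2 : ℝ) ^ (-(t * i))) →
      (∀ i ≤ k, ∀ q, ∑ y ∈ Y with cell (2 ^ i) y = q, ν y ≤ C₀ * (2 : ℝ) ^ (-(t * i))) →
      ∀ G ⊆ X ×ˢ Y, 1 / (k : ℝ) ^ 2 ≤ ∑ p ∈ G, μ p.1 * ν p.2 →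
      ∀ R : Finset ℝ, (∀ p ∈ G, ∃ r ∈ R, |‖p.1 - p.2‖ - r| ≤ (2 : ℝ) ^ (-(k : ℝ))) →
      (2 : ℝ) ^ (u * k) ≤ R.card := by
  set σ := t - 1 with hσ
  have htσ : t = 1 + σ := by ring
  obtain ⟨M, hM0, hM1, hM2⟩ := exists_loss_lt (σ := σ) (u := u) (by linarith) (by
    rw [hσ]; convert hu using 3 <;> ring)
  set N := M * M with hN
  have hN0 : 0 < N := Nat.mul_pos hM0 hM0
  have hNr : (0 : ℝ) < N := by exact_mod_cast hN0
  set e : ℝ := N - ((1 - σ) ^ 2 / (2 * (2 + σ)) * N + 550 * M) - 2 with he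
  have hue : u * N < e := by rw [he, hN]; push_cast; exact hM2
  have hev1 := eventually_add_lt_one_div_sq
    (a := 2 * ((N : ℝ) + 1) ^ 2 + ((2 * N + 3) ^ (N + 1) * (2 * N + 3) ^ (N + 1) : ℕ) *
      (2 * ((N : ℝ) + 1) ^ 2 + 1))
    (b := ((N : ℝ) + 1) * (128 * (1 / d + 2) * (5 * (1 + 36 * C₀)))) (A := 24 * (1 / d + 2))
    (τ := σ / 2) (by positivity) (by positivity) (by positivity) (by linarith) hN0
  have hpow : Filter.Tendsto (fun k : ℕ => (2 : ℝ) ^ (k / N)) Filter.atTop Filter.atTop :=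
    (tendsto_pow_atTop_atTop_of_one_lt one_lt_two).comp (Nat.tendsto_div_const_atTop hN0.ne')
  have hev2 := hpow.eventually_ge_atTop (max (40 : ℝ) (max (9 * (N + 1)) C₀))
  have hev3 : ∀ᶠ k : ℕ in Filter.atTop, e ≤ (e - u * N) / N * k :=
    (tendsto_natCast_atTop_atTop.const_mul_atTop (div_pos (sub_pos.2 hue) hNr)).eventually_ge_atTop
      _
  obtain ⟨k₀, hk₀⟩ := Filter.eventually_atTop.1 (hev1.and (hev2.and hev3))
  refine ⟨k₀, fun k hk X Y μ ν hμ hν hμ1 hν1 hX hY hXY hμF hνF G hG hmass R hR => ?_⟩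
  obtain ⟨h1, h2, h3⟩ := hk₀ k hk
  obtain ⟨h4, h5⟩ := max_le_iff.1 h2
  obtain ⟨h5, h6⟩ := max_le_iff.1 h5
  set L := k / N with hL
  have hD : ((2 ^ L : ℕ) : ℝ) = (2 : ℝ) ^ L := by push_cast; rfl
  have hkL : (k : ℝ) / N - 1 ≤ L := by
    have : k < N * (L + 1) := by
      rw [hL]; exact Nat.lt_mul_div_succ k hN0
    have : (k : ℝ) ≤ N * (L + 1) := by exact_mod_cast this.le
    rw [sub_le_iff_le_add, div_le_iff₀ hNr]
    linarith
  have h7 := h1 ((2 ^ L : ℕ) : ℝ) (by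
    rw [hD, ← Real.rpow_natCast]
    refine le_trans (le_of_eq ?_) (Real.rpow_le_rpow_of_exponent_le one_le_two hkL)
    rw [Real.rpow_sub two_pos, Real.rpow_one])
  have hmain := rpow_le_card_of_mass (σ := σ) (C₀ := C₀) (d := d) (M := M) (N := N) (L := L)
    (D := 2 ^ L) (k := k) (by linarith) (by linarith) hC₀ hd hN hM1 rfl (Nat.div_mul_le_self k N)
    (by rw [← hD] at h4; exact_mod_cast h4) (by rw [← hD] at h5; exact_mod_cast h5)
    (by rw [hD]; exact h6) hμ hν hμ1 hν1 hX hY hXY (by rw [← htσ]; exact hμF)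
    (by rw [← htσ]; exact hνF) hG (by
      refine lt_of_le_of_lt ?_ (h7.trans_le hmass)
      rw [← mul_div_assoc, ← mul_div_assoc, add_div (2 * ((N : ℝ) + 1) ^ 2)]
      have h8 : (1 + 36 * C₀ * ((k : ℝ) + 1)) ≤ (1 + 36 * C₀) * (k + 1) := by
        have : (0 : ℝ) ≤ k := Nat.cast_nonneg k
        nlinarith
      have h9 : 0 ≤ (24 * (1 / d + 2) / ((2 ^ L : ℕ) : ℝ)) ^ (σ / 2) := by positivity
      have h10 : (N + 1) * (128 * (1 / d + 2) * (5 * (1 + 36 * C₀ * (k + 1))) *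
          (24 * (1 / d + 2) / ((2 ^ L : ℕ) : ℝ)) ^ (σ / 2)) ≤
          ((N : ℝ) + 1) * (128 * (1 / d + 2) * (5 * (1 + 36 * C₀))) * (k + 1) *
          (24 * (1 / d + 2) / ((2 ^ L : ℕ) : ℝ)) ^ (σ / 2) := by
        rw [← mul_assoc]
        refine mul_le_mul_of_nonneg_right ?_ h9
        calc _ ≤ ((N : ℝ) + 1) * (128 * (1 / d + 2) * (5 * ((1 + 36 * C₀) * (k + 1)))) := by
              gcongr
          _ = _ := by ring
      linarith) hR
  refine le_trans ?_ hmain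
  rw [hD, ← Real.rpow_natCast, ← Real.rpow_mul two_pos.le]
  refine Real.rpow_le_rpow_of_exponent_le one_le_two ?_
  have he0 : 0 ≤ e := (by positivity : 0 ≤ u * N).trans hue.le
  calc u * k ≤ (k / N - 1) * e := by
        have : (e - u * N) / N * k = k / N * e - u * k := by field_simp
        linarith
    _ ≤ L * e := by gcongr

section Hausdorff

open scoped ENNReal

/-- The dyadic square with index `v = (n, q)`. -/
def square (v : ℕ × ℤ × ℤ) : Set ℂ := {z | cell (2 ^ v.1) z = v.2}

theorem square_subset {u v : ℕ × ℤ × ℤ} {x : ℂ} (hu : x ∈ square u) (hv : x ∈ square v)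
    (huv : u.1 ≤ v.1) : square v ⊆ square u := fun z hz => by
  simp only [square, Set.mem_ofPred_eq] at *
  rw [← hu]
  exact cell_pow_of_le two_pos huv (hz.trans hv.symm)

theorem eq_of_mem_square {u v : ℕ × ℤ × ℤ} {x : ℂ} (hu : x ∈ square u) (hv : x ∈ square v)
    (huv : u.1 = v.1) : u = v := by
  simp only [square, Set.mem_ofPred_eq] at *
  refine Prod.ext huv ?_
  rw [← hu, ← hv, huv]

section Content

variable (c : ℕ × ℤ × ℤ → ℝ≥0∞)

/-- The total cost of a family of dyadic squares. -/
noncomputable def cost (V : Set (ℕ × ℤ × ℤ)) : ℝ≥0∞ := ∑' v : V, c v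

/-- The least total cost of a family of dyadic squares that covers `A`. -/
noncomputable def content (A : Set ℂ) : ℝ≥0∞ :=
  ⨅ (V : Set (ℕ × ℤ × ℤ)) (_ : A ⊆ ⋃ v ∈ V, square v), cost c V

variable {c}

theorem content_le {A : Set ℂ} {V : Set (ℕ × ℤ × ℤ)} (h : A ⊆ ⋃ v ∈ V, square v) :
    content c A ≤ cost c V := iInf₂_le V h

theorem content_mono {A B : Set ℂ} (h : A ⊆ B) : content c A ≤ content c B :=
  le_iInf₂ fun _ hV => content_le (h.trans hV)

theorem exists_cover_cost_lt {A : Set ℂ} {b : ℝ≥0∞} (h : content c A < b) :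
    ∃ V : Set (ℕ × ℤ × ℤ), A ⊆ ⋃ v ∈ V, square v ∧ cost c V < b := by
  simp only [content, iInf_lt_iff] at h
  obtain ⟨V, hV, h⟩ := h
  exact ⟨V, hV, h⟩

/-- The squares of `V` that lie in a square of `U`. -/
def lower (U V : Set (ℕ × ℤ × ℤ)) : Set (ℕ × ℤ × ℤ) :=
  {v ∈ V | ∃ u ∈ U, u.1 ≤ v.1 ∧ square v ⊆ square u}

/-- The squares of `U` that lie in a larger square of `V`. -/
def lower' (U V : Set (ℕ × ℤ × ℤ)) : Set (ℕ × ℤ × ℤ) :=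
  {u ∈ U | ∃ v ∈ V, v.1 < u.1 ∧ square u ⊆ square v}

/-- The maximal squares of two families. -/
def join (U V : Set (ℕ × ℤ × ℤ)) : Set (ℕ × ℤ × ℤ) := (U \ lower' U V) ∪ (V \ lower U V)

theorem mem_lower_union {U V : Set (ℕ × ℤ × ℤ)} {x : ℂ} {u v : ℕ × ℤ × ℤ} (hu : u ∈ U)
    (hv : v ∈ V) (hxu : x ∈ square u) (hxv : x ∈ square v) :
    ∃ w ∈ lower' U V ∪ lower U V, x ∈ square w := by
  rcases le_or_gt u.1 v.1 with h | h
  · exact ⟨v, Or.inr ⟨hv, u, hu, h, square_subset hxu hxv h⟩, hxv⟩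
  · exact ⟨u, Or.inl ⟨hu, v, hv, h, square_subset hxv hxu h.le⟩, hxu⟩

theorem exists_mem_join {U V : Set (ℕ × ℤ × ℤ)} {x : ℂ} (n : ℕ) :
    (∀ u ∈ U, x ∈ square u → u.1 = n → ∃ w ∈ join U V, x ∈ square w ∧ w.1 ≤ u.1) ∧
    (∀ v ∈ V, x ∈ square v → v.1 = n → ∃ w ∈ join U V, x ∈ square w ∧ w.1 ≤ v.1) := by
  induction n using Nat.strong_induction_on with
  | _ n ih =>
    have hU : ∀ u ∈ U, x ∈ square u → u.1 = n → ∃ w ∈ join U V, x ∈ square w ∧ w.1 ≤ u.1 := by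
      intro u hu hx hn
      by_cases h : u ∈ lower' U V
      · obtain ⟨-, v, hv, hlt, hsub⟩ := h
        obtain ⟨w, hw, hxw, hle⟩ := (ih v.1 (hn ▸ hlt)).2 v hv (hsub hx) rfl
        exact ⟨w, hw, hxw, hle.trans hlt.le⟩
      · exact ⟨u, Or.inl ⟨hu, h⟩, hx, le_rfl⟩
    refine ⟨hU, fun v hv hx hn => ?_⟩
    by_cases h : v ∈ lower U V
    · obtain ⟨-, u, hu, hle, hsub⟩ := h
      rcases hle.eq_or_lt with heq | hlt
      · obtain ⟨w, hw, hxw, hle'⟩ := hU u hu (hsub hx) (heq.trans hn)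
        exact ⟨w, hw, hxw, hle'.trans hle⟩
      · obtain ⟨w, hw, hxw, hle'⟩ := (ih u.1 (hn ▸ hlt)).1 u hu (hsub hx) rfl
        exact ⟨w, hw, hxw, hle'.trans hle⟩
    · exact ⟨v, Or.inr ⟨hv, h⟩, hx, le_rfl⟩

theorem cost_union_le (U V : Set (ℕ × ℤ × ℤ)) : cost c (U ∪ V) ≤ cost c U + cost c V :=
  ENNReal.tsum_union_le c U V

theorem cost_sdiff_add {U V : Set (ℕ × ℤ × ℤ)} (h : V ⊆ U) :
    cost c (U \ V) + cost c V = cost c U := by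
  rw [cost, cost, cost, ← Summable.tsum_union_disjoint disjoint_sdiff_left ENNReal.summable
    ENNReal.summable, sdiff_union_of_subset h]

theorem cost_join_add_le (U V : Set (ℕ × ℤ × ℤ)) :
    cost c (join U V) + cost c (lower' U V ∪ lower U V) ≤ cost c U + cost c V := by
  calc _ ≤ (cost c (U \ lower' U V) + cost c (V \ lower U V)) +
        (cost c (lower' U V) + cost c (lower U V)) :=
        add_le_add (cost_union_le _ _) (cost_union_le _ _)
    _ = (cost c (U \ lower' U V) + cost c (lower' U V)) +
        (cost c (V \ lower U V) + cost c (lower U V)) := by ring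
    _ = _ := by rw [cost_sdiff_add fun u hu => hu.1, cost_sdiff_add fun u hu => hu.1]

/-- The dyadic net content is continuous along increasing sequences of sets. -/
theorem content_iUnion_le {A : ℕ → Set ℂ} (hA : Monotone A) {α : ℝ≥0∞}
    (hα : ∀ n, content c (A n) ≤ α) : content c (⋃ n, A n) ≤ α := by
  rcases eq_or_ne α ⊤ with rfl | hαt
  · exact le_top
  refine ENNReal.le_of_forall_pos_le_add fun ε hε _ => ?_
  obtain ⟨δ, hδ, hδsum⟩ := ENNReal.exists_pos_sum_of_countable (ENNReal.coe_pos.2 hε).ne' ℕ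
  have hfin : ∀ n, content c (A n) ≠ ⊤ := fun n => ((hα n).trans_lt hαt.lt_top).ne
  choose V hV hVcost using fun n => exists_cover_cost_lt
    (ENNReal.lt_add_right (hfin n) (ENNReal.coe_pos.2 (hδ n)).ne')
  let W : ℕ → Set (ℕ × ℤ × ℤ) := fun n => Nat.rec (V 0) (fun m U => join U (V (m + 1))) n
  have hW0 : W 0 = V 0 := rfl
  have hWs : ∀ n, W (n + 1) = join (W n) (V (n + 1)) := fun n => rfl
  have hWstep : ∀ n x, ∀ u ∈ W n, x ∈ square u → ∃ w ∈ W (n + 1), x ∈ square w ∧ w.1 ≤ u.1 :=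
    fun n x u hu hx => (exists_mem_join u.1).1 u hu hx rfl
  have hWcov : ∀ n, A n ⊆ ⋃ v ∈ W n, square v := by
    intro n x hx
    have h1 := hV n hx
    simp only [mem_iUnion, exists_prop] at h1 ⊢
    obtain ⟨v, hv, hxv⟩ := h1
    cases n with
    | zero => exact ⟨v, hv, hxv⟩
    | succ m =>
      obtain ⟨w, hw, hxw, -⟩ := (exists_mem_join (U := W m) v.1).2 v hv hxv rfl
      exact ⟨w, hw, hxw⟩
  have hWcost : ∀ n, cost c (W n) ≤ content c (A n) + ∑ i ∈ Finset.range (n + 1), (δ i : ℝ≥0∞) := by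
    intro n
    induction n with
    | zero => simpa [hW0] using (hVcost 0).le
    | succ n ih =>
      have h1 : content c (A n) ≤ cost c (lower' (W n) (V (n + 1)) ∪ lower (W n) (V (n + 1))) := by
        refine content_le fun x hx => ?_
        have h2 := hWcov n hx
        have h3 := hV (n + 1) (hA n.le_succ hx)
        simp only [mem_iUnion, exists_prop] at h2 h3 ⊢
        obtain ⟨u, hu, hxu⟩ := h2
        obtain ⟨v, hv, hxv⟩ := h3
        exact mem_lower_union hu hv hxu hxv
      refine (ENNReal.add_le_add_iff_right (hfin n)).1 ?_
      calc cost c (W (n + 1)) + content c (A n) ≤ cost c (W n) + cost c (V (n + 1)) := by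
            rw [hWs]
            exact (add_le_add le_rfl h1).trans (cost_join_add_le _ _)
        _ ≤ (content c (A n) + ∑ i ∈ Finset.range (n + 1), (δ i : ℝ≥0∞)) +
            (content c (A (n + 1)) + δ (n + 1)) := add_le_add ih (hVcost _).le
        _ = _ := by rw [Finset.sum_range_succ _ (n + 1)]; ring
  have hWcost' : ∀ n, cost c (W n) ≤ α + ε := fun n =>
    (hWcost n).trans (add_le_add (hα n) ((ENNReal.sum_le_tsum _).trans hδsum.le))
  set Z : Set (ℕ × ℤ × ℤ) := {v | ∃ n, ∀ m ≥ n, v ∈ W m} with hZ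
  refine (content_le (V := Z) fun x hx => ?_).trans ?_
  · obtain ⟨n, hn⟩ := mem_iUnion.1 hx
    obtain ⟨u, hu⟩ := mem_iUnion.1 (hWcov n hn)
    obtain ⟨hu, hxu⟩ := mem_iUnion.1 hu
    have hex : ∃ l : ℕ, ∃ n : ℕ, ∃ u ∈ W n, x ∈ square u ∧ u.1 = l := ⟨u.1, n, u, hu, hxu, rfl⟩
    obtain ⟨l, ⟨n, u, hu, hxu, hul⟩, hl⟩ : ∃ l, (∃ n, ∃ u ∈ W n, x ∈ square u ∧ u.1 = l) ∧
        ∀ m, ∀ w ∈ W m, x ∈ square w → l ≤ w.1 :=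
      have := Classical.decPred fun l : ℕ => ∃ n : ℕ, ∃ u ∈ W n, x ∈ square u ∧ u.1 = l
      ⟨Nat.find hex, Nat.find_spec hex, fun m w hw hxw => Nat.find_min' hex ⟨m, w, hw, hxw, rfl⟩⟩
    have hmin : ∀ m, ∀ w ∈ W m, x ∈ square w → u.1 ≤ w.1 := fun m w hw hxw => by
      exact hul.trans_le (hl m w hw hxw)
    simp only [mem_iUnion, exists_prop]
    refine ⟨u, ⟨n, fun m hm => ?_⟩, hxu⟩
    induction m, hm using Nat.le_induction with
    | base => exact hu
    | succ m _ ih =>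
      obtain ⟨w, hw, hxw, hle⟩ := hWstep m x u ih hxu
      rwa [eq_of_mem_square hxu hxw ((hmin (m + 1) w hw hxw).antisymm hle)]
  · rw [cost, ENNReal.tsum_eq_iSup_sum]
    refine iSup_le fun s => ?_
    have : ∃ n, ∀ v ∈ s, (v : ℕ × ℤ × ℤ) ∈ W n := by
      choose f hf using fun v : Z => v.2
      exact ⟨s.sup f, fun v hv => hf v _ (Finset.le_sup hv)⟩
    obtain ⟨n, hn⟩ := this
    refine le_trans ?_ (hWcost' n)
    rw [cost, tsum_subtype]
    calc ∑ v ∈ s, c v = ∑ v ∈ s.map (Function.Embedding.subtype _), c v := by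
          rw [Finset.sum_map]; rfl
      _ = ∑ v ∈ s.map (Function.Embedding.subtype _), (W n).indicator c v := by
          refine Finset.sum_congr rfl fun v hv => ?_
          obtain ⟨w, hw, rfl⟩ := Finset.mem_map.1 hv
          rw [indicator_of_mem]
          exact hn w hw
      _ ≤ _ := ENNReal.sum_le_tsum _

end Content

/-- The neighbours of a dyadic square, itself included. -/
def neighbours (v : ℕ × ℤ × ℤ) : Set (ℕ × ℤ × ℤ) :=
  {w | w.1 = v.1 ∧ |w.2.1 - v.2.1| ≤ 1 ∧ |w.2.2 - v.2.2| ≤ 1}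

theorem abs_floor_sub_le_one {a b : ℝ} (h : |a - b| ≤ 1) : |⌊a⌋ - ⌊b⌋| ≤ 1 := by
  rw [abs_le] at h ⊢
  have h1 : ⌊a⌋ ≤ ⌊b + 1⌋ := Int.floor_mono (by linarith)
  have h2 : ⌊b⌋ ≤ ⌊a + 1⌋ := Int.floor_mono (by linarith)
  rw [Int.floor_add_one] at h1 h2
  omega

theorem ball_subset_neighbours {v : ℕ × ℤ × ℤ} {z : ℂ} (hz : z ∈ square v) :
    Metric.ball z (1 / 2 ^ v.1) ⊆ ⋃ w ∈ neighbours v, square w := by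
  intro x hx
  rw [Metric.mem_ball, dist_eq_norm, lt_div_iff₀ (by positivity)] at hx
  simp only [square, Set.mem_ofPred_eq] at hz
  simp only [mem_iUnion, exists_prop]
  refine ⟨(v.1, cell (2 ^ v.1) x), ⟨rfl, ?_, ?_⟩, rfl⟩ <;> rw [← hz] <;>
    refine abs_floor_sub_le_one ?_ <;> push_cast <;>
      rw [← mul_sub, abs_mul, abs_of_pos (by positivity)]
  · have := Complex.abs_re_le_norm (x - z)
    rw [Complex.sub_re] at this
    nlinarith [pow_pos (two_pos : (0 : ℝ) < 2) v.1]
  · have := Complex.abs_im_le_norm (x - z)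
    rw [Complex.sub_im] at this
    nlinarith [pow_pos (two_pos : (0 : ℝ) < 2) v.1]

section

variable {c : ℕ → ℝ≥0∞}

theorem cost_neighbours_le (v : ℕ × ℤ × ℤ) :
    cost (fun w => c w.1) (neighbours v) ≤ 9 * c v.1 := by
  have h : neighbours v ⊆ ((({v.1} : Finset ℕ) ×ˢ (Finset.Icc (v.2.1 - 1) (v.2.1 + 1) ×ˢ
      Finset.Icc (v.2.2 - 1) (v.2.2 + 1)) : Finset (ℕ × ℤ × ℤ)) : Set (ℕ × ℤ × ℤ)) := by
    rintro w ⟨h1, h2, h3⟩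
    rw [abs_le] at h2 h3
    simp only [Finset.coe_product, mem_prod, Finset.coe_singleton, mem_singleton_iff,
      Finset.coe_Icc, mem_Icc]
    omega
  calc _ ≤ ∑ w ∈ ({v.1} : Finset ℕ) ×ˢ (Finset.Icc (v.2.1 - 1) (v.2.1 + 1) ×ˢ
      Finset.Icc (v.2.2 - 1) (v.2.2 + 1)), c w.1 := by
        rw [cost, ← Finset.tsum_subtype]
        exact ENNReal.tsum_mono_subtype (fun w => c w.1) h
    _ = 9 * c v.1 := by
      simp only [Finset.sum_product, Finset.sum_singleton, Finset.sum_const]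
      rw [Finset.card_product,
        Int.card_Icc, Int.card_Icc, nsmul_eq_mul]
      have h1 : v.2.1 + 1 + 1 - (v.2.1 - 1) = 3 := by ring
      have h2 : v.2.2 + 1 + 1 - (v.2.2 - 1) = 3 := by ring
      rw [h1, h2, show Int.toNat 3 = 3 from rfl]
      norm_num

theorem cost_iUnion_neighbours_le (V : Finset (ℕ × ℤ × ℤ)) :
    cost (fun w => c w.1) (⋃ v ∈ V, neighbours v) ≤ 9 * ∑ v ∈ V, c v.1 := by
  rw [cost, Finset.mul_sum]
  exact (ENNReal.tsum_biUnion_le (fun w => c w.1) V neighbours).trans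
    (Finset.sum_le_sum fun v _ => cost_neighbours_le v)

theorem lt_content_exists_bounds {f : (ℕ → ℕ) → ℂ} {a : ℝ≥0∞}
    (h : a < content (fun w => c w.1) (range f)) :
    ∃ B : ℕ → ℕ, ∀ k, a < content (fun w => c w.1) (f '' {x | ∀ i < k, x i ≤ B i}) := by
  let P : ℕ → (ℕ → ℕ) → Prop := fun k B =>
    a < content (fun w => c w.1) (f '' {x | ∀ i < k, x i ≤ B i})
  have hstep : ∀ k B, P k B → ∃ B', P (k + 1) B' ∧ ∀ i < k, B' i = B i := by
    intro k B hB
    by_contra! hcon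
    refine (lt_irrefl a) (hB.trans_le ?_)
    have hun : f '' {x | ∀ i < k, x i ≤ B i} ⊆
        ⋃ m, f '' {x | ∀ i < k + 1, x i ≤ Function.update B k m i} := by
      rintro _ ⟨x, hx, rfl⟩
      refine mem_iUnion.2 ⟨x k, x, fun i hi => ?_, rfl⟩
      rcases eq_or_ne i k with rfl | hne
      · simp
      · rw [Function.update_of_ne hne]
        exact hx i (by omega)
    refine (content_mono hun).trans (content_iUnion_le (fun m n hmn => ?_) fun m => ?_)
    · refine image_mono fun x hx i hi => (hx i hi).trans ?_
      rcases eq_or_ne i k with rfl | hne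
      · simpa using hmn
      · rw [Function.update_of_ne hne, Function.update_of_ne hne]
    · by_contra! hlt
      obtain ⟨i, hi, hne⟩ := hcon (Function.update B k m) hlt
      exact hne (Function.update_of_ne hi.ne _ _)
  have h0 : P 0 0 := by simpa [P] using h
  choose! g hg hgi using hstep
  let S : ℕ → ℕ → ℕ := fun n => Nat.rec 0 (fun k B => g k B) n
  have hS : ∀ k, P k (S k) := fun k => by
    induction k with
    | zero => exact h0
    | succ k ih => exact hg k _ ih
  have hSi : ∀ i k, i < k → S k i = S (i + 1) i := fun i k hik => by
    induction k, hik using Nat.le_induction with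
    | base => rfl
    | succ k hk ih => exact (hgi k _ (hS k) i hk).trans ih
  refine ⟨fun i => S (i + 1) i, fun k => ?_⟩
  have h1 := hS k
  have h2 : {x : ℕ → ℕ | ∀ i < k, x i ≤ S k i} = {x | ∀ i < k, x i ≤ S (i + 1) i} := by
    ext x
    exact forall₂_congr fun i hi => by rw [hSi i k hi]
  simp only [P] at h1
  rwa [h2] at h1

theorem exists_image_bounds_subset {f : (ℕ → ℕ) → ℂ} (hf : Continuous f) {B : ℕ → ℕ} {U : Set ℂ}
    (hU : IsOpen U) (h : f '' {x | ∀ i, x i ≤ B i} ⊆ U) :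
    ∃ k, f '' {x | ∀ i < k, x i ≤ B i} ⊆ U := by
  by_contra! hcon
  have : ∀ k, ∃ x : ℕ → ℕ, (∀ i < k, x i ≤ B i) ∧ f x ∉ U := fun k => by
    obtain ⟨_, ⟨x, hx, rfl⟩, hxU⟩ := not_subset.1 (hcon k)
    exact ⟨x, hx, hxU⟩
  choose x hx hxU using this
  have hK : IsCompact (univ.pi fun i => Icc 0 (B i + ∑ k ∈ Finset.range (i + 1), x k i)) :=
    isCompact_univ_pi fun i => (finite_Icc _ _).isCompact
  have hxK : ∀ k, x k ∈ univ.pi fun i => Icc 0 (B i + ∑ k ∈ Finset.range (i + 1), x k i) := by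
    intro k i _
    refine ⟨Nat.zero_le _, ?_⟩
    rcases lt_or_ge i k with hik | hik
    · exact (hx k i hik).trans (Nat.le_add_right _ _)
    · exact (Finset.single_le_sum (f := fun k => x k i) (fun _ _ => Nat.zero_le _)
        (Finset.mem_range.2 (by omega))).trans (Nat.le_add_left _ _)
  obtain ⟨y, -, φ, hφ, hy⟩ := hK.tendsto_subseq hxK
  have hyB : ∀ i, y i ≤ B i := fun i => by
    refine le_of_tendsto ((tendsto_pi_nhds.1 hy) i) ?_
    filter_upwards [Filter.eventually_gt_atTop i] with k hk
    exact hx _ i (hk.trans_le (hφ.id_le k))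
  have hyU : f y ∈ U := h ⟨y, hyB, rfl⟩
  obtain ⟨k, hk⟩ := (((hf.tendsto y).comp hy).eventually (hU.mem_nhds hyU)).exists
  exact hxU _ hk

/-- An analytic set of positive net content has a compact subset all of whose finite dyadic covers
are expensive. -/
theorem exists_compact_content {A : Set ℂ} (hA : AnalyticSet A) {a : ℝ≥0∞}
    (ha : a < content (fun w => c w.1) A) :
    ∃ K ⊆ A, IsCompact K ∧ ∀ V : Finset (ℕ × ℤ × ℤ), K ⊆ ⋃ v ∈ V, square v →
      a < 9 * ∑ v ∈ V, c v.1 := by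
  rw [AnalyticSet] at hA
  obtain rfl | ⟨f, hf, rfl⟩ := hA
  · have : content (fun w => c w.1) (∅ : Set ℂ) ≤ cost (fun w => c w.1) ∅ :=
      content_le (empty_subset _)
    rw [cost, tsum_empty] at this
    exact absurd (ha.trans_le this) not_lt_zero
  obtain ⟨B, hB⟩ := lt_content_exists_bounds ha
  have hC : IsCompact {x : ℕ → ℕ | ∀ i, x i ≤ B i} := by
    convert isCompact_univ_pi fun i => (finite_Icc 0 (B i)).isCompact
    ext x
    simp [Pi.le_def]
  refine ⟨f '' {x | ∀ i, x i ≤ B i}, image_subset_range _ _, hC.image hf, fun V hV => ?_⟩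
  have hU : IsOpen (⋃ v ∈ V, ⋃ z ∈ square v, Metric.ball z (1 / 2 ^ v.1)) :=
    isOpen_biUnion fun v _ => isOpen_biUnion fun z _ => Metric.isOpen_ball
  obtain ⟨k, hk⟩ := exists_image_bounds_subset hf (B := B) hU
    (hV.trans (iUnion₂_mono fun v _ z hz =>
    mem_iUnion₂.2 ⟨z, hz, Metric.mem_ball_self (by positivity)⟩))
  refine (hB k).trans_le ((content_le (V := ⋃ v ∈ V, neighbours v) (hk.trans ?_)).trans
    (cost_iUnion_neighbours_le V))
  refine iUnion₂_subset fun v hv => iUnion₂_subset fun z hz => (ball_subset_neighbours hz).trans ?_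
  exact biUnion_subset_biUnion_left (subset_biUnion_of_mem (u := neighbours) hv)

end

theorem ediam_square_le (v : ℕ × ℤ × ℤ) :
    Metric.ediam (square v) ≤ ENNReal.ofReal (2 * (2 : ℝ) ^ (-(v.1 : ℝ))) := by
  refine Metric.ediam_le_of_forall_dist_le fun z hz w hw => ?_
  have h := norm_sub_le_of_cell (n := 2 ^ v.1) (by positivity) ((mem_ofPred_eq ▸ hz : _ = v.2).trans
    (mem_ofPred_eq ▸ hw : _ = v.2).symm)
  rw [dist_eq_norm, Real.rpow_neg two_pos.le, Real.rpow_natCast]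
  push_cast at h
  rwa [div_eq_mul_inv] at h

/-- A set of positive Hausdorff measure has positive net content. -/
theorem content_pos {t : ℝ} (ht : 0 < t) {A : Set ℂ} (hA : μH[t] A ≠ 0) :
    0 < content (fun v => ENNReal.ofReal ((2 : ℝ) ^ (-(t * v.1)))) A := by
  rw [pos_iff_ne_zero]
  intro h0
  refine hA (nonpos_iff_eq_zero.1 ?_)
  have hex : ∀ n : ℕ, ∃ V : Set (ℕ × ℤ × ℤ), A ⊆ ⋃ v ∈ V, square v ∧
      cost (fun v => ENNReal.ofReal ((2 : ℝ) ^ (-(t * v.1)))) V <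
        ENNReal.ofReal ((2 : ℝ) ^ (-(t * n))) := fun n =>
    exists_cover_cost_lt (h0 ▸ ENNReal.ofReal_pos.2 (by positivity))
  choose V hV hcost using hex
  have hlev : ∀ n, ∀ v : V n, (n : ℝ) ≤ v.1.1 := by
    intro n v
    have h1 := (ENNReal.le_tsum v).trans_lt (hcost n)
    rw [ENNReal.ofReal_lt_ofReal_iff (by positivity)] at h1
    rw [Real.rpow_lt_rpow_left_iff one_lt_two] at h1
    nlinarith
  have hlim : ∀ a : ℝ, 0 < a → Filter.Tendsto (fun n : ℕ => (2 : ℝ) ^ (-(a * n))) Filter.atTop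
      (nhds 0) := fun a ha => by
    have h1 : (fun n : ℕ => (2 : ℝ) ^ (-(a * n))) = fun n : ℕ => ((2 : ℝ) ^ (-a)) ^ n := by
      ext n
      rw [← Real.rpow_natCast, ← Real.rpow_mul two_pos.le, neg_mul]
    rw [h1]
    exact tendsto_pow_atTop_nhds_zero_of_lt_one (by positivity)
      (Real.rpow_lt_one_of_one_lt_of_neg one_lt_two (by linarith))
  have hr : Filter.Tendsto (fun n : ℕ => ENNReal.ofReal (2 * (2 : ℝ) ^ (-(1 * (n : ℝ)))))
      Filter.atTop (nhds 0) := by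
    have := ENNReal.tendsto_ofReal ((hlim 1 one_pos).const_mul 2)
    rwa [mul_zero, ENNReal.ofReal_zero] at this
  refine (Measure.hausdorffMeasure_le_liminf_tsum t A _ hr (fun n (v : V n) => square v)
    (Filter.Eventually.of_forall fun n v => (ediam_square_le v).trans (ENNReal.ofReal_le_ofReal ?_))
    (Filter.Eventually.of_forall fun n => (hV n).trans_eq (biUnion_eq_iUnion _ _))).trans ?_
  · have := hlev n v
    gcongr
    · norm_num
    · linarith
  · have hbound : ∀ n : ℕ, ∑' v : V n, Metric.ediam (square v) ^ t ≤
        ENNReal.ofReal (2 ^ t * (2 : ℝ) ^ (-(t * (n : ℝ)))) := fun n => by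
      calc _ ≤ ∑' v : V n, ENNReal.ofReal (2 ^ t) * ENNReal.ofReal ((2 : ℝ) ^ (-(t * v.1.1))) := by
            refine ENNReal.tsum_le_tsum fun v => ?_
            refine (ENNReal.rpow_le_rpow (ediam_square_le v) ht.le).trans_eq ?_
            rw [ENNReal.ofReal_rpow_of_nonneg (by positivity) ht.le,
              Real.mul_rpow two_pos.le (by positivity), ENNReal.ofReal_mul (by positivity),
              ← Real.rpow_mul two_pos.le]
            congr 3
            ring
        _ = ENNReal.ofReal (2 ^ t) *
            cost (fun v => ENNReal.ofReal ((2 : ℝ) ^ (-(t * v.1)))) (V n) :=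
            ENNReal.tsum_mul_left
        _ ≤ ENNReal.ofReal (2 ^ t) * ENNReal.ofReal ((2 : ℝ) ^ (-(t * n))) := by
            gcongr
            exact (hcost n).le
        _ = _ := (ENNReal.ofReal_mul (by positivity)).symm
    have h2 := ENNReal.tendsto_ofReal ((hlim t ht).const_mul (2 ^ t))
    rw [mul_zero, ENNReal.ofReal_zero] at h2
    rw [← h2.liminf_eq]
    exact Filter.liminf_le_liminf (Filter.Eventually.of_forall hbound)

open Classical in
/-- A discrete Frostman lemma: a heaviest weight obeying the dyadic mass bounds saturates the
squares of a cover. -/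
theorem exists_frostman_weight (t : ℝ) (n : ℕ) (X : Finset ℂ) :
    ∃ w : ℂ → ℝ, (∀ x, 0 ≤ w x) ∧
      (∀ i ≤ n, ∀ q, ∑ x ∈ X with cell (2 ^ i) x = q, w x ≤ (2 : ℝ) ^ (-(t * i))) ∧
      ∃ V : Finset (ℕ × ℤ × ℤ), (∀ v ∈ V, v.1 ≤ n) ∧ (∀ x ∈ X, ∃ v ∈ V, x ∈ square v) ∧
        ∑ v ∈ V, (2 : ℝ) ^ (-(t * v.1)) = ∑ x ∈ X, w x := by
  set S : Set (ℂ → ℝ) := (univ.pi fun _ => Icc 0 1) ∩ {w | ∀ i ≤ n, ∀ q,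
    ∑ x ∈ X with cell (2 ^ i) x = q, w x ≤ (2 : ℝ) ^ (-(t * i))} with hS
  have hScl : IsClosed {w : ℂ → ℝ | ∀ i ≤ n, ∀ q,
      ∑ x ∈ X with cell (2 ^ i) x = q, w x ≤ (2 : ℝ) ^ (-(t * i))} := by
    simp only [Set.ofPred_forall]
    exact isClosed_iInter fun i => isClosed_iInter fun _ => isClosed_iInter fun q =>
      isClosed_le (by fun_prop) continuous_const
  have hScomp : IsCompact S := (isCompact_univ_pi fun _ => isCompact_Icc).inter_right hScl
  have hSne : S.Nonempty := ⟨0, fun x _ => ⟨le_rfl, zero_le_one⟩, fun i _ q => by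
    simp only [Pi.zero_apply, Finset.sum_const_zero]; positivity⟩
  obtain ⟨w, ⟨hw1, hw2⟩, hmax⟩ := hScomp.exists_isMaxOn hSne (f := fun w => ∑ x ∈ X, w x)
    (by fun_prop)
  have hw0 : ∀ x, 0 ≤ w x := fun x => (hw1 x trivial).1
  have htight : ∀ x ∈ X, ∃ i, i ≤ n ∧
      ∑ y ∈ X with cell (2 ^ i) y = cell (2 ^ i) x, w y = (2 : ℝ) ^ (-(t * i)) := by
    intro x hx
    by_contra! hcon
    have hlt : ∀ i ≤ n, ∑ y ∈ X with cell (2 ^ i) y = cell (2 ^ i) x, w y < (2 : ℝ) ^ (-(t * i)) :=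
      fun i hi => lt_of_le_of_ne (hw2 i hi _) (hcon i hi)
    obtain ⟨ε, hε, hεle⟩ : ∃ ε > 0, ∀ i ≤ n,
        ∑ y ∈ X with cell (2 ^ i) y = cell (2 ^ i) x, w y + ε ≤ (2 : ℝ) ^ (-(t * i)) := by
      obtain ⟨j, hj, hjmin⟩ := (Finset.range (n + 1)).exists_min_image (fun i : ℕ =>
        (2 : ℝ) ^ (-(t * i)) - ∑ y ∈ X with cell (2 ^ i) y = cell (2 ^ i) x, w y) ⟨0, by simp⟩
      refine ⟨_, sub_pos.2 (hlt j (by simpa [Nat.lt_succ_iff] using hj)), fun i hi => ?_⟩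
      have := hjmin i (Finset.mem_range.2 (by omega))
      linarith
    have hsum : ∀ Y : Finset ℂ, ∑ y ∈ Y, Function.update w x (w x + ε) y =
        ∑ y ∈ Y, w y + if x ∈ Y then ε else 0 := by
      intro Y
      rw [← Finset.sum_ite_eq' Y x fun _ => ε, ← Finset.sum_add_distrib]
      refine Finset.sum_congr rfl fun y _ => ?_
      rcases eq_or_ne y x with rfl | hne
      · simp
      · simp [hne]
    have hmem : Function.update w x (w x + ε) ∈ S := by
      refine ⟨fun y _ => ?_, fun i hi q => ?_⟩
      · rcases eq_or_ne y x with rfl | hne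
        · rw [Function.update_self]
          refine ⟨add_nonneg (hw0 _) hε.le, ?_⟩
          have h1 := hεle 0 (Nat.zero_le _)
          have h2 := Finset.single_le_sum (f := w) (fun y _ => hw0 y)
            (Finset.mem_filter.2 ⟨hx, rfl⟩ : y ∈ X.filter fun z => cell (2 ^ 0) z = cell (2 ^ 0) y)
          simp only [Nat.cast_zero, mul_zero, neg_zero, Real.rpow_zero] at h1
          linarith
        · rw [Function.update_of_ne hne]
          exact hw1 y trivial
      · rw [hsum]
        split_ifs with h
        · obtain rfl := (Finset.mem_filter.1 h).2
          exact hεle i hi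
        · rw [add_zero]
          exact hw2 i hi q
    have h3 := hmax hmem
    simp only [mem_ofPred_eq, hsum, hx, if_true] at h3
    linarith
  let lev : ℂ → ℕ := fun x => if hx : x ∈ X then Nat.find (htight x hx) else 0
  have hlev : ∀ x ∈ X, lev x ≤ n ∧
      ∑ y ∈ X with cell (2 ^ lev x) y = cell (2 ^ lev x) x, w y = (2 : ℝ) ^ (-(t * lev x)) :=
    fun x hx => by
      simp only [lev, dif_pos hx]
      exact Nat.find_spec (htight x hx)
  have hlevmin : ∀ x ∈ X, ∀ i ≤ n,
      ∑ y ∈ X with cell (2 ^ i) y = cell (2 ^ i) x, w y = (2 : ℝ) ^ (-(t * i)) → lev x ≤ i :=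
    fun x hx i hi h => by
      simp only [lev, dif_pos hx]
      exact Nat.find_min' (htight x hx) ⟨hi, h⟩
  have hlevle : ∀ x ∈ X, ∀ y ∈ X, cell (2 ^ lev x) y = cell (2 ^ lev x) x → lev y ≤ lev x :=
    fun x hx y hy h => hlevmin y hy _ (hlev x hx).1 (by rw [h]; exact (hlev x hx).2)
  let idx : ℂ → ℕ × ℤ × ℤ := fun x => (lev x, cell (2 ^ lev x) x)
  have hidx : ∀ x ∈ X, ∀ y ∈ X, cell (2 ^ lev x) y = cell (2 ^ lev x) x → idx y = idx x := by
    intro x hx y hy h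
    have h1 := hlevle x hx y hy h
    have h2 := hlevle y hy x hx (cell_pow_of_le two_pos h1 h).symm
    have h3 : lev y = lev x := h1.antisymm h2
    simp only [idx, h3, h]
  refine ⟨w, hw0, hw2, X.image idx, fun v hv => ?_, fun x hx =>
    ⟨idx x, Finset.mem_image_of_mem _ hx, rfl⟩, ?_⟩
  · obtain ⟨x, hx, rfl⟩ := Finset.mem_image.1 hv
    exact (hlev x hx).1
  · rw [← Finset.sum_fiberwise_of_maps_to (s := X) (t := X.image idx) (g := idx)
      (fun x hx => Finset.mem_image_of_mem _ hx)]
    refine Finset.sum_congr rfl fun v hv => ?_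
    obtain ⟨x, hx, rfl⟩ := Finset.mem_image.1 hv
    rw [← (hlev x hx).2]
    refine Finset.sum_congr (Finset.filter_congr fun y hy => ⟨hidx x hx y hy, fun h => ?_⟩)
      fun _ _ => rfl
    simp only [idx, Prod.mk.injEq] at h
    rw [← h.2, h.1]

theorem finite_image_cell {K : Set ℂ} (hK : Bornology.IsBounded K) (n : ℕ) :
    (cell n '' K).Finite := by
  obtain ⟨R, hR⟩ := hK.exists_norm_le
  refine ((finite_Icc ⌊-(n * R)⌋ ⌊n * R⌋).prod (finite_Icc ⌊-(n * R)⌋ ⌊n * R⌋)).subset ?_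
  rintro _ ⟨z, hz, rfl⟩
  have h1 := abs_le.1 ((Complex.abs_re_le_norm z).trans (hR z hz))
  have h2 := abs_le.1 ((Complex.abs_im_le_norm z).trans (hR z hz))
  have hn : (0 : ℝ) ≤ n := Nat.cast_nonneg n
  refine ⟨⟨Int.floor_mono ?_, Int.floor_mono ?_⟩, Int.floor_mono ?_, Int.floor_mono ?_⟩ <;>
    nlinarith

theorem exists_finset_cell_eq {K : Set ℂ} (hK : Bornology.IsBounded K) (n : ℕ) :
    ∃ X : Finset ℂ, ↑X ⊆ K ∧ ∀ z ∈ K, ∃ x ∈ X, cell n x = cell n z := by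
  obtain ⟨s, hs, hbij⟩ := exists_subset_bijOn K (cell n)
  have hfin : s.Finite := Finite.of_finite_image (hbij.image_eq ▸ finite_image_cell hK n)
    hbij.injOn
  refine ⟨hfin.toFinset, by simpa using hs, fun z hz => ?_⟩
  obtain ⟨x, hx, hxz⟩ := hbij.surjOn (mem_image_of_mem _ hz)
  exact ⟨x, by simpa using hx, hxz⟩

open Classical in
/-- Discrete Frostman measures on an analytic set of positive Hausdorff measure. -/
theorem exists_compact_frostman {t : ℝ} (ht : 0 < t) {A : Set ℂ} (hA : AnalyticSet A)
    (hA0 : μH[t] A ≠ 0) :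
    ∃ K ⊆ A, IsCompact K ∧ ∃ C₀ : ℝ, 0 ≤ C₀ ∧ ∀ n : ℕ, ∃ X : Finset ℂ, ↑X ⊆ K ∧
      ∃ μ : ℂ → ℝ, (∀ x, 0 ≤ μ x) ∧ ∑ x ∈ X, μ x = 1 ∧
        ∀ i ≤ n, ∀ q, ∑ x ∈ X with cell (2 ^ i) x = q, μ x ≤ C₀ * (2 : ℝ) ^ (-(t * i)) := by
  obtain ⟨b, hb0, hb⟩ := ENNReal.lt_iff_exists_nnreal_btwn.1 (content_pos ht hA0)
  have hb0 : (0 : ℝ) < b := by exact_mod_cast hb0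
  obtain ⟨K, hKA, hK, hKc⟩ := exists_compact_content
    (c := fun i => ENNReal.ofReal ((2 : ℝ) ^ (-(t * i)))) hA hb
  refine ⟨K, hKA, hK, 9 / b, by positivity, fun n => ?_⟩
  obtain ⟨X, hXK, hX⟩ := exists_finset_cell_eq hK.isBounded (2 ^ n)
  obtain ⟨w, hw0, hw, V, hVn, hV, hVw⟩ := exists_frostman_weight t n X
  have hcov : K ⊆ ⋃ v ∈ V, square v := fun z hz => by
    obtain ⟨x, hx, hxz⟩ := hX z hz
    obtain ⟨v, hv, hxv⟩ := hV x hx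
    exact mem_iUnion₂.2 ⟨v, hv, (cell_pow_of_le two_pos (hVn v hv) hxz).symm.trans hxv⟩
  have hW : (b : ℝ) / 9 < ∑ x ∈ X, w x := by
    have h1 := hKc V hcov
    rw [← ENNReal.ofReal_sum_of_nonneg (fun v _ => by positivity), hVw,
      ← ENNReal.ofReal_coe_nnreal, ← ENNReal.ofReal_ofNat 9,
      ← ENNReal.ofReal_mul (by norm_num)] at h1
    have h2 : (b : ℝ) < 9 * ∑ x ∈ X, w x := (ENNReal.ofReal_lt_ofReal_iff_of_nonneg b.2).1 h1
    linarith
  set W := ∑ x ∈ X, w x with hWdef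
  have hW0 : 0 < W := by linarith
  refine ⟨X, hXK, fun x => w x / W, fun x => div_nonneg (hw0 x) hW0.le, ?_, fun i hi q => ?_⟩
  · rw [← Finset.sum_div, div_self hW0.ne']
  · rw [← Finset.sum_div, div_le_iff₀ hW0]
    refine (hw i hi q).trans ?_
    have h2 : 1 ≤ 9 / b * W := by
      rw [div_mul_eq_mul_div, le_div_iff₀ hb0]
      linarith
    have h3 : 0 < (2 : ℝ) ^ (-(t * i)) := by positivity
    nlinarith

theorem exists_two_rpow_near {u d η : ℝ} (hu : 0 < u) (hd : 0 ≤ d) (hd1 : d ≤ 1 / 2) (hη : 0 < η) :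
    ∃ k : ℕ, d < (2 : ℝ) ^ (-(k : ℝ)) ∧ (2 : ℝ) ^ (-(u * k)) ≤ 4 ^ u * d ^ u + η := by
  rcases hd.eq_or_lt with rfl | hd0
  · obtain ⟨k, hk⟩ := exists_pow_lt_of_lt_one hη
      (Real.rpow_lt_one_of_one_lt_of_neg one_lt_two (neg_lt_zero.2 hu) : (2 : ℝ) ^ (-u) < 1)
    refine ⟨k, by positivity, ?_⟩
    rw [← Real.rpow_natCast, ← Real.rpow_mul two_pos.le, neg_mul] at hk
    rw [Real.zero_rpow hu.ne', mul_zero, zero_add]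
    exact hk.le
  · obtain ⟨k, hk1, hk2⟩ := exists_nat_pow_near_of_lt_one (x := 2 * d) (y := (1 / 2 : ℝ))
      (by linarith) (by linarith) (by norm_num) (by norm_num)
    have hk : (2 : ℝ) ^ (-(k : ℝ)) = (1 / 2) ^ k := by
      rw [Real.rpow_neg two_pos.le, Real.rpow_natCast, one_div, inv_pow]
    refine ⟨k, by rw [hk]; linarith, ?_⟩
    have h1 : (2 : ℝ) ^ (-(k : ℝ)) ≤ 4 * d := by
      rw [hk]
      rw [pow_succ] at hk1
      linarith
    calc (2 : ℝ) ^ (-(u * k)) = ((2 : ℝ) ^ (-(k : ℝ))) ^ u := by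
          rw [← Real.rpow_mul two_pos.le]; congr 1; ring
      _ ≤ (4 * d) ^ u := Real.rpow_le_rpow (by positivity) h1 hu.le
      _ = 4 ^ u * d ^ u := Real.mul_rpow (by norm_num) hd
      _ ≤ _ := by linarith

/-- A compact null set for the `u`-dimensional Hausdorff measure on the line has efficient finite
covers by dyadic-length intervals. -/
theorem exists_finite_cover_of_hausdorffMeasure_eq_zero {u : ℝ} (hu : 0 < u) {S : Set ℝ}
    (hS : IsCompact S) (h0 : μH[u] S = 0) {ε : ℝ} (hε : 0 < ε) :
    ∃ (T : Finset ℕ) (k : ℕ → ℕ) (r : ℕ → ℝ),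
      (∀ s ∈ S, ∃ i ∈ T, |s - r i| ≤ (2 : ℝ) ^ (-(k i : ℝ))) ∧
      ∑ i ∈ T, (2 : ℝ) ^ (-(u * k i)) < ε := by
  rw [Measure.hausdorffMeasure_apply] at h0
  set a : ℝ := ε / (2 * 4 ^ u) with ha
  have ha0 : 0 < a := by positivity
  have h1 : (⨅ (t : ℕ → Set ℝ) (_ : S ⊆ ⋃ n, t n)
      (_ : ∀ n, Metric.ediam (t n) ≤ ENNReal.ofReal (1 / 2)),
      ∑' n, ⨆ _ : (t n).Nonempty, Metric.ediam (t n) ^ u) < ENNReal.ofReal a := by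
    refine lt_of_le_of_lt ?_ (ENNReal.ofReal_pos.2 ha0)
    rw [← h0]
    exact le_iSup₂ (f := fun (r : ℝ≥0∞) (_ : 0 < r) =>
      ⨅ (t : ℕ → Set ℝ) (_ : S ⊆ ⋃ n, t n) (_ : ∀ n, Metric.ediam (t n) ≤ r),
        ∑' n, ⨆ _ : (t n).Nonempty, Metric.ediam (t n) ^ u)
      (ENNReal.ofReal (1 / 2)) (ENNReal.ofReal_pos.2 (by norm_num))
  simp only [iInf_lt_iff] at h1
  obtain ⟨t, hcov, hdiam, hsum⟩ := h1
  obtain ⟨η, hη, hηsum⟩ := ENNReal.exists_pos_sum_of_countable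
    (ENNReal.ofReal_pos.2 (half_pos hε)).ne' ℕ
  have hex : ∀ n, ∃ (k : ℕ) (r : ℝ), t n ⊆ Metric.ball r ((2 : ℝ) ^ (-(k : ℝ))) ∧
      ENNReal.ofReal ((2 : ℝ) ^ (-(u * k))) ≤
        ENNReal.ofReal (4 ^ u) * (⨆ _ : (t n).Nonempty, Metric.ediam (t n) ^ u) + η n := by
    intro n
    have hη' : (0 : ℝ) < η n := hη n
    rcases (t n).eq_empty_or_nonempty with he | hne
    · obtain ⟨k, -, hk⟩ := exists_two_rpow_near hu le_rfl (by norm_num) hη'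
      rw [Real.zero_rpow hu.ne', mul_zero, zero_add] at hk
      refine ⟨k, 0, by simp [he], ?_⟩
      rw [← ENNReal.ofReal_coe_nnreal (p := η n)]
      exact (ENNReal.ofReal_le_ofReal hk).trans le_add_self
    · have hfin : Metric.ediam (t n) ≠ ⊤ := ((hdiam n).trans_lt ENNReal.ofReal_lt_top).ne
      have hd : Metric.diam (t n) ≤ 1 / 2 := ENNReal.toReal_le_of_le_ofReal (by norm_num) (hdiam n)
      obtain ⟨k, hk1, hk2⟩ := exists_two_rpow_near hu Metric.diam_nonneg hd hη'
      obtain ⟨r, hr⟩ := hne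
      refine ⟨k, r, fun x hx => ?_, ?_⟩
      · exact (Metric.dist_le_diam_of_mem' hfin hx hr).trans_lt hk1
      · rw [iSup_pos ⟨r, hr⟩]
        refine (ENNReal.ofReal_le_ofReal hk2).trans_eq ?_
        rw [ENNReal.ofReal_add (by positivity) hη'.le, ENNReal.ofReal_mul (by positivity),
          ENNReal.ofReal_coe_nnreal, ← ENNReal.ofReal_rpow_of_nonneg Metric.diam_nonneg hu.le,
          Metric.diam, ENNReal.ofReal_toReal hfin]
  choose k r hball hk using hex
  obtain ⟨T, hT⟩ := hS.elim_finite_subcover (fun n => Metric.ball (r n) ((2 : ℝ) ^ (-(k n : ℝ))))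
    (fun n => Metric.isOpen_ball) (hcov.trans (iUnion_mono hball))
  refine ⟨T, k, r, fun s hs => ?_, ?_⟩
  · obtain ⟨i, hi, hsi⟩ := mem_iUnion₂.1 (hT hs)
    exact ⟨i, hi, (Metric.mem_ball.1 hsi).le⟩
  · refine (ENNReal.ofReal_lt_ofReal_iff hε).1 ?_
    rw [ENNReal.ofReal_sum_of_nonneg fun i _ => by positivity]
    calc _ ≤ ∑' n, (ENNReal.ofReal (4 ^ u) *
          (⨆ _ : (t n).Nonempty, Metric.ediam (t n) ^ u) + η n) :=
          (Finset.sum_le_sum fun i _ => hk i).trans (ENNReal.sum_le_tsum _)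
      _ = ENNReal.ofReal (4 ^ u) * (∑' n, ⨆ _ : (t n).Nonempty, Metric.ediam (t n) ^ u) +
          ∑' n, (η n : ℝ≥0∞) := by rw [ENNReal.tsum_add, ENNReal.tsum_mul_left]
      _ < ENNReal.ofReal (4 ^ u) * ENNReal.ofReal a + ENNReal.ofReal (ε / 2) := by
          refine ENNReal.add_lt_add ?_ hηsum
          exact ENNReal.mul_lt_mul_right (ENNReal.ofReal_pos.2 (by positivity)).ne'
            ENNReal.ofReal_ne_top hsum
      _ = ENNReal.ofReal ε := by
          rw [← ENNReal.ofReal_mul (by positivity), ← ENNReal.ofReal_add (by positivity)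
            (by positivity), ha]
          congr 1
          field_simp
          ring

theorem exists_one_div_sq_le_mass {ι κ : Type*} [DecidableEq ι] {P : Finset κ} {m : κ → ℝ}
    {k : ι → ℕ}
    {T : Finset ι} (hk : ∀ i ∈ T, 2 ≤ k i) (hm : ∀ p, 0 ≤ m p) (h1 : ∑ p ∈ P, m p = 1)
    (near : ι → κ → Prop) (hcov : ∀ p ∈ P, ∃ i ∈ T, near i p) :
    ∃ i ∈ T, ∃ G ⊆ P, (∀ p ∈ G, ∃ j ∈ T, k j = k i ∧ near j p) ∧
      1 / (k i : ℝ) ^ 2 ≤ ∑ p ∈ G, m p := by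
  classical
  by_contra! h
  set G : ℕ → Finset κ := fun l => P.filter fun p => ∃ j ∈ T, k j = l ∧ near j p with hG
  have hlt : ∀ l ∈ T.image k, ∑ p ∈ G l, m p < ((l : ℝ) ^ 2)⁻¹ := by
    intro l hl
    obtain ⟨i, hi, rfl⟩ := Finset.mem_image.1 hl
    rw [← one_div]
    exact h i hi (G (k i)) (Finset.filter_subset _ _) fun p hp => (Finset.mem_filter.1 hp).2
  have hP : ∀ p ∈ P, m p ≤ ∑ l ∈ T.image k, if ∃ j ∈ T, k j = l ∧ near j p then m p else 0 := by
    intro p hp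
    obtain ⟨i, hi, hip⟩ := hcov p hp
    have h2 := Finset.single_le_sum
      (f := fun l => if ∃ j ∈ T, k j = l ∧ near j p then m p else 0)
      (fun l _ => by split_ifs <;> simp [hm p]) (Finset.mem_image_of_mem k hi)
    simp only [if_pos (show ∃ j ∈ T, k j = k i ∧ near j p from ⟨i, hi, rfl, hip⟩)] at h2
    exact h2
  have hne : (T.image k).Nonempty := by
    rw [Finset.image_nonempty]
    obtain ⟨p, hp, -⟩ := Finset.exists_ne_zero_of_sum_ne_zero (h1.trans_ne one_ne_zero)
    obtain ⟨i, hi, -⟩ := hcov p hp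
    exact ⟨i, hi⟩
  set N := (T.image k).sup id + 1 with hN
  have hsub : T.image k ⊆ Finset.Ioc 1 N := fun l hl => by
    obtain ⟨i, hi, rfl⟩ := Finset.mem_image.1 hl
    refine Finset.mem_Ioc.2 ⟨hk i hi, ?_⟩
    exact (Finset.le_sup (f := id) hl).trans (Nat.le_succ _)
  have h2 : ∑ l ∈ Finset.Ioc 1 N, ((l : ℝ) ^ 2)⁻¹ ≤ (1 : ℝ) := by
    have := sum_Ioc_inv_sq_le_sub (α := ℝ) one_ne_zero (show 1 ≤ N by omega)
    have h3 : (0 : ℝ) ≤ (N : ℝ)⁻¹ := by positivity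
    simp only [Nat.cast_one, inv_one] at this
    linarith
  have h3 : (1 : ℝ) < 1 := calc
    (1 : ℝ) = ∑ p ∈ P, m p := h1.symm
    _ ≤ ∑ p ∈ P, ∑ l ∈ T.image k, if ∃ j ∈ T, k j = l ∧ near j p then m p else 0 :=
        Finset.sum_le_sum hP
    _ = ∑ l ∈ T.image k, ∑ p ∈ G l, m p := by
        rw [Finset.sum_comm]
        exact Finset.sum_congr rfl fun l _ => (Finset.sum_filter _ _).symm
    _ < ∑ l ∈ T.image k, ((l : ℝ) ^ 2)⁻¹ := Finset.sum_lt_sum_of_nonempty hne hlt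
    _ ≤ ∑ l ∈ Finset.Ioc 1 N, ((l : ℝ) ^ 2)⁻¹ :=
        Finset.sum_le_sum_of_subset_of_nonneg hsub fun l _ _ => by positivity
    _ ≤ 1 := h2
  exact lt_irrefl _ h3

/-- The distances between two separated analytic sets of positive `t`-dimensional measure have
positive `u`-dimensional measure. -/
theorem hausdorffMeasure_dist_image_prod_ne_zero {t u d : ℝ} (ht1 : 1 < t) (ht2 : t < 2)
    (hu0 : 0 < u) (hu : u < 1 - (2 - t) ^ 2 / (2 * (1 + t))) (hd : 0 < d) {A B : Set ℂ}
    (hA : AnalyticSet A) (hB : AnalyticSet B) (hA0 : μH[t] A ≠ 0) (hB0 : μH[t] B ≠ 0)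
    (hA1 : ∀ x ∈ A, cell 1 x = 0) (hB1 : ∀ y ∈ B, cell 1 y = 0)
    (hAB : ∀ x ∈ A, ∀ y ∈ B, d ≤ dist x y) :
    μH[u] ((fun p : ℂ × ℂ => dist p.1 p.2) '' (A ×ˢ B)) ≠ 0 := by
  classical
  intro h0
  obtain ⟨K, hKA, hK, C, hC, hKX⟩ := exists_compact_frostman (by linarith) hA hA0
  obtain ⟨L, hLB, hL, C', hC', hLY⟩ := exists_compact_frostman (by linarith) hB hB0
  obtain ⟨k₀, hk₀⟩ := exists_forall_rpow_le_card (C₀ := max C C') ht1 ht2 hu0 hu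
    (hC.trans (le_max_left _ _)) hd
  have hcont : Continuous fun p : ℂ × ℂ => dist p.1 p.2 := by fun_prop
  have hnull : μH[u] ((fun p : ℂ × ℂ => dist p.1 p.2) '' (K ×ˢ L)) = 0 :=
    measure_mono_null (image_mono (prod_mono hKA hLB)) h0
  set l := max k₀ 2 with hl
  have hε : (2 : ℝ) ^ (-(u * l)) ≤ 1 :=
    Real.rpow_le_one_of_one_le_of_nonpos one_le_two (by
      rw [neg_nonpos]; positivity)
  obtain ⟨T, k, r, hcov, hsum⟩ := exists_finite_cover_of_hausdorffMeasure_eq_zero hu0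
    ((hK.prod hL).image hcont) hnull (ε := (2 : ℝ) ^ (-(u * l))) (by positivity)
  have hkl : ∀ i ∈ T, l ≤ k i := fun i hi => by
    have h1 := (Finset.single_le_sum (f := fun i => (2 : ℝ) ^ (-(u * k i)))
      (fun i _ => by positivity) hi).trans_lt hsum
    rw [Real.rpow_lt_rpow_left_iff one_lt_two, neg_lt_neg_iff, mul_lt_mul_iff_right₀ hu0] at h1
    exact_mod_cast h1.le
  obtain ⟨X, hXK, μ, hμ0, hμ1, hμ⟩ := hKX (T.sup k)
  obtain ⟨Y, hYL, ν, hν0, hν1, hν⟩ := hLY (T.sup k)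
  obtain ⟨i, hi, G, hG, hGT, hGm⟩ := exists_one_div_sq_le_mass (P := X ×ˢ Y)
    (m := fun p => μ p.1 * ν p.2) (fun i hi => (le_max_right _ _).trans (hkl i hi))
    (fun p => mul_nonneg (hμ0 _) (hν0 _))
    (by rw [Finset.sum_product, ← Finset.sum_mul_sum, hμ1, hν1, one_mul])
    (fun i p => |dist p.1 p.2 - r i| ≤ (2 : ℝ) ^ (-(k i : ℝ)))
    (fun p hp => hcov _ (mem_image_of_mem _
      ⟨hXK (Finset.mem_product.1 hp).1, hYL (Finset.mem_product.1 hp).2⟩))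
  have hik : k i ≤ T.sup k := Finset.le_sup hi
  set S := T.filter fun j => k j = k i with hS
  have hmass : ∀ (D : ℝ) (j : ℕ), D ≤ max C C' → D * (2 : ℝ) ^ (-(t * j)) ≤
      max C C' * (2 : ℝ) ^ (-(t * j)) := fun D j h => by gcongr
  have hcard := hk₀ (k i) ((le_max_left _ _).trans (hkl i hi)) X Y μ ν hμ0 hν0 hμ1 hν1
    (fun x hx => hA1 x (hKA (hXK hx))) (fun y hy => hB1 y (hLB (hYL hy)))
    (fun x hx y hy => by
      rw [← dist_eq_norm]; exact hAB x (hKA (hXK hx)) y (hLB (hYL hy)))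
    (fun j hj q => by
      refine le_trans ?_ (hmass C j (le_max_left _ _))
      exact hμ j (hj.trans hik) q)
    (fun j hj q => by
      refine le_trans ?_ (hmass C' j (le_max_right _ _))
      exact hν j (hj.trans hik) q)
    G hG hGm (S.image r) (fun p hp => by
      obtain ⟨j, hj, hji, hjp⟩ := hGT p hp
      rw [dist_eq_norm, hji] at hjp
      exact ⟨r j, Finset.mem_image_of_mem _ (Finset.mem_filter.2 ⟨hj, hji⟩), hjp⟩)
  have hcard' : (2 : ℝ) ^ (u * k i) ≤ S.card :=
    hcard.trans (by exact_mod_cast Finset.card_image_le)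
  have hlow : (1 : ℝ) ≤ ∑ j ∈ T, (2 : ℝ) ^ (-(u * k j)) := calc
    (1 : ℝ) = (2 : ℝ) ^ (u * k i) * (2 : ℝ) ^ (-(u * k i)) := by
        rw [← Real.rpow_add two_pos, add_neg_cancel, Real.rpow_zero]
    _ ≤ S.card * (2 : ℝ) ^ (-(u * k i)) := by gcongr
    _ = ∑ j ∈ S, (2 : ℝ) ^ (-(u * k j)) := by
        rw [Finset.sum_congr rfl fun j hj => by rw [(Finset.mem_filter.1 hj).2],
          Finset.sum_const, nsmul_eq_mul]
    _ ≤ _ := Finset.sum_le_sum_of_subset_of_nonneg (Finset.filter_subset _ _)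
        fun j _ _ => by positivity
  linarith

theorem cell_one_eq_zero {z : ℂ} (hz : dist z ⟨1 / 2, 1 / 2⟩ < 1 / 2) : cell 1 z = 0 := by
  rw [dist_eq_norm] at hz
  have h1 := abs_lt.1 ((Complex.abs_re_le_norm _).trans_lt hz)
  have h2 := abs_lt.1 ((Complex.abs_im_le_norm _).trans_lt hz)
  simp only [Complex.sub_re, Complex.sub_im] at h1 h2
  rw [cell, Nat.cast_one, one_mul, one_mul]
  refine Prod.ext (Int.floor_eq_zero_iff.2 ⟨?_, ?_⟩) (Int.floor_eq_zero_iff.2 ⟨?_, ?_⟩) <;>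
    linarith

theorem hausdorffMeasure_dist_image_ne_zero {t u : ℝ} (ht1 : 1 < t) (ht2 : t < 2)
    (hu0 : 0 < u) (hu : u < 1 - (2 - t) ^ 2 / (2 * (1 + t))) {A : Set ℂ} (hA : MeasurableSet A)
    (hA0 : μH[t] A ≠ 0) : μH[u] ((fun p : ℂ × ℂ => dist p.1 p.2) '' (A ×ˢ A)) ≠ 0 := by
  have := Measure.nullSingletonClass_hausdorff ℂ (show 0 < t by linarith)
  obtain ⟨x, hx, hxA⟩ := exists_mem_forall_mem_nhdsWithin_pos_measure hA0
  set A' := (A ∩ Metric.ball x (1 / 4)) \ {x} with hA'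
  have hA'0 : μH[t] A' ≠ 0 := by
    rw [measure_sdiff_null (measure_singleton x)]
    exact (hxA _ (Filter.inter_mem self_mem_nhdsWithin
      (mem_nhdsWithin_of_mem_nhds (Metric.ball_mem_nhds x (by norm_num))))).ne'
  obtain ⟨y, hy, hyA⟩ := exists_mem_forall_mem_nhdsWithin_pos_measure hA'0
  have hyx : 0 < dist y x := dist_pos.2 hy.2
  have hyx' : dist y x < 1 / 4 := hy.1.2
  set ρ := dist y x / 4 with hρ
  have hρ0 : 0 < ρ := by positivity
  set e : ℂ ≃ᵢ ℂ := IsometryEquiv.addRight (⟨1 / 2, 1 / 2⟩ - x) with he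
  have hex : e x = ⟨1 / 2, 1 / 2⟩ := add_sub_cancel x _
  have hBA : A' ∩ Metric.ball y ρ ⊆ A := fun z hz => hz.1.1.1
  have hA'm : MeasurableSet A' := (hA.inter measurableSet_ball).diff (measurableSet_singleton x)
  refine fun h0 => hausdorffMeasure_dist_image_prod_ne_zero ht1 ht2 hu0 hu
    (d := 2 * ρ) (by positivity)
    ((hA.inter (measurableSet_ball (x := x) (ε := ρ))).analyticSet.image_of_continuous
      e.continuous)
    ((hA'm.inter (measurableSet_ball (x := y) (ε := ρ))).analyticSet.image_of_continuous
      e.continuous) ?_ ?_ ?_ ?_ ?_ (measure_mono_null ?_ h0)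
  · rw [e.hausdorffMeasure_image]
    exact (hxA _ (Filter.inter_mem self_mem_nhdsWithin
      (mem_nhdsWithin_of_mem_nhds (Metric.ball_mem_nhds x hρ0)))).ne'
  · rw [e.hausdorffMeasure_image]
    exact (hyA _ (Filter.inter_mem self_mem_nhdsWithin
      (mem_nhdsWithin_of_mem_nhds (Metric.ball_mem_nhds y hρ0)))).ne'
  · rintro _ ⟨z, hz, rfl⟩
    refine cell_one_eq_zero ?_
    rw [← hex, e.dist_eq]
    have : dist z x < ρ := hz.2
    linarith
  · rintro _ ⟨z, hz, rfl⟩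
    refine cell_one_eq_zero ?_
    rw [← hex, e.dist_eq]
    have : dist z x < 1 / 4 := hz.1.1.2
    linarith
  · rintro _ ⟨z, hz, rfl⟩ _ ⟨w, hw, rfl⟩
    rw [e.dist_eq]
    have h1 : dist z x < ρ := hz.2
    have h2 : dist w y < ρ := hw.2
    have h3 := dist_triangle4 y w z x
    rw [dist_comm y w, dist_comm w z] at h3
    linarith
  · rintro _ ⟨⟨_, _⟩, ⟨⟨z, hz, rfl⟩, w, hw, rfl⟩, rfl⟩
    exact ⟨(z, w), ⟨hz.1, hBA hw⟩, (e.dist_eq z w).symm⟩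

theorem distance_bound_lt {s : ℝ} (hs1 : 1 < s) (hs2 : s < 4 / 3) :
    s * (147 - 170 * s + 60 * s ^ 2) / (18 * (12 - 14 * s + 5 * s ^ 2)) <
      1 - (2 - s) ^ 2 / (2 * (1 + s)) := by
  have h1 : 0 < 12 - 14 * s + 5 * s ^ 2 := by nlinarith [sq_nonneg (s - 7 / 5)]
  have h2 : 0 < 1 + s := by linarith
  rw [one_sub_div (by positivity), div_lt_div_iff₀ (by positivity) (by positivity)]
  obtain ⟨x, rfl⟩ : ∃ x, s = 1 + x := ⟨s - 1, by ring⟩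
  have hx : 0 < x := by linarith
  have hx' : x < 1 / 3 := by linarith
  nlinarith [mul_pos hx (sub_pos.2 hx'), mul_pos (mul_pos hx hx) (sub_pos.2 hx'),
    mul_pos (mul_pos (mul_pos hx hx) hx) (sub_pos.2 hx'), sq_nonneg x]

theorem le_distance_bound {s : ℝ} (hs1 : 1 < s) (hs2 : s < 4 / 3) :
    37 / 54 ≤ s * (147 - 170 * s + 60 * s ^ 2) / (18 * (12 - 14 * s + 5 * s ^ 2)) := by
  have h1 : 0 < 12 - 14 * s + 5 * s ^ 2 := by nlinarith [sq_nonneg (s - 7 / 5)]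
  rw [div_le_div_iff₀ (by norm_num) (by positivity)]
  obtain ⟨x, rfl⟩ : ∃ x, s = 1 + x := ⟨s - 1, by ring⟩
  have hx : 0 < x := by linarith
  have hx' : x < 1 / 3 := by linarith
  nlinarith [mul_pos hx (sub_pos.2 hx'), mul_pos (mul_pos hx hx) (sub_pos.2 hx'), sq_nonneg x]

theorem hausdorffMeasure_dist_image_euclidean_ne_zero {t u : ℝ} (ht1 : 1 < t) (ht2 : t < 2)
    (hu0 : 0 < u) (hu : u < 1 - (2 - t) ^ 2 / (2 * (1 + t)))
    {A : Set (EuclideanSpace ℝ (Fin 2))} (hA : MeasurableSet A) (hA0 : μH[t] A ≠ 0) :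
    μH[u] ((fun p : EuclideanSpace ℝ (Fin 2) × EuclideanSpace ℝ (Fin 2) => dist p.1 p.2) ''
      (A ×ˢ A)) ≠ 0 := by
  set e := Complex.orthonormalBasisOneI.repr.symm.toIsometryEquiv with he
  have hm : MeasurableSet (e '' A) := e.toHomeomorph.measurableEmbedding.measurableSet_image' hA
  have h := hausdorffMeasure_dist_image_ne_zero ht1 ht2 hu0 hu hm
    (by rwa [e.hausdorffMeasure_image])
  refine fun h0 => h (measure_mono_null ?_ h0)
  rintro _ ⟨⟨_, _⟩, ⟨⟨z, hz, rfl⟩, w, hw, rfl⟩, rfl⟩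
  exact ⟨(z, w), ⟨hz, hw⟩, (e.dist_eq z w).symm⟩

end Hausdorff

/-- **Theorem.** If `A ⊆ ℝ²` is Borel with `dimH A = s ∈ (1, 4/3)`, then the distance set
`Δ(A) = {|x-y| : x, y ∈ A}` satisfies
`dimH Δ(A) ≥ s(147 - 170s + 60s²) / (18(12 - 14s + 5s²))`, and this lower bound is `≥ 37/54`. -/
theorem statement3 (A : Set (EuclideanSpace ℝ (Fin 2))) (hA : MeasurableSet A) (s : ℝ)
    (hs1 : 1 < s) (hs2 : s < 4 / 3) (hdim : dimH A = ENNReal.ofReal s) :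
    ENNReal.ofReal (s * (147 - 170 * s + 60 * s ^ 2) / (18 * (12 - 14 * s + 5 * s ^ 2))) ≤
      dimH ((fun p : EuclideanSpace ℝ (Fin 2) × EuclideanSpace ℝ (Fin 2) =>
        dist p.1 p.2) '' (A ×ˢ A)) ∧
    (37 / 54 : ℝ) ≤ s * (147 - 170 * s + 60 * s ^ 2) / (18 * (12 - 14 * s + 5 * s ^ 2)) := by
  refine ⟨?_, le_distance_bound hs1 hs2⟩
  have hlt := distance_bound_lt hs1 hs2
  have hle := le_distance_bound hs1 hs2
  set u := s * (147 - 170 * s + 60 * s ^ 2) / (18 * (12 - 14 * s + 5 * s ^ 2)) with hu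
  have hu0 : 0 < u := by linarith
  have hcont : ContinuousAt (fun t : ℝ => 1 - (2 - t) ^ 2 / (2 * (1 + t))) s := by
    refine continuousAt_const.sub (ContinuousAt.div (by fun_prop) (by fun_prop) ?_)
    linarith
  obtain ⟨t, ht, ht1, hts⟩ := ((hcont.eventually (lt_mem_nhds hlt)).filter_mono
    nhdsWithin_le_nhds |>.and (Ioo_mem_nhdsLT hs1)).exists
  lift u to NNReal using hu0.le with v hv
  rw [ENNReal.ofReal_coe_nnreal]
  refine le_dimH_of_hausdorffMeasure_ne_zero
    (hausdorffMeasure_dist_image_euclidean_ne_zero ht1 (by linarith) hu0 ht hA ?_)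
  have hd : ((t.toNNReal : NNReal) : ENNReal) < dimH A := by
    rw [hdim]
    exact (ENNReal.ofReal_lt_ofReal_iff (by linarith)).2 hts
  have := hausdorffMeasure_of_lt_dimH hd
  rw [Real.coe_toNNReal t (by linarith)] at this
  rw [this]
  exact ENNReal.top_ne_zero
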